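/- arXiv:1604.06755 — 2 statements merged into one kernel-verified Lean document; each statement's English description precedes it below -/
import Mathlib

section
/- Let A = (2,1) and B = (2,1,1,3,1). Define T_0 = B and, for k ≥ 1, T_k = T_{k−1} A^k T_{k−1} (concatenation). Let T be the infinite sequence of positive integers having each T_k as a prefix. Then the real number τ = [T] = [2,1,1,3,1,2,1,2,1,1,3,1,2,1,2,1,2,1,1,3,1,2,1,…] is transcendental, and T is 2-palindromic. -/
/-- Value of a finite continued fraction `[a₀, a₁, …, a_i] = a₀ + 1/(a₁ + 1/(⋯ + 1/a_i))`. -/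
noncomputable def cfVal : List ℕ → ℝ
  | [] => 0
  | [a] => (a : ℝ)
  | a :: b :: rest => (a : ℝ) + 1 / cfVal (b :: rest)

/-- `A` is an `m`-palindrome: `[A] = m·[Ã]`, where `Ã` is the reversal of `A`. -/
def IsMPal (m : ℕ) (A : List ℕ) : Prop := cfVal A = (m : ℝ) * cfVal A.reverse

/-- The prefix `(a₀, …, a_i)` of an infinite sequence of partial quotients. -/
def cfPrefix (a : ℕ → ℕ) (i : ℕ) : List ℕ := (List.range (i + 1)).map a

/-- Continuant numerators, index-shifted: `contP a (k+1) = p_k`, `contP a 0 = p₋₁ = 1`. -/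
def contP (a : ℕ → ℕ) : ℕ → ℤ
  | 0 => 1
  | 1 => (a 0 : ℤ)
  | (k+2) => (a (k+1) : ℤ) * contP a (k+1) + contP a k

/-- Continuant denominators, index-shifted: `contQ a (k+1) = q_k`, `contQ a 0 = q₋₁ = 0`. -/
def contQ (a : ℕ → ℕ) : ℕ → ℤ
  | 0 => 0
  | 1 => 1
  | (k+2) => (a (k+1) : ℤ) * contQ a (k+1) + contQ a k

/-- Concatenation of `k` copies of the finite sequence `A`. -/
def listPow (A : List ℕ) (k : ℕ) : List ℕ := (List.replicate k A).flatten

/-- `x` is a quadratic irrational. -/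
def IsQuadraticIrrational (x : ℝ) : Prop :=
  Irrational x ∧ ∃ a b c : ℤ, a ≠ 0 ∧ (a : ℝ) * x ^ 2 + (b : ℝ) * x + (c : ℝ) = 0

/-- `x` is a reduced quadratic irrational: `x > 1` and its algebraic (Galois) conjugate
lies strictly between `-1` and `0`. -/
def IsReducedQuadIrr (x : ℝ) : Prop :=
  Irrational x ∧ 1 < x ∧
    ∃ a b c : ℤ, a ≠ 0 ∧ (a : ℝ) * x ^ 2 + (b : ℝ) * x + (c : ℝ) = 0 ∧
      ∀ y : ℝ, y ≠ x → (a : ℝ) * y ^ 2 + (b : ℝ) * y + (c : ℝ) = 0 → -1 < y ∧ y < 0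

/-- `x` and `y` are equivalent: `x = (a + b·y)/(c + d·y)` for integers with `ad - bc = ±1`. -/
def RealEquiv (x y : ℝ) : Prop :=
  ∃ a b c d : ℤ, (a * d - b * c = 1 ∨ a * d - b * c = -1) ∧
    ((c : ℝ) + (d : ℝ) * y ≠ 0) ∧ x = ((a : ℝ) + (b : ℝ) * y) / ((c : ℝ) + (d : ℝ) * y)

namespace PowerSeries

variable {F : Type*} [Field F]

/-- Division of `f - f(0)` by `X`. -/
noncomputable def shift (f : F⟦X⟧) : F⟦X⟧ := mk fun p => coeff (p + 1) f

lemma eq_C_add_X_mul_shift (f : F⟦X⟧) : f = C (constantCoeff f) + X * shift f := by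
  rw [add_comm]; exact eq_X_mul_shift_add_const f

lemma subst_eq_add_mul_subst_shift {V : F⟦X⟧} (hV : constantCoeff V = 0) (f : F⟦X⟧) :
    subst V f = C (constantCoeff f) + V * subst V (shift f) := by
  have h : HasSubst V := HasSubst.of_constantCoeff_zero' hV
  conv_lhs => rw [eq_C_add_X_mul_shift f]
  rw [subst_add h, subst_mul h, subst_X h]
  congr 1
  exact subst_C _

lemma X_pow_dvd_subst_sub_of_dvd_sub {V : F⟦X⟧} (hV : X ^ 2 ∣ V) {f g : F⟦X⟧} {n : ℕ}
    (h : X ^ n ∣ f - g) : X ^ (2 * n) ∣ subst V f - subst V g := by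
  have hV0 : constantCoeff V = 0 := X_dvd_iff.1 ((dvd_pow_self X two_ne_zero).trans hV)
  have hs : HasSubst V := HasSubst.of_constantCoeff_zero' hV0
  obtain ⟨q, hq⟩ := h
  have : subst V f - subst V g = V ^ n * subst V q := by
    rw [← subst_sub hs, hq, subst_mul hs, subst_pow hs, subst_X hs]
  rw [this, pow_mul]
  exact Dvd.dvd.mul_right (pow_dvd_pow_of_dvd hV n) _

lemma X_pow_dvd_subst_sub_subst {V W : F⟦X⟧} (hV : constantCoeff V = 0)
    (hW : constantCoeff W = 0) {m : ℕ} (h : X ^ m ∣ V - W) (f : F⟦X⟧) :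
    X ^ m ∣ subst V f - subst W f := by
  have key : ∀ M : ℕ, ∀ f : F⟦X⟧, X ^ (min m M) ∣ subst V f - subst W f := by
    intro M
    induction M with
    | zero => intro f; simp
    | succ M ih =>
      intro f
      have e : subst V f - subst W f = (V - W) * subst V (shift f)
          + W * (subst V (shift f) - subst W (shift f)) := by
        rw [subst_eq_add_mul_subst_shift hV f, subst_eq_add_mul_subst_shift hW f]; ring
      rw [e]
      refine dvd_add (Dvd.dvd.mul_right ((pow_dvd_pow X (min_le_left _ _)).trans h) _) ?_
      have h1 : (X : F⟦X⟧) ^ (min m M + 1) ∣ W * (subst V (shift f) - subst W (shift f)) := by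
        rw [pow_succ']
        exact mul_dvd_mul (X_dvd_iff.2 hW) (ih _)
      exact (pow_dvd_pow X (by omega)).trans h1
  simpa using key m f

/-- The series `1 / (1 + z + θ - X)`. -/
noncomputable def invFactor (z : F) (θ : F⟦X⟧) : F⟦X⟧ := (1 + C z + θ - X)⁻¹

/-- The series `X² / (L (1 + z + θ - X)²)`. -/
noncomputable def nextParam (z L : F) (θ : F⟦X⟧) : F⟦X⟧ :=
  X ^ 2 * (C L⁻¹ * invFactor z θ ^ 2)

/-- The functional equation of the invariant curve attached to `z ↦ σ z`. -/
def IsInvariantCurve (σ : F →+* F) (z L : F) (θ : F⟦X⟧) : Prop :=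
  constantCoeff θ = 0 ∧ θ = C L * subst (nextParam z L θ) (map σ θ)
    + X * (1 - (C z + θ)) * invFactor z θ

lemma invFactor_mul {z : F} (hz : 1 + z ≠ 0) {θ : F⟦X⟧} (hθ : constantCoeff θ = 0) :
    invFactor z θ * (1 + C z + θ - X) = 1 := by
  apply PowerSeries.inv_mul_cancel
  simpa [hθ] using hz

lemma X_sq_dvd_nextParam (z L : F) (θ : F⟦X⟧) : X ^ 2 ∣ nextParam z L θ := Dvd.intro _ rfl

lemma constantCoeff_nextParam (z L : F) (θ : F⟦X⟧) : constantCoeff (nextParam z L θ) = 0 := by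
  simp [nextParam]

lemma X_pow_dvd_map_sub (σ : F →+* F) {f g : F⟦X⟧} {n : ℕ} (h : X ^ n ∣ f - g) :
    X ^ n ∣ map σ f - map σ g := by
  obtain ⟨q, hq⟩ := h
  exact ⟨map σ q, by rw [← map_sub, hq, map_mul, map_pow, map_X]⟩

lemma exists_isInvariantCurve (σ : F →+* F) {z L : F} (hz : 1 + z ≠ 0) :
    ∃ θ : F⟦X⟧, IsInvariantCurve σ z L θ := by
  set Φ : F⟦X⟧ → F⟦X⟧ := fun θ => C L * subst (nextParam z L θ) (map σ θ)
    + X * (1 - (C z + θ)) * invFactor z θ with hΦ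
  have hcc : ∀ f, constantCoeff f = 0 → constantCoeff (Φ f) = 0 := by
    intro f hf
    simp only [hΦ, map_add, map_mul, constantCoeff_X, zero_mul, add_zero]
    rw [subst_eq_add_mul_subst_shift (constantCoeff_nextParam z L f)]
    have : constantCoeff (map σ f) = 0 := by
      rw [← coeff_zero_eq_constantCoeff_apply, coeff_map, coeff_zero_eq_constantCoeff_apply, hf,
        map_zero]
    simp [constantCoeff_nextParam, this]
  have hcontr : ∀ n, 1 ≤ n → ∀ f g, constantCoeff f = 0 → constantCoeff g = 0 →
      X ^ n ∣ f - g → X ^ (n + 1) ∣ Φ f - Φ g := by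
    intro n hn f g hf hg h
    have hκ : X ^ n ∣ invFactor z f - invFactor z g := by
      have e : invFactor z f - invFactor z g = (f - g) * (-(invFactor z f * invFactor z g)) := by
        linear_combination invFactor z g * invFactor_mul hz hf
          - invFactor z f * invFactor_mul hz hg
      rw [e]; exact Dvd.dvd.mul_right h _
    have hV : X ^ (n + 1) ∣ nextParam z L f - nextParam z L g := by
      have e : nextParam z L f - nextParam z L g = X ^ 2 * ((invFactor z f - invFactor z g) *
          (C L⁻¹ * (invFactor z f + invFactor z g))) := by
        simp only [nextParam]; ring
      rw [e]
      refine (pow_dvd_pow X (show n + 1 ≤ 2 + n by omega)).trans ?_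
      rw [pow_add]
      exact mul_dvd_mul_left _ (Dvd.dvd.mul_right hκ _)
    have e : Φ f - Φ g =
        C L * ((subst (nextParam z L f) (map σ f) - subst (nextParam z L f) (map σ g))
          + (subst (nextParam z L f) (map σ g) - subst (nextParam z L g) (map σ g)))
        + X * ((invFactor z f - invFactor z g) * (1 - (C z + f))
          - (f - g) * invFactor z g) := by
      simp only [hΦ]; ring
    rw [e]
    refine dvd_add (Dvd.dvd.mul_left (dvd_add ?_ ?_) _) ?_
    · exact (pow_dvd_pow X (by omega)).trans
        (X_pow_dvd_subst_sub_of_dvd_sub (X_sq_dvd_nextParam z L f) (X_pow_dvd_map_sub σ h))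
    · exact X_pow_dvd_subst_sub_subst (constantCoeff_nextParam z L f)
        (constantCoeff_nextParam z L g) hV _
    · rw [pow_succ']
      exact mul_dvd_mul_left _ (dvd_sub (Dvd.dvd.mul_right hκ _) (Dvd.dvd.mul_right h _))
  set a : ℕ → F⟦X⟧ := fun n => Φ^[n] 0 with ha
  have ha1 : ∀ n, a (n + 1) = Φ (a n) := fun n => Function.iterate_succ_apply' Φ n 0
  have ha0 : ∀ n, constantCoeff (a n) = 0 := by
    intro n
    induction n with
    | zero => simp [ha]
    | succ n ih => rw [ha1]; exact hcc _ ih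
  have hstep : ∀ n, X ^ (n + 1) ∣ a (n + 1) - a n := by
    intro n
    induction n with
    | zero => rw [zero_add, pow_one, X_dvd_iff, map_sub, ha0, ha0, sub_zero]
    | succ n ih =>
      rw [ha1 (n + 1), ha1 n]
      rw [ha1 n] at ih
      exact hcontr (n + 1) (by omega) _ _ (hcc _ (ha0 n)) (ha0 n) ih
  have hlong : ∀ n m, n ≤ m → X ^ (n + 1) ∣ a m - a n := by
    intro n m hnm
    induction m, hnm using Nat.le_induction with
    | base => simp
    | succ m hm ih =>
      have e : a (m + 1) - a n = (a (m + 1) - a m) + (a m - a n) := by ring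
      rw [e]
      exact dvd_add ((pow_dvd_pow X (by omega)).trans (hstep m)) ih
  set θ : F⟦X⟧ := mk fun n => coeff n (a n) with hθ
  have hθa : ∀ n, X ^ (n + 1) ∣ θ - a n := by
    intro n
    rw [X_pow_dvd_iff]
    intro m hm
    have h1 := X_pow_dvd_iff.1 (hlong m n (by omega)) m (by omega)
    rw [map_sub] at h1 ⊢
    rw [hθ, coeff_mk]
    linear_combination -h1
  have hθ0 : constantCoeff θ = 0 := by
    rw [← coeff_zero_eq_constantCoeff_apply, hθ, coeff_mk, coeff_zero_eq_constantCoeff_apply, ha0]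
  refine ⟨θ, hθ0, ?_⟩
  have hfin : ∀ n, X ^ (n + 1) ∣ θ - Φ θ := by
    intro n
    have e : θ - Φ θ = (θ - a (n + 1)) - (Φ θ - Φ (a n)) := by rw [ha1]; ring
    rw [e]
    exact dvd_sub ((pow_dvd_pow X (by omega)).trans (hθa (n + 1)))
      ((pow_dvd_pow X (by omega)).trans
        (hcontr (n + 1) (by omega) _ _ hθ0 (ha0 n) (hθa n)))
  have : θ - Φ θ = 0 := by
    ext n
    exact X_pow_dvd_iff.1 (hfin n) n (by omega)
  exact sub_eq_zero.1 this

end PowerSeries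

namespace PowerSeries

variable {F : Type*} [Field F]

/-- The power series whose coefficients of index less than `N` lie in `R`. -/
def upTo (R : Subring F) (N : ℕ) : Subring F⟦X⟧ where
  carrier := {f | ∀ n < N, coeff n f ∈ R}
  mul_mem' := by
    intro f g hf hg n hn
    rw [coeff_mul]
    refine Subring.sum_mem _ fun p hp => ?_
    have := Finset.HasAntidiagonal.mem_antidiagonal.1 hp
    exact R.mul_mem (hf _ (by omega)) (hg _ (by omega))
  one_mem' := by
    intro n hn
    rw [coeff_one]
    split_ifs
    exacts [R.one_mem, R.zero_mem]
  add_mem' := by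
    intro f g hf hg n hn
    rw [map_add]
    exact R.add_mem (hf n hn) (hg n hn)
  zero_mem' := by
    intro n hn
    simp
  neg_mem' := by
    intro f hf n hn
    rw [map_neg]
    exact R.neg_mem (hf n hn)

variable {R : Subring F}

lemma upTo_anti {M N : ℕ} (h : M ≤ N) {f : F⟦X⟧} (hf : f ∈ upTo R N) : f ∈ upTo R M :=
  fun n hn => hf n (hn.trans_le h)

lemma C_mem_upTo {N : ℕ} {c : F} (hc : c ∈ R) : C c ∈ upTo R N := by
  intro n hn
  rw [coeff_C]
  split_ifs
  exacts [hc, R.zero_mem]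

lemma X_mul_mem_upTo {N : ℕ} {f : F⟦X⟧} (hf : f ∈ upTo R N) : X * f ∈ upTo R (N + 1) := by
  intro n hn
  cases n with
  | zero => simp
  | succ n => rw [coeff_succ_X_mul]; exact hf n (by omega)

lemma X_mem_upTo (N : ℕ) : (X : F⟦X⟧) ∈ upTo R N := by
  intro n hn
  rw [coeff_X]
  split_ifs
  exacts [R.one_mem, R.zero_mem]

lemma shift_mem_upTo {N : ℕ} {f : F⟦X⟧} (hf : f ∈ upTo R (N + 1)) : shift f ∈ upTo R N := by
  intro n hn
  rw [shift, coeff_mk]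
  exact hf _ (by omega)

lemma trunc_mem_upTo {n : ℕ} {f : F⟦X⟧} (hf : f ∈ upTo R n) (N : ℕ) :
    (trunc n f : F⟦X⟧) ∈ upTo R N := by
  intro m hm
  rw [Polynomial.coeff_coe, coeff_trunc]
  split_ifs with h
  exacts [hf m h, R.zero_mem]

lemma invFactor_mem_upTo {z : F} (hz : 1 + z ≠ 0) (hzR : (1 + z)⁻¹ ∈ R) {θ : F⟦X⟧}
    (hθ0 : constantCoeff θ = 0) {N : ℕ} (hθ : θ ∈ upTo R N) : invFactor z θ ∈ upTo R N := by
  have key : ∀ M ≤ N, invFactor z θ ∈ upTo R M := by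
    intro M
    induction M with
    | zero => intro _ n hn; omega
    | succ M ih =>
      intro hM
      have h1 := eq_C_add_X_mul_shift (θ - X)
      have h2 : constantCoeff (θ - X) = 0 := by simp [hθ0]
      rw [h2, map_zero, zero_add] at h1
      have hC : C (1 + z)⁻¹ * (1 + C z) = (1 : F⟦X⟧) := by
        rw [← map_one (C : F →+* F⟦X⟧), ← map_add, ← map_mul, inv_mul_cancel₀ hz]
      have e : invFactor z θ
          = C (1 + z)⁻¹ * (1 - X * (invFactor z θ * shift (θ - X))) := by
        have h3 := invFactor_mul hz hθ0
        have h4 : X * (invFactor z θ * shift (θ - X)) = invFactor z θ * (θ - X) := by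
          conv_rhs => rw [h1]
          ring
        rw [h4]
        linear_combination (-invFactor z θ) * hC + C (1 + z)⁻¹ * h3
      rw [e]
      refine Subring.mul_mem _ (C_mem_upTo hzR) (Subring.sub_mem _ (Subring.one_mem _) ?_)
      exact X_mul_mem_upTo (Subring.mul_mem _ (ih (by omega))
        (shift_mem_upTo (Subring.sub_mem _ (upTo_anti hM hθ) (X_mem_upTo _))))
  exact key N le_rfl

lemma constantCoeff_map' (σ : F →+* F) (f : F⟦X⟧) :
    constantCoeff (map σ f) = σ (constantCoeff f) := by
  rw [← coeff_zero_eq_constantCoeff_apply, coeff_map, coeff_zero_eq_constantCoeff_apply]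

lemma subst_mem_upTo {W : F⟦X⟧} {n : ℕ} : ∀ {P : ℕ} {g : F⟦X⟧}, W ∈ upTo R (P - 2) →
    g ∈ upTo R n → P ≤ 2 * n → subst (X ^ 2 * W) g ∈ upTo R P := by
  induction n with
  | zero => intro P g _ _ hP m hm; omega
  | succ n ih =>
    intro P g hW hg hP
    rw [subst_eq_add_mul_subst_shift (by simp) g]
    refine Subring.add_mem _ (C_mem_upTo ?_) ?_
    · rw [← coeff_zero_eq_constantCoeff_apply]; exact hg 0 (by omega)
    · have h1 : subst (X ^ 2 * W) (shift g) ∈ upTo R (P - 2) :=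
        ih (upTo_anti (by omega) hW) (shift_mem_upTo hg) (by omega)
      have h2 := X_mul_mem_upTo (X_mul_mem_upTo (Subring.mul_mem _ hW h1))
      have e : X ^ 2 * W * subst (X ^ 2 * W) (shift g)
          = X * (X * (W * subst (X ^ 2 * W) (shift g))) := by ring
      rw [e]
      exact upTo_anti (by omega) h2

/-- The coefficients of the invariant curve acquire their first pole at the `j`-th place in
index `2 ^ j`. -/
lemma IsInvariantCurve.first_pole {σ : F →+* F} {z L : F} {θ : F⟦X⟧}
    (hθ : IsInvariantCurve σ z L θ) (hz : 1 + z ≠ 0) (hL : L ≠ 0) (R : ℕ → Subring F)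
    (hσ : ∀ j g, σ g ∈ R (j + 1) ↔ g ∈ R j) (hzR : ∀ j, z ∈ R j) (hLR : ∀ j, L ∈ R j)
    (hLR' : ∀ j, L⁻¹ ∈ R j) (hzR' : ∀ j, (1 + z)⁻¹ ∈ R (j + 1))
    (hpole : (1 - z) * (1 + z)⁻¹ ∉ R 0) (j : ℕ) :
    θ ∈ upTo (R j) (2 ^ j) ∧ coeff (2 ^ j) θ ∉ R j := by
  obtain ⟨hθ0, hθe⟩ := hθ
  have hκ0 : constantCoeff (invFactor z θ) = (1 + z)⁻¹ := by
    simp [invFactor, hθ0]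
  induction j with
  | zero =>
    refine ⟨?_, ?_⟩
    · intro n hn
      have : n = 0 := by simpa using hn
      subst this
      rw [coeff_zero_eq_constantCoeff_apply, hθ0]
      exact Subring.zero_mem _
    · rw [hθe]
      have h1 : coeff 1 (C L * subst (nextParam z L θ) (map σ θ)) = 0 := by
        rw [subst_eq_add_mul_subst_shift (constantCoeff_nextParam z L θ), constantCoeff_map', hθ0,
          map_zero, map_zero, zero_add]
        have : X ^ 2 ∣ C L * (nextParam z L θ * subst (nextParam z L θ) (shift (map σ θ))) :=
          Dvd.dvd.mul_left (Dvd.dvd.mul_right (X_sq_dvd_nextParam z L θ) _) _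
        exact X_pow_dvd_iff.1 this 1 (by norm_num)
      have h2 : coeff 1 (X * (1 - (C z + θ)) * invFactor z θ) = (1 - z) * (1 + z)⁻¹ := by
        rw [mul_assoc, coeff_succ_X_mul, coeff_zero_eq_constantCoeff_apply, map_mul, hκ0]
        simp [hθ0]
      rw [pow_zero, map_add, h1, h2, zero_add]
      exact hpole
  | succ j ih =>
    obtain ⟨ih1, ih2⟩ := ih
    set n := 2 ^ j with hn
    have hn1 : 1 ≤ n := Nat.one_le_two_pow
    have hN : 2 ^ (j + 1) = 2 * n := by rw [hn]; ring
    rw [hN]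
    have hση : map σ θ ∈ upTo (R (j + 1)) n := by
      intro m hm
      rw [coeff_map]
      exact (hσ j _).2 (ih1 m hm)
    have htail : ∀ N, θ ∈ upTo (R (j + 1)) N →
        X * (1 - (C z + θ)) * invFactor z θ ∈ upTo (R (j + 1)) (N + 1) := by
      intro N h
      rw [mul_assoc]
      exact X_mul_mem_upTo (Subring.mul_mem _ (Subring.sub_mem _ (Subring.one_mem _)
        (Subring.add_mem _ (C_mem_upTo (hzR _)) h)) (invFactor_mem_upTo hz (hzR' j) hθ0 h))
    have hW : ∀ N, θ ∈ upTo (R (j + 1)) N →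
        C L⁻¹ * invFactor z θ ^ 2 ∈ upTo (R (j + 1)) N := fun N h =>
      Subring.mul_mem _ (C_mem_upTo (hLR' _))
        (Subring.pow_mem _ (invFactor_mem_upTo hz (hzR' j) hθ0 h) 2)
    have hreg : ∀ N ≤ 2 * n, θ ∈ upTo (R (j + 1)) N := by
      intro N
      induction N with
      | zero => intro _ m hm; omega
      | succ N ihN =>
        intro hNn
        have h := ihN (by omega)
        rw [hθe]
        refine Subring.add_mem _ (Subring.mul_mem _ (C_mem_upTo (hLR _)) ?_) (htail N h)
        exact subst_mem_upTo (upTo_anti (by omega) (hW N h)) hση hNn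
    refine ⟨hreg _ le_rfl, fun hmem => ih2 ?_⟩
    have h := hreg _ le_rfl
    have hsplit := eq_X_pow_mul_shift_add_trunc n (map σ θ)
    set g : F⟦X⟧ := ((trunc n (map σ θ) : Polynomial F) : F⟦X⟧) with hg
    set h' : F⟦X⟧ := mk fun i => coeff (i + n) (map σ θ) with hh'
    have hs : HasSubst (nextParam z L θ) :=
      HasSubst.of_constantCoeff_zero' (constantCoeff_nextParam z L θ)
    have hg1 : subst (nextParam z L θ) g ∈ upTo (R (j + 1)) (2 * n + 1) :=
      subst_mem_upTo (n := n + 1) (upTo_anti (by omega) (hW _ h)) (trunc_mem_upTo hση _) (by omega)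
    set W : F⟦X⟧ := C L⁻¹ * invFactor z θ ^ 2 with hWdef
    have hmain : coeff (2 * n) (subst (nextParam z L θ) (map σ θ))
        = (L⁻¹ * ((1 + z)⁻¹) ^ 2) ^ n * σ (coeff n θ)
          + coeff (2 * n) (subst (nextParam z L θ) g) := by
      rw [hsplit, subst_add hs, subst_mul hs, subst_pow hs, subst_X hs, map_add]
      congr 1
      have e : nextParam z L θ ^ n * subst (nextParam z L θ) h'
          = X ^ (2 * n) * (W ^ n * subst (nextParam z L θ) h') := by
        rw [nextParam, ← hWdef, mul_pow, ← pow_mul]; ring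
      rw [e]
      have := coeff_X_pow_mul (W ^ n * subst (nextParam z L θ) h') (2 * n) 0
      rw [zero_add] at this
      rw [this, coeff_zero_eq_constantCoeff_apply, map_mul, map_pow,
        subst_eq_add_mul_subst_shift (constantCoeff_nextParam z L θ)]
      simp only [hWdef, map_add, map_mul, map_pow, hκ0, constantCoeff_nextParam, zero_mul,
        add_zero, constantCoeff_C]
      congr 1
      rw [← coeff_zero_eq_constantCoeff_apply, hh', coeff_mk, coeff_map, zero_add]
    have hco := congrArg (coeff (2 * n)) hθe
    rw [map_add, coeff_C_mul, hmain] at hco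
    have hσn : σ (coeff n θ) = (L * (1 + z) ^ 2) ^ n * L⁻¹ * (coeff (2 * n) θ
        - L * coeff (2 * n) (subst (nextParam z L θ) g)
        - coeff (2 * n) (X * (1 - (C z + θ)) * invFactor z θ)) := by
      have h1 : (L * (1 + z) ^ 2) ^ n * (L⁻¹ * ((1 + z)⁻¹) ^ 2) ^ n = 1 := by
        rw [← mul_pow]
        have : L * (1 + z) ^ 2 * (L⁻¹ * ((1 + z)⁻¹) ^ 2) = 1 := by field_simp
        rw [this, one_pow]
      have h2 : L⁻¹ * L = 1 := inv_mul_cancel₀ hL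
      rw [hco]
      linear_combination (-σ (coeff n θ)) * h1
        - (L * (1 + z) ^ 2) ^ n * (L⁻¹ * ((1 + z)⁻¹) ^ 2) ^ n * σ (coeff n θ) * h2
    rw [← hσ j, hσn]
    have hR := R (j + 1)
    refine Subring.mul_mem _ (Subring.mul_mem _ (Subring.pow_mem _ (Subring.mul_mem _ (hLR _)
      (Subring.pow_mem _ (Subring.add_mem _ (Subring.one_mem _) (hzR _)) _)) _) (hLR' _))
      (Subring.sub_mem _ (Subring.sub_mem _ hmem (Subring.mul_mem _ (hLR _) ?_)) ?_)
    · exact hg1 _ (by omega)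
    · exact htail _ h _ (by omega)

/-- Eisenstein's theorem: the coefficients of an algebraic power series lie in almost all
the given subrings. -/
lemma eventually_coeff_mem_of_eval₂_eq_zero [CharZero F] (R : ℕ → Subring F)
    (hR : ∀ g : F, ∀ᶠ j in Filter.atTop, g ∈ R j) {r : F⟦X⟧}
    {Q : Polynomial (Polynomial F)} (hQ : Q ≠ 0)
    (hQr : Q.eval₂ (Polynomial.coeToPowerSeries.ringHom (R := F)) r = 0) :
    ∀ᶠ j in Filter.atTop, ∀ n, coeff n r ∈ R j := by
  set φ : Polynomial F →+* F⟦X⟧ := Polynomial.coeToPowerSeries.ringHom with hφ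
  have hφi : Function.Injective φ := Polynomial.coe_injective F
  induction hd : Q.natDegree using Nat.strong_induction_on generalizing Q with
  | _ d ih =>
  by_cases hder : Q.derivative.eval₂ φ r = 0
  · by_cases hd0 : Q.natDegree = 0
    · rw [Polynomial.eq_C_of_natDegree_eq_zero hd0, Polynomial.eval₂_C] at hQr
      have : Q.coeff 0 = 0 := hφi (by rw [hQr, map_zero])
      exact absurd (by rw [Polynomial.eq_C_of_natDegree_eq_zero hd0, this, map_zero]) hQ
    · refine ih _ (hd ▸ Polynomial.natDegree_derivative_lt hd0) (Q := Q.derivative) ?_ hder rfl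
      intro h0
      exact hd0 (Polynomial.derivative_eq_zero.1 h0)
  · set D := Q.derivative.eval₂ φ r with hD
    obtain ⟨m, u, hu0, hDu⟩ : ∃ m u, constantCoeff u ≠ 0 ∧ D = X ^ m * u := by
      refine ⟨D.order.toNat, divXPowOrder D, ?_, (X_pow_order_mul_divXPowOrder (f := D)).symm⟩
      rw [constantCoeff_divXPowOrder]
      exact coeff_order hder
    have hE1 : ∀ᶠ j in Filter.atTop, ∀ n ∈ Finset.range (m + 1), coeff n r ∈ R j :=
      (Filter.eventually_all_finset _).2 fun n _ => hR _
    have hE2 : ∀ᶠ j in Filter.atTop, ∀ i ∈ Q.support, ∀ l ∈ (Q.coeff i).support,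
        (Q.coeff i).coeff l ∈ R j :=
      (Filter.eventually_all_finset _).2 fun i _ =>
        (Filter.eventually_all_finset _).2 fun l _ => hR _
    filter_upwards [hE1, hE2, hR (constantCoeff u)⁻¹] with j h1 h2 h3
    have hcoef : ∀ N i, φ (Q.coeff i) ∈ upTo (R j) N := by
      intro N i l _
      rw [hφ, Polynomial.coeToPowerSeries.ringHom_apply, Polynomial.coeff_coe]
      by_cases hl : l ∈ (Q.coeff i).support
      · refine h2 i ?_ l hl
        rw [Polynomial.mem_support_iff]
        rintro h0
        simp [h0] at hl
      · rw [Polynomial.notMem_support_iff.1 hl]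
        exact Subring.zero_mem _
    intro n
    induction n using Nat.strong_induction_on with
    | _ n ihn =>
    by_cases hnm : n ≤ m
    · exact h1 n (Finset.mem_range.2 (by omega))
    · have hsplit := eq_X_pow_mul_shift_add_trunc n r
      set t : F⟦X⟧ := ((trunc n r : Polynomial F) : F⟦X⟧) with ht
      set s : F⟦X⟧ := mk fun i => coeff (i + n) r with hs
      obtain ⟨k, hk⟩ := Polynomial.binomExpansion (Q.map φ) r (t - r)
      rw [add_sub_cancel, Polynomial.eval_map, Polynomial.derivative_map, Polynomial.eval_map,
        Polynomial.eval_map, hQr, ← hD, hDu] at hk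
      have htr : t - r = -(X ^ n * s) := by linear_combination -hsplit
      rw [htr] at hk
      have hk' : Q.eval₂ φ t = X ^ (n + m) * (-(u * s) + X ^ (n - m) * (k * s ^ 2)) := by
        obtain ⟨l, rfl⟩ : ∃ l, n = m + l := ⟨n - m, by omega⟩
        rw [hk, Nat.add_sub_cancel_left]; ring
      have hmem : Q.eval₂ φ t ∈ upTo (R j) (n + m + 1) := by
        rw [Polynomial.eval₂_eq_sum_range]
        refine Subring.sum_mem _ fun i _ => Subring.mul_mem _ (hcoef _ i) (Subring.pow_mem _ ?_ _)
        exact trunc_mem_upTo (fun l hl => ihn l hl) _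
      have hc := hmem (n + m) (by omega)
      have h4 := coeff_X_pow_mul (-(u * s) + X ^ (n - m) * (k * s ^ 2)) (n + m) 0
      rw [zero_add] at h4
      rw [hk', h4, coeff_zero_eq_constantCoeff_apply] at hc
      have hne : n - m ≠ 0 := by omega
      have h5 : constantCoeff s = coeff n r := by
        rw [← coeff_zero_eq_constantCoeff_apply, hs, coeff_mk, zero_add]
      simp only [map_add, map_neg, map_mul, map_pow, constantCoeff_X, h5, zero_pow hne, zero_mul,
        add_zero] at hc
      have h6 := Subring.neg_mem _ (Subring.mul_mem _ h3 hc)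
      have h7 : -((constantCoeff u)⁻¹ * -(constantCoeff u * coeff n r)) = coeff n r := by
        field_simp
      rwa [h7] at h6

end PowerSeries

namespace PowerSeries

variable {F : Type*} [Field F]

lemma coeff_shift (f : F⟦X⟧) (n : ℕ) : coeff n (shift f) = coeff (n + 1) f := coeff_mk _ _

lemma shift_eq_of_eq {f g : F⟦X⟧} {c : F} (h : f = C c + X * g) : shift f = g := by
  ext n
  rw [coeff_shift, h, map_add, coeff_succ_X_mul, coeff_C, if_neg (Nat.succ_ne_zero n), zero_add]

lemma shift_add (f g : F⟦X⟧) : shift (f + g) = shift f + shift g := by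
  ext n; simp [coeff_shift]

lemma shift_neg (f : F⟦X⟧) : shift (-f) = -shift f := by
  ext n; simp [coeff_shift]

lemma shift_mul (f g : F⟦X⟧) :
    shift (f * g) = shift f * g + C (constantCoeff f) * shift g := by
  refine shift_eq_of_eq (c := constantCoeff f * constantCoeff g) ?_
  rw [map_mul]
  linear_combination g * eq_C_add_X_mul_shift f
    + C (constantCoeff f) * eq_C_add_X_mul_shift g

lemma shift_C (c : F) : shift (C c) = 0 := shift_eq_of_eq (c := c) (by simp)

lemma shift_X_mul (f : F⟦X⟧) : shift (X * f) = f := shift_eq_of_eq (c := 0) (by simp)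

lemma shift_map (σ : F →+* F) (f : F⟦X⟧) : shift (map σ f) = map σ (shift f) := by
  ext n; simp [coeff_shift]

variable {G : Type*} [CommRing G]

/-- `x` agrees with the formal expansion `f(v)` up to an error in `v ^ N * B`. -/
def Expands (E : F →+* G) (B : Subring G) (v : G) : ℕ → F⟦X⟧ → G → Prop
  | 0, _, x => x ∈ B
  | N + 1, f, x => E (constantCoeff f) ∈ B ∧
      ∃ x', x = E (constantCoeff f) + v * x' ∧ Expands E B v N (shift f) x'

namespace Expands

variable {E : F →+* G} {B : Subring G} {v : G}

lemma mem (hv : v ∈ B) {N : ℕ} {f : F⟦X⟧} {x : G} (h : Expands E B v N f x) : x ∈ B := by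
  induction N generalizing f x with
  | zero => exact h
  | succ N ih =>
    obtain ⟨h0, x', rfl, hx'⟩ := h
    exact B.add_mem h0 (B.mul_mem hv (ih hx'))

lemma of_succ (hv : v ∈ B) {N : ℕ} {f : F⟦X⟧} {x : G} (h : Expands E B v (N + 1) f x) :
    Expands E B v N f x := by
  induction N generalizing f x with
  | zero => exact h.mem hv
  | succ N ih =>
    obtain ⟨h0, x', hx, hx'⟩ := h
    exact ⟨h0, x', hx, ih hx'⟩

lemma anti (hv : v ∈ B) {M N : ℕ} (hMN : M ≤ N) {f : F⟦X⟧} {x : G} (h : Expands E B v N f x) :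
    Expands E B v M f x := by
  induction N, hMN using Nat.le_induction with
  | base => exact h
  | succ N _ ih => exact ih (h.of_succ hv)

lemma add {N : ℕ} {f g : F⟦X⟧} {x y : G} (hf : Expands E B v N f x)
    (hg : Expands E B v N g y) : Expands E B v N (f + g) (x + y) := by
  induction N generalizing f g x y with
  | zero => exact B.add_mem hf hg
  | succ N ih =>
    obtain ⟨hf0, x', rfl, hx'⟩ := hf
    obtain ⟨hg0, y', rfl, hy'⟩ := hg
    refine ⟨?_, x' + y', ?_, ?_⟩
    · rw [map_add, map_add]; exact B.add_mem hf0 hg0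
    · rw [map_add, map_add]; ring
    · rw [shift_add]; exact ih hx' hy'

lemma neg {N : ℕ} {f : F⟦X⟧} {x : G} (hf : Expands E B v N f x) :
    Expands E B v N (-f) (-x) := by
  induction N generalizing f x with
  | zero => exact B.neg_mem hf
  | succ N ih =>
    obtain ⟨hf0, x', rfl, hx'⟩ := hf
    refine ⟨?_, -x', ?_, ?_⟩
    · rw [map_neg, map_neg]; exact B.neg_mem hf0
    · rw [map_neg, map_neg]; ring
    · rw [shift_neg]; exact ih hx'

lemma sub {N : ℕ} {f g : F⟦X⟧} {x y : G} (hf : Expands E B v N f x)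
    (hg : Expands E B v N g y) : Expands E B v N (f - g) (x - y) := by
  rw [sub_eq_add_neg, sub_eq_add_neg]
  exact hf.add hg.neg

lemma zero (N : ℕ) : Expands E B v N 0 0 := by
  induction N with
  | zero => exact B.zero_mem
  | succ N ih =>
    refine ⟨by simp, 0, by simp, ?_⟩
    rwa [← map_zero C, shift_C]

lemma const {c : F} (hc : E c ∈ B) (N : ℕ) : Expands E B v N (C c) (E c) := by
  cases N with
  | zero => exact hc
  | succ N =>
    refine ⟨by simpa using hc, 0, by simp, ?_⟩
    rw [shift_C]
    exact zero N

lemma one (N : ℕ) : Expands E B v N 1 1 := by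
  have := const (E := E) (B := B) (v := v) (c := 1) (by rw [map_one]; exact B.one_mem) N
  rwa [map_one, map_one] at this

lemma X_mul {N : ℕ} {f : F⟦X⟧} {x : G} (hf : Expands E B v N f x) :
    Expands E B v (N + 1) (X * f) (v * x) := by
  refine ⟨by simp, x, by simp, ?_⟩
  rwa [shift_X_mul]

lemma mul (hv : v ∈ B) {N : ℕ} {f g : F⟦X⟧} {x y : G} (hf : Expands E B v N f x)
    (hg : Expands E B v N g y) : Expands E B v N (f * g) (x * y) := by
  induction N generalizing f g x y with
  | zero => exact B.mul_mem hf hg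
  | succ N ih =>
    have hg' := hg.of_succ hv
    obtain ⟨hf0, x', rfl, hx'⟩ := hf
    obtain ⟨hg0, y', hy, hy'⟩ := hg
    refine ⟨?_, x' * y + E (constantCoeff f) * y', ?_, ?_⟩
    · rw [map_mul, map_mul]; exact B.mul_mem hf0 hg0
    · rw [map_mul, map_mul]; linear_combination E (constantCoeff f) * hy
    · rw [shift_mul]; exact (ih hx' hg').add (ih (const hf0 N) hy')

lemma X_self (hv : v ∈ B) (N : ℕ) : Expands E B v N X v := by
  have := (one (E := E) (B := B) (v := v) N).X_mul
  rw [mul_one, mul_one] at this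
  exact this.of_succ hv

lemma pow (hv : v ∈ B) {N : ℕ} {f : F⟦X⟧} {x : G} (hf : Expands E B v N f x) (n : ℕ) :
    Expands E B v N (f ^ n) (x ^ n) := by
  induction n with
  | zero => rw [pow_zero, pow_zero]; exact one N
  | succ n ih => rw [pow_succ, pow_succ]; exact ih.mul hv hf

lemma sum {ι : Type*} (s : Finset ι) {N : ℕ} {f : ι → F⟦X⟧} {x : ι → G}
    (h : ∀ i ∈ s, Expands E B v N (f i) (x i)) :
    Expands E B v N (∑ i ∈ s, f i) (∑ i ∈ s, x i) := by
  classical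
  induction s using Finset.induction_on with
  | empty => exact zero N
  | insert a s ha ih =>
    rw [Finset.sum_insert ha, Finset.sum_insert ha]
    exact (h a (Finset.mem_insert_self a s)).add
      (ih fun i hi => h i (Finset.mem_insert_of_mem hi))

lemma inv (hv : v ∈ B) {N : ℕ} {f κ : F⟦X⟧} {x y : G} (hf : Expands E B v N f x)
    (hκ : κ * f = 1) (hy : y * x = 1) (hyB : y ∈ B) (hκ0 : E (constantCoeff κ) ∈ B) :
    Expands E B v N κ y := by
  have hc : constantCoeff κ * constantCoeff f = 1 := by rw [← map_mul, hκ, map_one]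
  have hs : shift κ = -(C (constantCoeff κ) * shift f * κ) := by
    apply shift_eq_of_eq (c := constantCoeff κ)
    have h1 := eq_C_add_X_mul_shift f
    have h2 : C (constantCoeff κ) * C (constantCoeff f) = (1 : F⟦X⟧) := by
      rw [← map_mul, hc, map_one]
    linear_combination C (constantCoeff κ) * hκ - C (constantCoeff κ) * κ * h1 - κ * h2
  have hE : E (constantCoeff κ) * E (constantCoeff f) = 1 := by rw [← map_mul, hc, map_one]
  induction N generalizing x y with
  | zero => exact hyB
  | succ N ih =>
    have hκN := ih (hf.of_succ hv) hy hyB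
    obtain ⟨hf0, x', rfl, hx'⟩ := hf
    refine ⟨hκ0, -(E (constantCoeff κ) * x' * y), ?_, ?_⟩
    · linear_combination E (constantCoeff κ) * hy - y * hE
    · rw [hs]
      exact (((const hκ0 N).mul hv hx').mul hv hκN).neg

lemma subst_map (hv : v ∈ B) {S : G →+* G} {σ : F →+* F} (hSB : ∀ x ∈ B, S x ∈ B)
    (hS : ∀ c, E (σ c) = S (E c)) {W : F⟦X⟧} {w : G} (hvw : S v = v ^ 2 * w)
    {M : ℕ} (hW : Expands E B v M W w) {N : ℕ} {f : F⟦X⟧} {x : G} (hf : Expands E B v N f x)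
    {P : ℕ} (hP : P ≤ 2 * N) (hPM : P ≤ M + 2) :
    Expands E B v P (subst (X ^ 2 * W) (map σ f)) (S x) := by
  induction N generalizing f x P with
  | zero =>
    obtain rfl : P = 0 := by omega
    exact hSB _ hf
  | succ N ih =>
    obtain ⟨hf0, x', rfl, hx'⟩ := hf
    have h1 := ih hx' (P := P - 2) (by omega) (by omega)
    have h2 := ((hW.anti hv (show P - 2 ≤ M by omega)).mul hv h1).X_mul.X_mul
    have h3 : Expands E B v (P - 2 + 1 + 1) _ _ :=
      (const (E := E) (B := B) (v := v) (c := σ (constantCoeff f))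
        (by rw [hS]; exact hSB _ hf0) (P - 2 + 1 + 1)).add h2
    have h4 := h3.anti hv (show P ≤ P - 2 + 1 + 1 by omega)
    convert h4 using 1
    · rw [subst_eq_add_mul_subst_shift (by simp), shift_map]
      have : constantCoeff (map σ f) = σ (constantCoeff f) := by
        rw [← coeff_zero_eq_constantCoeff_apply, coeff_map, coeff_zero_eq_constantCoeff_apply]
      rw [this]; ring
    · rw [map_add, map_mul, hvw, hS]; ring

/-- A germ on the invariant curve has a full asymptotic expansion given by that curve. -/
lemma of_isInvariantCurve (hv : v ∈ B) {S : G →+* G} {σ : F →+* F} (hSB : ∀ x ∈ B, S x ∈ B)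
    (hS : ∀ c, E (σ c) = S (E c)) {z L : F} (hz : 1 + z ≠ 0) (hEz : E z ∈ B) (hEL : E L ∈ B)
    (hEL' : E L⁻¹ ∈ B) (hEz' : E (1 + z)⁻¹ ∈ B) {θ : F⟦X⟧} (hθ : IsInvariantCurve σ z L θ)
    {t k x : G} (hk : k * (1 + E z + t - v) = 1) (hkB : k ∈ B)
    (ht : t = E L * S t + v * (1 - (E z + t)) * k) (hSv : S v = v ^ 2 * (E L⁻¹ * k ^ 2))
    (hx : t = v * x) (hxB : x ∈ B) (N : ℕ) : Expands E B v N θ t := by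
  obtain ⟨hθ0, hθe⟩ := hθ
  have key : ∀ N, Expands E B v (N + 1) θ t := by
    intro N
    induction N with
    | zero => exact ⟨by simp [hθ0], x, by simp [hθ0, hx], hxB⟩
    | succ N ih =>
      have h1 : Expands E B v (N + 1) (1 + C z + θ - X) (1 + E z + t - v) :=
        (((one _).add (const hEz _)).add ih).sub (X_self hv _)
      have hκ : Expands E B v (N + 1) (invFactor z θ) k := by
        refine h1.inv hv (invFactor_mul hz hθ0) hk hkB ?_
        have : constantCoeff (invFactor z θ) = (1 + z)⁻¹ := by simp [invFactor, hθ0]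
        rwa [this]
      have hW := (const (E := E) (B := B) (v := v) hEL' (N + 1)).mul hv (hκ.pow hv 2)
      have h2 : Expands E B v (N + 2) (subst (nextParam z L θ) (map σ θ)) (S t) :=
        subst_map hv hSB hS hSv hW ih (by omega) (by omega)
      have h3 := (((one (E := E) (B := B) (v := v) (N + 1)).sub
        ((const hEz _).add ih)).mul hv hκ).X_mul
      have h4 := ((const hEL (N + 2)).mul hv h2).add h3
      rw [← mul_assoc, ← mul_assoc, ← ht, ← hθe] at h4
      exact h4
  exact (key N).of_succ hv

lemma exists_leading {f : F⟦X⟧} (hf : f ≠ 0) {n : ℕ} (hn : ∀ m < n, coeff m f = 0) {x : G}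
    (h : ∀ N, Expands E B v N f x) :
    ∃ M, n ≤ M ∧ ∃ c, c ≠ 0 ∧ E c ∈ B ∧ ∃ y ∈ B, x = v ^ M * (E c + v * y) := by
  have key : ∀ M, ∀ f : F⟦X⟧, ∀ x, (∀ m < M, coeff m f = 0) → coeff M f ≠ 0 →
      Expands E B v (M + 1) f x →
      ∃ c, c ≠ 0 ∧ E c ∈ B ∧ ∃ y ∈ B, x = v ^ M * (E c + v * y) := by
    intro M
    induction M with
    | zero =>
      rintro f x - h0 ⟨h1, y, rfl, hy⟩
      exact ⟨_, h0, by simpa using h1, y, hy, by simp⟩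
    | succ M ih =>
      rintro f x hlt h0 ⟨h1, x', rfl, hx'⟩
      obtain ⟨c, hc, hEc, y, hy, rfl⟩ := ih (shift f) x'
        (fun m hm => by rw [coeff_shift]; exact hlt _ (by omega)) (by rwa [coeff_shift]) hx'
      refine ⟨c, hc, hEc, y, hy, ?_⟩
      have : constantCoeff f = 0 := by
        rw [← coeff_zero_eq_constantCoeff_apply]; exact hlt 0 (by omega)
      rw [this, map_zero]; ring
  have hex : ∃ M, coeff M f ≠ 0 := by
    by_contra! hcon
    exact hf (ext fun m => by rw [hcon m, map_zero])
  classical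
  refine ⟨Nat.find hex, ?_, key _ f x (fun m hm => ?_) (Nat.find_spec hex) (h _)⟩
  · by_contra! hlt
    exact Nat.find_spec hex (hn _ hlt)
  · by_contra hne
    exact Nat.find_min hex hm hne

end Expands

end PowerSeries

namespace RatFunc

variable {K : Type*} [Field K]

/-- The rational functions that are regular at `c`. -/
def regularAt (c : K) : Subring (RatFunc K) where
  carrier := {g | ∃ p q : Polynomial K, q.eval c ≠ 0 ∧ g * algebraMap _ _ q = algebraMap _ _ p}
  mul_mem' := by
    rintro f g ⟨p, q, hq, h⟩ ⟨p', q', hq', h'⟩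
    refine ⟨p * p', q * q', by rw [Polynomial.eval_mul]; exact mul_ne_zero hq hq', ?_⟩
    rw [map_mul, map_mul, ← h, ← h']; ring
  one_mem' := ⟨1, 1, by simp, by simp⟩
  add_mem' := by
    rintro f g ⟨p, q, hq, h⟩ ⟨p', q', hq', h'⟩
    refine ⟨p * q' + p' * q, q * q', by rw [Polynomial.eval_mul]; exact mul_ne_zero hq hq', ?_⟩
    rw [map_mul, map_add, map_mul, map_mul, ← h, ← h']; ring
  zero_mem' := ⟨0, 1, by simp, by simp⟩
  neg_mem' := by
    rintro f ⟨p, q, hq, h⟩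
    exact ⟨-p, q, hq, by rw [map_neg, ← h]; ring⟩

lemma algebraMap_mem_regularAt (c : K) (p : Polynomial K) :
    algebraMap (Polynomial K) (RatFunc K) p ∈ regularAt c := ⟨p, 1, by simp, by simp⟩

lemma exists_mul_algebraMap_eq (g : RatFunc K) : ∃ p q : Polynomial K, q ≠ 0 ∧
    g * algebraMap _ _ q = algebraMap _ _ p := by
  obtain ⟨p, q, h⟩ := IsLocalization.exists_mk'_eq (nonZeroDivisors (Polynomial K)) g
  exact ⟨p, q, nonZeroDivisors.ne_zero q.2, by rw [← h]; exact IsLocalization.mk'_spec _ _ _⟩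

lemma eventually_mem_regularAt {c : ℕ → K} (hc : Function.Injective c) (g : RatFunc K) :
    ∀ᶠ j in Filter.atTop, g ∈ regularAt (c j) := by
  obtain ⟨p, q, hq, h⟩ := exists_mul_algebraMap_eq g
  have hfin : {j | q.IsRoot (c j)}.Finite :=
    (Polynomial.finite_setOfPred_isRoot hq).preimage hc.injOn
  have := hfin.eventually_cofinite_notMem
  rw [Nat.cofinite_eq_atTop] at this
  filter_upwards [this] with j hj
  exact ⟨p, q, hj, h⟩

lemma nonZeroDivisors_le_comap_scale {a : K} (ha : a ≠ 0) :
    nonZeroDivisors (Polynomial K) ≤ (nonZeroDivisors (Polynomial K)).comap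
      (Polynomial.compRingHom (Polynomial.C a * Polynomial.X)) := by
  intro p hp
  have hp0 : p ≠ 0 := nonZeroDivisors.ne_zero hp
  rw [Submonoid.mem_comap, mem_nonZeroDivisors_iff_ne_zero]
  change p.comp _ ≠ 0
  intro h
  rcases Polynomial.comp_eq_zero_iff.1 h with h | ⟨-, h⟩
  · exact hp0 h
  · have := congrArg (fun q => Polynomial.coeff q 1) h
    simp [ha] at this

/-- The substitution `g(z) ↦ g(a z)`. -/
noncomputable def scale {a : K} (ha : a ≠ 0) : RatFunc K →+* RatFunc K :=
  IsLocalization.map (RatFunc K) _ (nonZeroDivisors_le_comap_scale ha)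

lemma scale_algebraMap {a : K} (ha : a ≠ 0) (p : Polynomial K) :
    scale ha (algebraMap _ _ p) =
      algebraMap _ _ (p.comp (Polynomial.C a * Polynomial.X)) :=
  IsLocalization.map_eq (nonZeroDivisors_le_comap_scale ha) p

lemma scale_mem_regularAt_iff {a : K} (ha : a ≠ 0) {c d : K} (hcd : a * d = c)
    (g : RatFunc K) : scale ha g ∈ regularAt d ↔ g ∈ regularAt c := by
  constructor
  · rintro ⟨p, q, hq, h⟩
    have hinv : ∀ p : Polynomial K, (p.comp (Polynomial.C a⁻¹ * Polynomial.X)).comp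
        (Polynomial.C a * Polynomial.X) = p := by
      intro p
      rw [Polynomial.comp_assoc]
      have : (Polynomial.C a⁻¹ * Polynomial.X).comp (Polynomial.C a * Polynomial.X)
          = (Polynomial.X : Polynomial K) := by
        rw [Polynomial.mul_comp, Polynomial.C_comp, Polynomial.X_comp, ← mul_assoc,
          ← Polynomial.C_mul, inv_mul_cancel₀ ha, Polynomial.C_1, one_mul]
      rw [this, Polynomial.comp_X]
    refine ⟨p.comp (Polynomial.C a⁻¹ * Polynomial.X), q.comp (Polynomial.C a⁻¹ * Polynomial.X),
      ?_, (scale ha).injective ?_⟩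
    · have : a⁻¹ * c = d := by rw [← hcd, inv_mul_cancel_left₀ ha]
      simpa [Polynomial.eval_comp, this] using hq
    · rw [map_mul, scale_algebraMap, scale_algebraMap, hinv, hinv, h]
  · rintro ⟨p, q, hq, h⟩
    refine ⟨p.comp (Polynomial.C a * Polynomial.X), q.comp (Polynomial.C a * Polynomial.X),
      ?_, ?_⟩
    · simpa [Polynomial.eval_comp, hcd] using hq
    · rw [← scale_algebraMap ha q, ← scale_algebraMap ha p, ← map_mul, h]

end RatFunc

namespace PowerSeries

lemma IsInvariantCurve.eval₂_ne_zero {K : Type*} [Field K] [CharZero K] {L : K} (hL : L ≠ 0)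
    (hinj : Function.Injective fun j : ℕ => L ^ j) {θ : (RatFunc K)⟦X⟧}
    (hθ : IsInvariantCurve (RatFunc.scale (inv_ne_zero hL)) RatFunc.X (RatFunc.C L) θ)
    {Q : Polynomial (Polynomial (RatFunc K))} (hQ : Q ≠ 0) :
    Q.eval₂ (Polynomial.coeToPowerSeries.ringHom (R := RatFunc K)) (C RatFunc.X + θ) ≠ 0 := by
  intro h0
  have hX : (RatFunc.X : RatFunc K) = algebraMap (Polynomial K) _ Polynomial.X :=
    (RatFunc.algebraMap_X).symm
  have hCc : ∀ c : K, (RatFunc.C c : RatFunc K) = algebraMap (Polynomial K) _ (Polynomial.C c) :=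
    fun c => (RatFunc.algebraMap_C c).symm
  have hz : (1 + RatFunc.X : RatFunc K) ≠ 0 := by
    rw [hX, ← map_one (algebraMap (Polynomial K) (RatFunc K)), ← map_add]
    rw [Ne, map_eq_zero_iff _ (IsFractionRing.injective (Polynomial K) (RatFunc K))]
    intro h
    have := congrArg (fun q => Polynomial.coeff q 1) h
    simp [Polynomial.coeff_one] at this
  have h1X : (1 + RatFunc.X : RatFunc K) = algebraMap (Polynomial K) _ (1 + Polynomial.X) := by
    rw [map_add, map_one, hX]
  set R : ℕ → Subring (RatFunc K) := fun j => RatFunc.regularAt (-L ^ j) with hR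
  have hpole := hθ.first_pole hz (by simpa using hL) R ?_ ?_ ?_ ?_ ?_ ?_
  · have hev := eventually_coeff_mem_of_eval₂_eq_zero R (fun g =>
      RatFunc.eventually_mem_regularAt (c := fun j => -L ^ j)
        (fun i j hij => hinj (neg_injective hij)) g) hQ h0
    obtain ⟨j, hj⟩ := hev.exists
    refine (hpole j).2 ?_
    have := hj (2 ^ j)
    rwa [map_add, coeff_C, if_neg (by positivity), zero_add] at this
  · intro j g
    exact RatFunc.scale_mem_regularAt_iff _ (by rw [pow_succ]; field_simp) g
  · intro j
    rw [hX]; exact RatFunc.algebraMap_mem_regularAt _ _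
  · intro j
    rw [hCc]; exact RatFunc.algebraMap_mem_regularAt _ _
  · intro j
    rw [← map_inv₀, hCc]; exact RatFunc.algebraMap_mem_regularAt _ _
  · intro j
    refine ⟨1, 1 + Polynomial.X, ?_, ?_⟩
    · have : L ^ (j + 1) ≠ L ^ 0 := fun h => by simpa using hinj h
      simp only [Polynomial.eval_add, Polynomial.eval_one, Polynomial.eval_X]
      intro h
      exact this (by rw [pow_zero]; linear_combination -h)
    · rw [← h1X, inv_mul_cancel₀ hz, map_one]
  · rintro ⟨p, q, hq, h⟩
    have h2 : algebraMap (Polynomial K) (RatFunc K) ((1 - Polynomial.X) * q) =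
        algebraMap (Polynomial K) (RatFunc K) (p * (1 + Polynomial.X)) := by
      rw [map_mul, map_mul, ← h, ← h1X, map_sub, map_one, ← hX]
      field_simp
    have h3 := congrArg (Polynomial.eval (-1))
      (IsFractionRing.injective (Polynomial K) (RatFunc K) h2)
    simp only [Polynomial.eval_mul, Polynomial.eval_sub, Polynomial.eval_add,
      Polynomial.eval_one, Polynomial.eval_X] at h3
    rw [add_neg_cancel, mul_zero] at h3
    rw [pow_zero] at hq
    rcases mul_eq_zero.1 h3 with h4 | h4
    · norm_num at h4
    · exact hq h4

end PowerSeries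

namespace PowerSeries

open scoped Polynomial

lemma exists_auxiliary {K : Type*} [Field K] (r : (RatFunc K)⟦X⟧)
    (hr : ∀ Q : Polynomial (Polynomial (RatFunc K)), Q ≠ 0 →
      Q.eval₂ (Polynomial.coeToPowerSeries.ringHom (R := RatFunc K)) r ≠ 0)
    {E N : ℕ} (hN : N < (E + 1) ^ 2) :
    ∃ P : Fin (E + 1) → Fin (E + 1) → K[X],
      (∑ i, ∑ j, C (algebraMap K[X] (RatFunc K) (P i j)) * X ^ (i : ℕ) * r ^ (j : ℕ)) ≠ 0 ∧
      ∀ m < N, coeff m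
        (∑ i, ∑ j, C (algebraMap K[X] (RatFunc K) (P i j)) * X ^ (i : ℕ) * r ^ (j : ℕ)) = 0 := by
  classical
  let ev : (Fin (E + 1) × Fin (E + 1) → (RatFunc K)) →ₗ[(RatFunc K)] (RatFunc K)⟦X⟧ :=
    Fintype.linearCombination (RatFunc K) fun ij => X ^ (ij.1 : ℕ) * r ^ (ij.2 : ℕ)
  let Φ : (Fin (E + 1) × Fin (E + 1) → (RatFunc K)) →ₗ[(RatFunc K)] (Fin N → (RatFunc K)) :=
    LinearMap.pi fun m => (coeff (m : ℕ)).comp ev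
  have hker : Φ.ker ≠ ⊥ := by
    apply LinearMap.ker_ne_bot_of_finrank_lt
    simpa [Module.finrank_fintype_fun_eq_card, ← pow_two] using hN
  obtain ⟨p, hp, hp0⟩ := Submodule.exists_mem_ne_zero_of_ne_bot hker
  have hcoef : ∀ m < N, coeff m (ev p) = 0 := by
    intro m hm
    have := congrFun (LinearMap.mem_ker.1 hp) ⟨m, hm⟩
    simpa [Φ] using this
  obtain ⟨b, hb⟩ := IsLocalization.exist_integer_multiples_of_finset
    (nonZeroDivisors K[X]) (Finset.univ.image p)
  have hb' : ∀ ij, ∃ q : K[X], algebraMap K[X] (RatFunc K) q = algebraMap K[X] (RatFunc K) b * p ij := by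
    intro ij
    obtain ⟨q, hq⟩ := hb (p ij) (Finset.mem_image_of_mem _ (Finset.mem_univ _))
    exact ⟨q, by rw [hq, Algebra.smul_def]⟩
  choose q hq using hb'
  have hb0 : algebraMap K[X] (RatFunc K) b ≠ 0 := by
    rw [Ne, map_eq_zero_iff _ (IsFractionRing.injective K[X] (RatFunc K))]
    exact nonZeroDivisors.ne_zero b.2
  have hsum : (∑ i, ∑ j, C (algebraMap K[X] (RatFunc K) (q (i, j))) * X ^ (i : ℕ) * r ^ (j : ℕ))
      = C (algebraMap K[X] (RatFunc K) b) * ev p := by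
    rw [Fintype.linearCombination_apply, Finset.mul_sum, Fintype.sum_prod_type]
    refine Finset.sum_congr rfl fun i _ => Finset.sum_congr rfl fun j _ => ?_
    rw [hq, map_mul, smul_eq_C_mul]; ring
  refine ⟨fun i j => q (i, j), ?_, ?_⟩
  · beta_reduce
    rw [hsum]
    refine mul_ne_zero (by rwa [Ne, map_eq_zero_iff _ C_injective]) ?_
    let Q : Polynomial (Polynomial (RatFunc K)) := ∑ ij : Fin (E + 1) × Fin (E + 1),
      Polynomial.monomial (ij.2 : ℕ) (Polynomial.monomial (ij.1 : ℕ) (p ij))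
    have hQev : Q.eval₂ (Polynomial.coeToPowerSeries.ringHom (R := (RatFunc K))) r = ev p := by
      rw [Fintype.linearCombination_apply, Polynomial.eval₂_finsetSum]
      refine Finset.sum_congr rfl fun ij _ => ?_
      rw [Polynomial.eval₂_monomial, smul_eq_C_mul, Polynomial.coeToPowerSeries.ringHom_apply,
        Polynomial.coe_monomial, monomial_eq_mk, ← mul_assoc]
      congr 1
      ext n
      simp [coeff_X_pow, coeff_C_mul]
    rw [← hQev]
    apply hr
    intro hQ0
    apply hp0
    ext ij
    have h1 : (Q.coeff ij.2).coeff ij.1 = p ij := by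
      simp only [Q, Polynomial.finsetSum_coeff, Polynomial.coeff_monomial]
      rw [Finset.sum_eq_single ij]
      · simp
      · intro kl _ hne
        by_cases h2 : (kl.2 : ℕ) = ij.2
        · rw [if_pos h2, Polynomial.coeff_monomial, if_neg]
          intro h1
          exact hne (Prod.ext (Fin.ext h1) (Fin.ext h2))
        · rw [if_neg h2, Polynomial.coeff_zero]
      · simp
    rw [← h1, hQ0]; simp
  · intro m hm
    beta_reduce
    rw [hsum, coeff_C_mul, hcoef m hm, mul_zero]

end PowerSeries

open Filter Topology in
/-- The ring of germs at infinity of bounded real sequences. -/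
def boundedGerms : Subring (Germ (atTop : Filter ℕ) ℝ) where
  carrier := {x | ∃ f : ℕ → ℝ, (∃ C, ∀ᶠ k in atTop, |f k| ≤ C) ∧ (f : Germ atTop ℝ) = x}
  mul_mem' := by
    rintro _ _ ⟨f, ⟨C, hf⟩, rfl⟩ ⟨g, ⟨D, hg⟩, rfl⟩
    refine ⟨f * g, ⟨C * D, ?_⟩, rfl⟩
    filter_upwards [hf, hg] with k h1 h2
    rw [Pi.mul_apply, abs_mul]
    exact mul_le_mul h1 h2 (abs_nonneg _) ((abs_nonneg _).trans h1)
  one_mem' := ⟨1, ⟨1, by simp⟩, rfl⟩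
  add_mem' := by
    rintro _ _ ⟨f, ⟨C, hf⟩, rfl⟩ ⟨g, ⟨D, hg⟩, rfl⟩
    refine ⟨f + g, ⟨C + D, ?_⟩, rfl⟩
    filter_upwards [hf, hg] with k h1 h2
    exact (abs_add_le _ _).trans (add_le_add h1 h2)
  zero_mem' := ⟨0, ⟨0, by simp⟩, rfl⟩
  neg_mem' := by
    rintro _ ⟨f, ⟨C, hf⟩, rfl⟩
    refine ⟨-f, ⟨C, ?_⟩, rfl⟩
    filter_upwards [hf] with k h1
    rwa [Pi.neg_apply, abs_neg]

open Filter Topology in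
lemma coe_mem_boundedGerms_of_tendsto {f : ℕ → ℝ} {a : ℝ} (h : Tendsto f atTop (𝓝 a)) :
    (f : Germ atTop ℝ) ∈ boundedGerms :=
  ⟨f, ⟨|a| + 1, (h.abs.eventually_lt_const (lt_add_one _)).mono fun _ h => h.le⟩, rfl⟩

open Filter in
/-- The index shift on germs at infinity of real sequences. -/
def germShift : Germ (atTop : Filter ℕ) ℝ →+* Germ (atTop : Filter ℕ) ℝ where
  toFun x := x.compTendsto (· + 1) (tendsto_add_atTop_nat 1)
  map_one' := rfl
  map_mul' x y := Germ.inductionOn₂ x y fun _ _ => rfl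
  map_zero' := rfl
  map_add' x y := Germ.inductionOn₂ x y fun _ _ => rfl

open Filter in
lemma germShift_coe (f : ℕ → ℝ) :
    germShift (f : Germ atTop ℝ) = ((fun k => f (k + 1) : ℕ → ℝ) : Germ atTop ℝ) := rfl

open Filter in
lemma germShift_mem {x : Germ (atTop : Filter ℕ) ℝ} (hx : x ∈ boundedGerms) :
    germShift x ∈ boundedGerms := by
  obtain ⟨f, ⟨C, hf⟩, rfl⟩ := hx
  exact ⟨fun k => f (k + 1), ⟨C, (tendsto_add_atTop_nat 1).eventually hf⟩, rfl⟩

section evalGerm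

open Filter Topology Polynomial

variable {K : Type*} [Field K] (ι : K →+* ℝ) {ζ : ℕ → ℝ}

/-- Evaluation of polynomials along a sequence, as a germ. -/
noncomputable def polyEvalGerm (ζ : ℕ → ℝ) : K[X] →+* Germ (atTop : Filter ℕ) ℝ :=
  (Germ.coeRingHom atTop).comp (RingHom.pi fun k => eval₂RingHom ι (ζ k))

lemma polyEvalGerm_apply (ζ : ℕ → ℝ) (p : K[X]) :
    polyEvalGerm ι ζ p = ((fun k => p.eval₂ ι (ζ k) : ℕ → ℝ) : Germ atTop ℝ) := rfl

lemma exists_lower_bound_eval₂ (hζ : ∀ k, 0 < ζ k) (hζlim : Tendsto ζ atTop (𝓝 0))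
    {p : K[X]} (hp : p ≠ 0) :
    ∃ c > 0, ∃ m : ℕ, ∀ᶠ k in atTop, c * ζ k ^ m ≤ |p.eval₂ ι (ζ k)| := by
  obtain ⟨q, hpq, hq⟩ := Polynomial.exists_eq_pow_rootMultiplicity_mul_and_not_dvd p hp 0
  set m := p.rootMultiplicity 0
  have hq0 : q.eval₂ ι 0 ≠ 0 := by
    rw [map_zero, sub_zero, X_dvd_iff] at hq
    rw [eval₂_at_zero]
    simpa using hq
  have hlim : Tendsto (fun k => |q.eval₂ ι (ζ k)|) atTop (𝓝 |q.eval₂ ι 0|) := by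
    have hc : Continuous fun x : ℝ => q.eval₂ ι x := by
      simp_rw [eval₂_eq_eval_map]
      exact Polynomial.continuous _
    exact ((hc.tendsto 0).comp hζlim).abs
  have hpos : 0 < |q.eval₂ ι 0| := abs_pos.2 hq0
  refine ⟨|q.eval₂ ι 0| / 2, by positivity, m, ?_⟩
  filter_upwards [hlim.eventually_const_lt (half_lt_self hpos)] with k hk
  rw [hpq, eval₂_mul, map_zero, sub_zero, eval₂_X_pow, abs_mul, abs_of_pos (pow_pos (hζ k) m),
    mul_comm]
  exact mul_le_mul_of_nonneg_left hk.le (pow_pos (hζ k) m).le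

lemma polyEvalGerm_mem (hζlim : Tendsto ζ atTop (𝓝 0)) (p : K[X]) :
    polyEvalGerm ι ζ p ∈ boundedGerms := by
  have hc : Continuous fun x : ℝ => p.eval₂ ι x := by
    simp_rw [eval₂_eq_eval_map]
    exact Polynomial.continuous _
  exact coe_mem_boundedGerms_of_tendsto ((hc.tendsto 0).comp hζlim)

lemma isUnit_polyEvalGerm (hζ : ∀ k, 0 < ζ k) (hζlim : Tendsto ζ atTop (𝓝 0))
    (p : nonZeroDivisors K[X]) : IsUnit (polyEvalGerm ι ζ p) := by
  obtain ⟨c, hc, m, h⟩ := exists_lower_bound_eval₂ ι hζ hζlim (nonZeroDivisors.ne_zero p.2)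
  refine IsUnit.of_mul_eq_one
    ((fun k => ((p : K[X]).eval₂ ι (ζ k))⁻¹ : ℕ → ℝ) : Germ atTop ℝ) ?_
  rw [polyEvalGerm_apply, ← Germ.coe_mul, ← Germ.coe_one, Germ.coe_eq]
  filter_upwards [h] with k hk
  have : (p : K[X]).eval₂ ι (ζ k) ≠ 0 :=
    abs_pos.1 ((mul_pos hc (pow_pos (hζ k) m)).trans_le hk)
  simp [this]

/-- Evaluation of rational functions along a sequence of positive reals tending to zero. -/
noncomputable def evalGerm (hζ : ∀ k, 0 < ζ k) (hζlim : Tendsto ζ atTop (𝓝 0)) :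
    RatFunc K →+* Germ (atTop : Filter ℕ) ℝ :=
  IsLocalization.lift (isUnit_polyEvalGerm ι hζ hζlim)

lemma evalGerm_algebraMap (hζ : ∀ k, 0 < ζ k) (hζlim : Tendsto ζ atTop (𝓝 0)) (p : K[X]) :
    evalGerm ι hζ hζlim (algebraMap _ _ p) =
      ((fun k => p.eval₂ ι (ζ k) : ℕ → ℝ) : Germ atTop ℝ) :=
  IsLocalization.lift_eq _ p

lemma evalGerm_scale (hζ : ∀ k, 0 < ζ k) (hζlim : Tendsto ζ atTop (𝓝 0)) {L : K} (hL : L ≠ 0)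
    (hζs : ∀ k, ι L * ζ (k + 1) = ζ k) (g : RatFunc K) :
    evalGerm ι hζ hζlim (RatFunc.scale (inv_ne_zero hL) g) =
      germShift (evalGerm ι hζ hζlim g) := by
  have : (evalGerm ι hζ hζlim).comp (RatFunc.scale (inv_ne_zero hL)) =
      germShift.comp (evalGerm ι hζ hζlim) := by
    apply IsLocalization.ringHom_ext (nonZeroDivisors K[X])
    refine RingHom.ext fun p => ?_
    simp only [RingHom.comp_apply]
    rw [RatFunc.scale_algebraMap, evalGerm_algebraMap, evalGerm_algebraMap, germShift_coe,
      Germ.coe_eq]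
    refine Eventually.of_forall fun k => ?_
    have h1 : ι L ≠ 0 := by rwa [Ne, map_eq_zero]
    have h2 : (ι L)⁻¹ * ζ k = ζ (k + 1) := by rw [← hζs k, inv_mul_cancel_left₀ h1]
    simp [eval₂_comp, h2]
  exact RingHom.congr_fun this g

lemma eventually_ne_zero_of_evalGerm (hζ : ∀ k, 0 < ζ k) (hζlim : Tendsto ζ atTop (𝓝 0))
    {v : ℕ → ℝ} (hvζ : ∀ m : ℕ, Tendsto (fun k => v k / ζ k ^ m) atTop (𝓝 0))
    {c : RatFunc K} (hc : c ≠ 0) {y : Germ (atTop : Filter ℕ) ℝ} (hy : y ∈ boundedGerms)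
    {x : ℕ → ℝ} (hx : (x : Germ atTop ℝ) = evalGerm ι hζ hζlim c + (v : Germ atTop ℝ) * y) :
    ∀ᶠ k in atTop, x k ≠ 0 := by
  obtain ⟨p, q, hq, h⟩ := RatFunc.exists_mul_algebraMap_eq c
  have hinj := IsFractionRing.injective K[X] (RatFunc K)
  have hp : p ≠ 0 := by
    rintro rfl
    rw [map_zero, mul_eq_zero, map_eq_zero_iff _ hinj] at h
    exact h.elim hc hq
  obtain ⟨a, ha, m, hm⟩ := exists_lower_bound_eval₂ ι hζ hζlim hp
  obtain ⟨w, ⟨D, hD⟩, hw⟩ := boundedGerms.mul_mem hy (polyEvalGerm_mem ι hζlim q)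
  set pf : ℕ → ℝ := fun k => p.eval₂ ι (ζ k) with hpf
  set qf : ℕ → ℝ := fun k => q.eval₂ ι (ζ k) with hqf
  have hkey : ((x * qf : ℕ → ℝ) : Germ (atTop : Filter ℕ) ℝ) =
      ((pf + v * w : ℕ → ℝ) : Germ (atTop : Filter ℕ) ℝ) := by
    rw [Germ.coe_add, Germ.coe_mul, Germ.coe_mul, hw, hpf, hqf, hx,
      ← evalGerm_algebraMap ι hζ hζlim p, ← h, map_mul,
      evalGerm_algebraMap, polyEvalGerm_apply]
    ring
  rw [Germ.coe_eq] at hkey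
  have hsmall := ((hvζ m).abs.mul_const (|D| + 1)).eventually_lt_const
    (show |(0 : ℝ)| * (|D| + 1) < a by simpa using ha)
  filter_upwards [hkey, hm, hD, hsmall] with k h1 h2 h3 h4 h0
  rw [Pi.mul_apply, h0, zero_mul, Pi.add_apply, Pi.mul_apply] at h1
  change 0 = p.eval₂ ι (ζ k) + _ at h1
  have hz := pow_pos (hζ k) m
  rw [abs_div, abs_of_pos hz, div_mul_eq_mul_div, div_lt_iff₀ hz] at h4
  have h5 : |p.eval₂ ι (ζ k)| = |v k| * |w k| := by
    rw [← abs_mul, ← abs_neg (v k * w k)]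
    congr 1
    linarith
  have h6 : |v k| * |w k| ≤ |v k| * (|D| + 1) :=
    mul_le_mul_of_nonneg_left (by linarith [le_abs_self D]) (abs_nonneg _)
  linarith

/-- Auxiliary polynomials taking small nonzero values along an orbit of the invariant curve. -/
theorem exists_small_nonzero [CharZero K] {L : K} (hL : 1 < ι L) {v r : ℕ → ℝ}
    (hζ : ∀ k, 0 < ζ k) (hζlim : Tendsto ζ atTop (𝓝 0)) (hζs : ∀ k, ι L * ζ (k + 1) = ζ k)
    (hvζ : ∀ m : ℕ, Tendsto (fun k => v k / ζ k ^ m) atTop (𝓝 0))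
    (hvs : ∀ᶠ k in atTop, v (k + 1) = v k ^ 2 * ((ι L)⁻¹ * ((1 + r k - v k)⁻¹) ^ 2))
    (hrs : ∀ᶠ k in atTop, r k = ι L * r (k + 1) + v k * (1 - r k) * (1 + r k - v k)⁻¹)
    (hr : Tendsto r atTop (𝓝 0)) {D : ℝ} (hD : ∀ᶠ k in atTop, |r k - ζ k| ≤ D * v k)
    (hv : ∀ᶠ k in atTop, 0 < v k) {E N : ℕ} (hN : N < (E + 1) ^ 2) :
    ∃ P : Fin (E + 1) → Fin (E + 1) → K[X],
      (∀ᶠ k in atTop,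
        ∑ i, ∑ j, (P i j).eval₂ ι (ζ k) * v k ^ (i : ℕ) * r k ^ (j : ℕ) ≠ 0) ∧
      ∃ C, ∀ᶠ k in atTop,
        |∑ i, ∑ j, (P i j).eval₂ ι (ζ k) * v k ^ (i : ℕ) * r k ^ (j : ℕ)| ≤ C * v k ^ N := by
  have hL0 : L ≠ 0 := by rintro rfl; simp at hL; linarith
  have hιL : ι L ≠ 0 := by rwa [Ne, map_eq_zero]
  have hvlim : Tendsto v atTop (𝓝 0) := by simpa using hvζ 0
  have hinj : Function.Injective fun j : ℕ => L ^ j := by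
    intro i j hij
    have : ι L ^ i = ι L ^ j := by rw [← map_pow, ← map_pow]; exact congrArg ι hij
    exact pow_right_injective₀ (by linarith) hL.ne' this
  have hz : (1 + RatFunc.X : RatFunc K) ≠ 0 := by
    intro h
    have h1 := evalGerm_algebraMap ι hζ hζlim (1 + X)
    rw [map_add, map_one, RatFunc.algebraMap_X, h, map_zero, ← Germ.coe_zero, Germ.coe_eq] at h1
    obtain ⟨k, hk⟩ := h1.exists
    have := hζ k
    simp at hk
    linarith
  obtain ⟨θ, hθ⟩ := PowerSeries.exists_isInvariantCurve
    (RatFunc.scale (inv_ne_zero hL0)) (z := RatFunc.X) (L := RatFunc.C L) hz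
  obtain ⟨P, hP0, hP⟩ := PowerSeries.exists_auxiliary (PowerSeries.C RatFunc.X + θ)
    (fun Q hQ => hθ.eval₂_ne_zero hL0 hinj hQ) hN
  set Ev := evalGerm ι hζ hζlim with hEv
  have hEX : Ev RatFunc.X = (ζ : Germ atTop ℝ) := by
    rw [← RatFunc.algebraMap_X, hEv, evalGerm_algebraMap]; simp
  have hEC : ∀ c, Ev (RatFunc.C c) = ((fun _ => ι c : ℕ → ℝ) : Germ atTop ℝ) := by
    intro c
    rw [← RatFunc.algebraMap_C, hEv, evalGerm_algebraMap]; simp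
  have hEz : Ev RatFunc.X ∈ boundedGerms := by
    rw [hEX]; exact coe_mem_boundedGerms_of_tendsto hζlim
  have hECm : ∀ c, Ev (RatFunc.C c) ∈ boundedGerms := by
    intro c; rw [hEC]; exact coe_mem_boundedGerms_of_tendsto tendsto_const_nhds
  have hvB : (v : Germ atTop ℝ) ∈ boundedGerms := coe_mem_boundedGerms_of_tendsto hvlim
  have hden : Tendsto (fun k => 1 + r k - v k) atTop (𝓝 1) := by
    simpa using (hr.const_add 1).sub hvlim
  have hEz' : Ev (1 + RatFunc.X)⁻¹ ∈ boundedGerms := by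
    have hl : Tendsto (fun k => (1 + ζ k)⁻¹) atTop (𝓝 1) := by
      simpa using (hζlim.const_add 1).inv₀ (by norm_num)
    obtain ⟨u, hu⟩ : ∃ u : ℕ → ℝ, u = fun k => (1 + ζ k)⁻¹ := ⟨_, rfl⟩
    have e : Ev (1 + RatFunc.X)⁻¹ = (u : Germ (atTop : Filter ℕ) ℝ) := by
      have e1 : Ev (1 + RatFunc.X)⁻¹ * (1 + (ζ : Germ atTop ℝ)) = 1 := by
        rw [← hEX, ← map_one Ev, ← map_add, ← map_mul, inv_mul_cancel₀ hz]
      have e2 : (1 + (ζ : Germ (atTop : Filter ℕ) ℝ)) * (u : Germ (atTop : Filter ℕ) ℝ) = 1 := by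
        rw [← Germ.coe_one, ← Germ.coe_add, ← Germ.coe_mul, Germ.coe_eq]
        refine Eventually.of_forall fun k => ?_
        have := hζ k
        simp only [Pi.mul_apply, Pi.add_apply, Pi.one_apply, hu]
        field_simp
      linear_combination (u : Germ (atTop : Filter ℕ) ℝ) * e1
        - Ev (1 + RatFunc.X)⁻¹ * e2
    rw [e, hu]
    exact coe_mem_boundedGerms_of_tendsto hl
  set kf : ℕ → ℝ := fun k => (1 + r k - v k)⁻¹ with hkf
  have hkB : (kf : Germ atTop ℝ) ∈ boundedGerms :=
    coe_mem_boundedGerms_of_tendsto (hden.inv₀ one_ne_zero)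
  set tf : ℕ → ℝ := fun k => r k - ζ k with htf
  have hrt : Ev RatFunc.X + (tf : Germ atTop ℝ) = (r : Germ atTop ℝ) := by
    rw [hEX, ← Germ.coe_add, Germ.coe_eq]
    exact Eventually.of_forall fun k => by simp [htf]
  have hexp := fun M => PowerSeries.Expands.of_isInvariantCurve (E := Ev) (B := boundedGerms)
    (v := (v : Germ atTop ℝ)) hvB (S := germShift) (σ := RatFunc.scale (inv_ne_zero hL0))
    (fun x hx => germShift_mem hx) (evalGerm_scale ι hζ hζlim hL0 hζs) hz hEz (hECm L)
    (by rw [← map_inv₀]; exact hECm _) hEz' hθ (t := (tf : Germ atTop ℝ))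
    (k := (kf : Germ atTop ℝ)) (x := ((fun k => tf k / v k : ℕ → ℝ) : Germ atTop ℝ))
    (by
      rw [add_assoc, hrt, ← Germ.coe_one, ← Germ.coe_add, ← Germ.coe_sub, ← Germ.coe_mul,
        Germ.coe_eq]
      filter_upwards [hden.eventually_ne one_ne_zero] with k hk
      simp only [Pi.mul_apply, Pi.add_apply, Pi.sub_apply, Pi.one_apply, hkf]
      exact inv_mul_cancel₀ hk)
    hkB
    (by
      rw [hrt, hEC, germShift_coe, ← Germ.coe_one, ← Germ.coe_sub, ← Germ.coe_mul,
        ← Germ.coe_mul, ← Germ.coe_mul, ← Germ.coe_add, Germ.coe_eq]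
      filter_upwards [hrs] with k hk
      simp only [Pi.mul_apply, Pi.add_apply, Pi.sub_apply, Pi.one_apply, hkf, htf]
      linear_combination hk + hζs k)
    (by
      rw [← map_inv₀, hEC, germShift_coe, ← Germ.coe_pow, ← Germ.coe_pow, ← Germ.coe_mul,
        ← Germ.coe_mul, Germ.coe_eq]
      filter_upwards [hvs] with k hk
      simp only [Pi.mul_apply, Pi.pow_apply, hkf, map_inv₀]
      exact hk)
    (by
      rw [← Germ.coe_mul, Germ.coe_eq]
      filter_upwards [hv] with k hk
      simp only [Pi.mul_apply]
      field_simp)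
    ⟨_, ⟨D, by
      filter_upwards [hv, hD] with k hk hk'
      rw [abs_div, abs_of_pos hk, div_le_iff₀ hk]
      exact hk'⟩, rfl⟩ M
  set xf : ℕ → ℝ := fun k =>
    ∑ i, ∑ j, (P i j).eval₂ ι (ζ k) * v k ^ (i : ℕ) * r k ^ (j : ℕ) with hxf
  have hxg : (xf : Germ atTop ℝ) = ∑ i, ∑ j, Ev (algebraMap K[X] (RatFunc K) (P i j)) *
      (v : Germ atTop ℝ) ^ (i : ℕ) * (Ev RatFunc.X + (tf : Germ atTop ℝ)) ^ (j : ℕ) := by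
    have e : xf = ∑ i, ∑ j, (fun k => (P i j).eval₂ ι (ζ k)) * v ^ (i : ℕ) * r ^ (j : ℕ) := by
      ext k
      simp [hxf, Finset.sum_apply]
    rw [e, hrt]
    change Germ.coeRingHom atTop _ = _
    simp only [map_sum, map_mul, map_pow]
    simp only [hEv, evalGerm_algebraMap]
    rfl
  have hall : ∀ M, PowerSeries.Expands Ev boundedGerms (v : Germ atTop ℝ) M
      (∑ i, ∑ j, PowerSeries.C (algebraMap K[X] (RatFunc K) (P i j)) *
        PowerSeries.X ^ (i : ℕ) * (PowerSeries.C RatFunc.X + θ) ^ (j : ℕ))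
      (xf : Germ atTop ℝ) := by
    intro M
    rw [hxg]
    refine PowerSeries.Expands.sum _ fun i _ => PowerSeries.Expands.sum _ fun j _ => ?_
    refine ((PowerSeries.Expands.const ?_ M).mul hvB
      ((PowerSeries.Expands.X_self hvB M).pow hvB _)).mul hvB
      (((PowerSeries.Expands.const hEz M).add (hexp M)).pow hvB _)
    rw [hEv, evalGerm_algebraMap]
    exact polyEvalGerm_mem ι hζlim _
  obtain ⟨M, hNM, c, hc, hcB, y, hy, hxy⟩ := PowerSeries.Expands.exists_leading hP0 hP hall
  obtain ⟨w, ⟨C, hC⟩, hw⟩ := boundedGerms.add_mem hcB (boundedGerms.mul_mem hvB hy)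
  have hxw : ∀ᶠ k in atTop, xf k = v k ^ M * w k := by
    rw [← hw, ← Germ.coe_pow, ← Germ.coe_mul, Germ.coe_eq] at hxy
    exact hxy
  refine ⟨P, ?_, C, ?_⟩
  · filter_upwards [hxw, hv, eventually_ne_zero_of_evalGerm ι hζ hζlim hvζ hc hy hw]
      with k h1 h2 h3
    change xf k ≠ 0
    rw [h1]
    exact mul_ne_zero (pow_ne_zero _ h2.ne') h3
  · filter_upwards [hxw, hv, hC, hvlim.eventually_lt_const one_pos] with k h1 h2 h3 h4
    change |xf k| ≤ _
    rw [h1, abs_mul, abs_of_pos (pow_pos h2 M), mul_comm]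
    exact mul_le_mul h3 (pow_le_pow_of_le_one h2.le h4.le hNM) (pow_pos h2 M).le
      ((abs_nonneg _).trans h3)

end evalGerm

section Controlled

variable {K : Type*} [Field K]

/-- Sequences in a number field with bounded denominators, all of whose conjugates are
bounded by `Q k ^ D` up to an exponential factor. -/
def Controlled (Q : ℕ → ℝ) (D : ℕ) (y : ℕ → K) : Prop :=
  ∃ Δ : ℕ, Δ ≠ 0 ∧ (∀ k, IsIntegral ℤ ((Δ : K) * y k)) ∧
    ∃ C B : ℝ, 1 ≤ C ∧ 1 ≤ B ∧ ∀ (φ : K →+* ℂ) (k : ℕ), ‖φ (y k)‖ ≤ C * B ^ k * Q k ^ D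

namespace Controlled

variable {Q : ℕ → ℝ} {D D' : ℕ} {y y' : ℕ → K}

lemma mono (hQ : ∀ k, 1 ≤ Q k) (h : Controlled Q D y) (hD : D ≤ D') : Controlled Q D' y := by
  obtain ⟨Δ, hΔ, hint, C, B, hC, hB, hb⟩ := h
  refine ⟨Δ, hΔ, hint, C, B, hC, hB, fun φ k => (hb φ k).trans ?_⟩
  have := pow_le_pow_right₀ (hQ k) hD
  gcongr

lemma congr (h : Controlled Q D y) (he : ∀ k, y k = y' k) : Controlled Q D y' :=
  (funext he : y = y') ▸ h

lemma add (hQ : ∀ k, 1 ≤ Q k) (h : Controlled Q D y) (h' : Controlled Q D y') :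
    Controlled Q D fun k => y k + y' k := by
  obtain ⟨Δ, hΔ, hint, C, B, hC, hB, hb⟩ := h
  obtain ⟨Δ', hΔ', hint', C', B', hC', hB', hb'⟩ := h'
  refine ⟨Δ * Δ', mul_ne_zero hΔ hΔ', fun k => ?_, C + C', B * B', by linarith,
    one_le_mul_of_one_le_of_one_le hB hB', fun φ k => ?_⟩
  · have e : ((Δ * Δ' : ℕ) : K) * (y k + y' k) =
        (Δ' : K) * ((Δ : K) * y k) + (Δ : K) * ((Δ' : K) * y' k) := by push_cast; ring
    rw [e]
    exact ((isIntegral_natCast Δ').mul (hint k)).add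
      ((isIntegral_natCast Δ).mul (hint' k))
  · rw [map_add]
    refine (norm_add_le _ _).trans ?_
    have hq : 0 ≤ Q k ^ D := pow_nonneg (by linarith [hQ k]) _
    have h1 : B ^ k ≤ (B * B') ^ k :=
      pow_le_pow_left₀ (by linarith) (le_mul_of_one_le_right (by linarith) hB') _
    have h2 : B' ^ k ≤ (B * B') ^ k :=
      pow_le_pow_left₀ (by linarith) (le_mul_of_one_le_left (by linarith) hB) _
    calc _ ≤ C * B ^ k * Q k ^ D + C' * B' ^ k * Q k ^ D := add_le_add (hb φ k) (hb' φ k)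
      _ ≤ C * (B * B') ^ k * Q k ^ D + C' * (B * B') ^ k * Q k ^ D := by gcongr
      _ = _ := by ring

lemma mul (h : Controlled Q D y) (h' : Controlled Q D' y') :
    Controlled Q (D + D') fun k => y k * y' k := by
  obtain ⟨Δ, hΔ, hint, C, B, hC, hB, hb⟩ := h
  obtain ⟨Δ', hΔ', hint', C', B', hC', hB', hb'⟩ := h'
  refine ⟨Δ * Δ', mul_ne_zero hΔ hΔ', fun k => ?_, C * C', B * B',
    one_le_mul_of_one_le_of_one_le hC hC',
    one_le_mul_of_one_le_of_one_le hB hB', fun φ k => ?_⟩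
  · have e : ((Δ * Δ' : ℕ) : K) * (y k * y' k) =
        ((Δ : K) * y k) * ((Δ' : K) * y' k) := by push_cast; ring
    rw [e]
    exact (hint k).mul (hint' k)
  · rw [map_mul, norm_mul]
    calc _ ≤ (C * B ^ k * Q k ^ D) * (C' * B' ^ k * Q k ^ D') :=
          mul_le_mul (hb φ k) (hb' φ k) (norm_nonneg _) ((norm_nonneg _).trans (hb φ k))
      _ = _ := by rw [mul_pow, pow_add]; ring

lemma pow_of_isIntegral [NumberField K] {u : K} (hu : IsIntegral ℤ u) :
    Controlled Q 0 fun k => u ^ k := by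
  refine ⟨1, one_ne_zero, fun k => by simpa using hu.pow k, 1, 1 + ∑ φ : K →+* ℂ, ‖φ u‖,
    le_rfl, le_add_of_nonneg_right (Finset.sum_nonneg fun _ _ => norm_nonneg _), fun φ k => ?_⟩
  rw [pow_zero, mul_one, one_mul, map_pow, norm_pow]
  refine pow_le_pow_left₀ (norm_nonneg _) ?_ k
  have := Finset.single_le_sum (f := fun φ : K →+* ℂ => ‖φ u‖) (fun _ _ => norm_nonneg _)
    (Finset.mem_univ φ)
  linarith

lemma const [NumberField K] (c : K) : Controlled Q 0 fun _ => c := by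
  have halg : IsAlgebraic ℤ c :=
    (IsFractionRing.isAlgebraic_iff ℤ ℚ K).2 (Algebra.IsAlgebraic.isAlgebraic c)
  obtain ⟨y, hy0, hy⟩ := halg.exists_integral_multiple
  refine ⟨y.natAbs, Int.natAbs_ne_zero.2 hy0, fun k => ?_, 1 + ∑ φ : K →+* ℂ, ‖φ c‖, 1,
    le_add_of_nonneg_right (Finset.sum_nonneg fun _ _ => norm_nonneg _), le_rfl, fun φ k => ?_⟩
  · rw [zsmul_eq_mul] at hy
    rcases Int.natAbs_eq y with h | h
    · rw [h] at hy
      simpa using hy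
    · rw [h] at hy
      simpa using hy.neg
  · have := Finset.single_le_sum (f := fun φ : K →+* ℂ => ‖φ c‖) (fun _ _ => norm_nonneg _)
      (Finset.mem_univ φ)
    simp only [one_pow, mul_one, pow_zero]
    linarith

lemma natCast {n : ℕ → ℕ} {C : ℝ} (hC : 1 ≤ C) (h : ∀ k, (n k : ℝ) ≤ C * Q k) :
    Controlled Q 1 fun k => (n k : K) := by
  refine ⟨1, one_ne_zero, fun k => ?_, C, 1, hC, le_rfl, fun φ k => ?_⟩
  · simpa using isIntegral_natCast (n k)
  · rw [map_natCast, Complex.norm_natCast]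
    simpa using h k

lemma pow [NumberField K] (h : Controlled Q D y) (n : ℕ) :
    Controlled Q (n * D) fun k => y k ^ n := by
  induction n with
  | zero => simpa using const (Q := Q) (1 : K)
  | succ n ih =>
    have := ih.mul h
    rw [add_mul, one_mul]
    simpa only [pow_succ] using this

lemma sum [NumberField K] (hQ : ∀ k, 1 ≤ Q k) {σ : Type*} (s : Finset σ) {f : σ → ℕ → K}
    (h : ∀ i ∈ s, Controlled Q D (f i)) : Controlled Q D fun k => ∑ i ∈ s, f i k := by
  classical
  induction s using Finset.induction_on with
  | empty => simpa using (const (Q := Q) (0 : K)).mono hQ (Nat.zero_le D)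
  | insert a s ha ih =>
    simp only [Finset.sum_insert ha]
    exact (h a (Finset.mem_insert_self a s)).add hQ
      (ih fun i hi => h i (Finset.mem_insert_of_mem hi))

lemma eval [NumberField K] (hQ : ∀ k, 1 ≤ Q k) (h : Controlled Q 0 y) (p : Polynomial K) :
    Controlled Q 0 fun k => p.eval (y k) := by
  simp only [Polynomial.eval_eq_sum_range]
  refine sum hQ _ fun i _ => ?_
  have := (const (Q := Q) (p.coeff i)).mul (h.pow i)
  simpa using this

end Controlled

lemma one_le_prod_norm_embeddings [NumberField K] {x : K} (hx : x ≠ 0) (hint : IsIntegral ℤ x) :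
    1 ≤ ∏ φ : K →ₐ[ℚ] ℂ, ‖φ x‖ := by
  have h1 := Algebra.norm_eq_prod_embeddings ℚ ℂ x
  have h2 : IsIntegral ℤ (Algebra.norm ℚ x) := Algebra.isIntegral_norm ℚ hint
  obtain ⟨n, hn⟩ := IsIntegrallyClosed.isIntegral_iff.1 h2
  have hn0 : n ≠ 0 := by
    rintro rfl
    rw [map_zero] at hn
    exact hx (Algebra.norm_eq_zero_iff.1 hn.symm)
  rw [← norm_prod, ← h1, ← hn]
  have : (1 : ℝ) ≤ |(n : ℝ)| := by exact_mod_cast Int.one_le_abs hn0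
  simpa using this

lemma Controlled.eventually_le_of_small [NumberField K] (ι : K →+* ℝ) {Q : ℕ → ℝ}
    (hQ : ∀ k, 1 ≤ Q k) {D e : ℕ} {y : ℕ → K} (hy : Controlled Q D y)
    (hy0 : ∀ᶠ k in Filter.atTop, y k ≠ 0) {C₀ B₀ : ℝ}
    (hsmall : ∀ᶠ k in Filter.atTop, |ι (y k)| * Q k ^ e ≤ C₀ * B₀ ^ k * Q k ^ D)
    (he : Module.finrank ℚ K * D < e) :
    ∃ C B : ℝ, ∀ᶠ k in Filter.atTop, Q k ≤ C * B ^ k := by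
  classical
  obtain ⟨Δ, hΔ, hint, C, B, hC, hB, hb⟩ := hy
  set d := Module.finrank ℚ K with hd
  set φ₀ : K →ₐ[ℚ] ℂ := (Complex.ofRealHom.comp ι).toRatAlgHom with hφ₀
  refine ⟨Δ ^ d * C₀ * C ^ (d - 1), B₀ * B ^ (d - 1), ?_⟩
  have hd1 : 1 ≤ d := Module.finrank_pos
  filter_upwards [hy0, hsmall] with k hk hk'
  have hQ0 : 0 < Q k := by linarith [hQ k]
  have h1 := one_le_prod_norm_embeddings
    (mul_ne_zero (Nat.cast_ne_zero.2 hΔ) hk : (Δ : K) * y k ≠ 0) (hint k)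
  have hcard : (Finset.univ : Finset (K →ₐ[ℚ] ℂ)).card = d := by
    rw [Finset.card_univ, AlgHom.card]
  have h2 : ∏ φ : K →ₐ[ℚ] ℂ, ‖φ ((Δ : K) * y k)‖ =
      (Δ : ℝ) ^ d * ∏ φ : K →ₐ[ℚ] ℂ, ‖φ (y k)‖ := by
    simp only [map_mul, map_natCast, norm_mul, Complex.norm_natCast]
    rw [Finset.prod_mul_distrib, Finset.prod_const, hcard]
  have h3 : ∏ φ : K →ₐ[ℚ] ℂ, ‖φ (y k)‖ ≤
      |ι (y k)| * (C * B ^ k * Q k ^ D) ^ (d - 1) := by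
    rw [← Finset.mul_prod_erase Finset.univ _ (Finset.mem_univ φ₀)]
    have h4 : ‖φ₀ (y k)‖ = |ι (y k)| := by simp [hφ₀]
    rw [h4]
    refine mul_le_mul_of_nonneg_left ?_ (abs_nonneg _)
    refine (Finset.prod_le_prod
      (f := fun φ : K →ₐ[ℚ] ℂ => ‖φ (y k)‖) (g := fun _ => C * B ^ k * Q k ^ D)
      (fun _ _ => norm_nonneg _) fun φ _ => hb (φ : K →+* ℂ) k).trans ?_
    rw [Finset.prod_const, Finset.card_erase_of_mem (Finset.mem_univ _), hcard]
  have h5 : 1 ≤ (Δ : ℝ) ^ d * (|ι (y k)| * (C * B ^ k * Q k ^ D) ^ (d - 1)) := by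
    rw [h2] at h1
    exact h1.trans (mul_le_mul_of_nonneg_left h3 (by positivity))
  have h6 : Q k ^ e ≤ (Δ : ℝ) ^ d * C₀ * C ^ (d - 1) * (B₀ * B ^ (d - 1)) ^ k
      * Q k ^ (d * D) := by
    have hpos : 0 ≤ (Δ : ℝ) ^ d * (C * B ^ k * Q k ^ D) ^ (d - 1) := by positivity
    calc Q k ^ e ≤ (Δ : ℝ) ^ d * (|ι (y k)| * (C * B ^ k * Q k ^ D) ^ (d - 1)) * Q k ^ e :=
          le_mul_of_one_le_left (by positivity) h5
      _ = (Δ : ℝ) ^ d * (C * B ^ k * Q k ^ D) ^ (d - 1) * (|ι (y k)| * Q k ^ e) := by ring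
      _ ≤ (Δ : ℝ) ^ d * (C * B ^ k * Q k ^ D) ^ (d - 1) * (C₀ * B₀ ^ k * Q k ^ D) :=
          mul_le_mul_of_nonneg_left hk' hpos
      _ = _ := by
        obtain ⟨m, hm⟩ : ∃ m, d = m + 1 := ⟨d - 1, by omega⟩
        rw [hm, Nat.add_sub_cancel]
        ring
  have h7 : Q k * Q k ^ (d * D) ≤ Q k ^ e := by
    rw [← pow_succ']
    exact pow_le_pow_right₀ (hQ k) he
  exact le_of_mul_le_mul_right (h7.trans h6) (by positivity)

end Controlled

/-- The pair `(Q, R)` with `[[3, 2], [1, 1]] ^ n = [[R + 2 * Q, 2 * Q], [Q, R]]`. -/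
def powCoeff : ℕ → ℕ × ℕ
  | 0 => (0, 1)
  | n + 1 => (3 * (powCoeff n).1 + (powCoeff n).2, 2 * (powCoeff n).1 + (powCoeff n).2)

lemma powCoeff_det (n : ℕ) : ((powCoeff n).2 : ℤ) ^ 2 + 2 * (powCoeff n).1 * (powCoeff n).2 =
    2 * (powCoeff n).1 ^ 2 + 1 := by
  induction n with
  | zero => simp [powCoeff]
  | succ n ih =>
    simp only [powCoeff]
    push_cast
    linear_combination ih

lemma one_le_powCoeff_snd (n : ℕ) : 1 ≤ (powCoeff n).2 := by
  induction n with
  | zero => simp [powCoeff]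
  | succ n ih => simp only [powCoeff]; omega

lemma powCoeff_fst_mul {K : Type*} [Field K] {s : K} (hs : s ^ 2 = 3) (n : ℕ) :
    2 * s * ((powCoeff n).1 : K) = (2 + s) ^ n - (2 - s) ^ n ∧
      2 * ((powCoeff n).2 : K) = (2 + s) ^ n + (2 - s) ^ n - 2 * (powCoeff n).1 := by
  induction n with
  | zero => simp [powCoeff]; norm_num
  | succ n ih =>
    obtain ⟨h1, h2⟩ := ih
    simp only [powCoeff]
    push_cast
    constructor
    · linear_combination 2 * h1 + s * h2
    · rw [pow_succ, pow_succ]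
      linear_combination 2 * h2 + s * h1 - 2 * ((powCoeff n).1 : K) * hs

/-- Sequences `p, q, r` such that `M k = [[p k, 2 * q k], [q k, r k]]` starts with the
matrix of `[2, 1, 1, 3, 1]` and satisfies `M (k + 1) = M k * A ^ (k + 1) * M k`
for `A = [[3, 2], [1, 1]]`. -/
structure IsSandwichOrbit (p q r : ℕ → ℕ) : Prop where
  p_zero : p 0 = 23
  q_zero : q 0 = 9
  r_zero : r 0 = 7
  p_succ : ∀ k, p (k + 1) = p k * (p k * ((powCoeff (k + 1)).2 + 2 * (powCoeff (k + 1)).1)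
    + 2 * q k * (powCoeff (k + 1)).1)
    + q k * (2 * (p k * (powCoeff (k + 1)).1 + q k * (powCoeff (k + 1)).2))
  q_succ : ∀ k, q (k + 1) = q k * (p k * ((powCoeff (k + 1)).2 + 2 * (powCoeff (k + 1)).1)
    + 2 * q k * (powCoeff (k + 1)).1)
    + r k * (p k * (powCoeff (k + 1)).1 + q k * (powCoeff (k + 1)).2)
  r_succ : ∀ k, r (k + 1) = q k * (2 * (q k * ((powCoeff (k + 1)).2 + 2 * (powCoeff (k + 1)).1)
    + r k * (powCoeff (k + 1)).1))
    + r k * (2 * q k * (powCoeff (k + 1)).1 + r k * (powCoeff (k + 1)).2)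

namespace IsSandwichOrbit

variable {p q r : ℕ → ℕ}

lemma det (h : IsSandwichOrbit p q r) (k : ℕ) :
    ((p (k + 1) : ℤ) * r (k + 1) - 2 * q (k + 1) ^ 2) = 1 := by
  have key : ∀ k, ((p (k + 1) : ℤ) * r (k + 1) - 2 * q (k + 1) ^ 2) =
      (p k * r k - 2 * q k ^ 2) ^ 2 := by
    intro k
    have := powCoeff_det (k + 1)
    rw [h.p_succ, h.q_succ, h.r_succ]
    push_cast
    linear_combination ((p k : ℤ) * r k - 2 * q k ^ 2) ^ 2 * this
  induction k with
  | zero => rw [key, h.p_zero, h.q_zero, h.r_zero]; norm_num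
  | succ k ih => rw [key, ih]; norm_num

lemma bounds (h : IsSandwichOrbit p q r) (k : ℕ) :
    7 * p k ≤ 18 * q k ∧ 7 * q k ≤ 9 * r k ∧ 2 * q k ≤ p k ∧ r k ≤ q k := by
  induction k with
  | zero => rw [h.p_zero, h.q_zero, h.r_zero]; norm_num
  | succ k ih =>
    obtain ⟨h1, h2, h3, h4⟩ := ih
    rw [h.p_succ, h.q_succ, h.r_succ]
    generalize (powCoeff (k + 1)).1 = Q
    generalize (powCoeff (k + 1)).2 = R
    generalize p k = p at *
    generalize q k = q at *
    generalize r k = r at *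
    refine ⟨?_, ?_, ?_, ?_⟩
    · have e1 := Nat.mul_le_mul_right (p * (R + 2 * Q) + 2 * q * Q) h1
      have e2 := Nat.mul_le_mul_right (p * Q + q * R) h2
      nlinarith
    · have e1 := Nat.mul_le_mul_right (q * (R + 2 * Q) + r * Q) h1
      have e2 := Nat.mul_le_mul_right (2 * q * Q + r * R) h2
      nlinarith
    · have e1 := Nat.mul_le_mul_right (p * (R + 2 * Q) + 2 * q * Q) h3
      have e2 := Nat.mul_le_mul_right (p * Q + q * R) h4
      nlinarith
    · have e1 := Nat.mul_le_mul_right (q * (R + 2 * Q) + r * Q) h3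
      have e2 := Nat.mul_le_mul_right (2 * q * Q + r * R) h4
      nlinarith

lemma two_pow_le (h : IsSandwichOrbit p q r) (k : ℕ) : 2 ^ 2 ^ k ≤ q k := by
  induction k with
  | zero => rw [h.q_zero]; norm_num
  | succ k ih =>
    have h1 := one_le_powCoeff_snd (k + 1)
    have h2 := (h.bounds k).2.2.1
    calc 2 ^ 2 ^ (k + 1) = 2 ^ 2 ^ k * 2 ^ 2 ^ k := by rw [pow_succ, pow_mul, sq]
      _ ≤ q k * q k := Nat.mul_le_mul ih ih
      _ ≤ q k * (p k * ((powCoeff (k + 1)).2 + 2 * (powCoeff (k + 1)).1)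
          + 2 * q k * (powCoeff (k + 1)).1) := by
        refine Nat.mul_le_mul_left _ ?_
        refine le_trans ?_ (Nat.le_add_right _ _)
        calc q k ≤ p k * 1 := by omega
          _ ≤ _ := Nat.mul_le_mul_left _ (by omega)
      _ ≤ q (k + 1) := by rw [h.q_succ]; exact Nat.le_add_right _ _

lemma one_le_q (h : IsSandwichOrbit p q r) (k : ℕ) : 1 ≤ q k :=
  Nat.one_le_two_pow.trans (h.two_pow_le k)

open Filter Topology in
lemma tendsto_pow_div (h : IsSandwichOrbit p q r) (B : ℝ) :
    Tendsto (fun k => B ^ k / (q k : ℝ)) atTop (𝓝 0) := by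
  obtain ⟨c, hc⟩ := pow_unbounded_of_one_lt |B| (one_lt_two)
  have h1 : Tendsto (fun n : ℕ => (n : ℝ) ^ c / 2 ^ n) atTop (𝓝 0) :=
    tendsto_pow_const_div_const_pow_of_one_lt c one_lt_two
  have h2 := h1.comp (tendsto_pow_atTop_atTop_of_one_lt (one_lt_two : 1 < 2))
  refine squeeze_zero_norm (fun k => ?_) h2
  have h3 : (2 : ℝ) ^ 2 ^ k ≤ q k := by exact_mod_cast h.two_pow_le k
  rw [norm_div, norm_pow, Real.norm_eq_abs, Real.norm_eq_abs, Nat.abs_cast]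
  simp only [Function.comp_apply, Nat.cast_pow, Nat.cast_ofNat]
  rw [← pow_mul, mul_comm k c, pow_mul]
  gcongr

end IsSandwichOrbit

section eigen

variable {K : Type*} [Field K]

/-- The component of `M k * A ^ (k + 1)` along the eigenvalue `2 + s` of `A`. -/
def alphaSeq (s : K) (p q r : ℕ → ℕ) (k : ℕ) : K :=
  s * ((1 + s) * p k + 4 * q k + (s - 1) * r k) / 6 * (2 + s) ^ (k + 1)

/-- The component of `M k * A ^ (k + 1)` along the eigenvalue `2 - s` of `A`. -/
def betaSeq (s : K) (p q r : ℕ → ℕ) (k : ℕ) : K :=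
  s * ((s - 1) * p k - 4 * q k + (s + 1) * r k) / 6 * (2 - s) ^ (k + 1)

variable {s : K} {p q r : ℕ → ℕ}

lemma map_alphaSeq {K' : Type*} [Field K'] (ι : K →+* K') (k : ℕ) :
    ι (alphaSeq s p q r k) = alphaSeq (ι s) p q r k := by
  simp [alphaSeq, map_ofNat]

lemma map_betaSeq {K' : Type*} [Field K'] (ι : K →+* K') (k : ℕ) :
    ι (betaSeq s p q r k) = betaSeq (ι s) p q r k := by
  simp [betaSeq, map_ofNat]

lemma IsSandwichOrbit.alphaSeq_betaSeq_succ [CharZero K] (h : IsSandwichOrbit p q r)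
    (hs : s ^ 2 = 3) (k : ℕ) :
    alphaSeq s p q r (k + 2) = (2 + s) * (alphaSeq s p q r (k + 1) *
      (alphaSeq s p q r (k + 1) + betaSeq s p q r (k + 1)) - 1) ∧
    betaSeq s p q r (k + 2) = (2 - s) * (betaSeq s p q r (k + 1) *
      (alphaSeq s p q r (k + 1) + betaSeq s p q r (k + 1)) - 1) := by
  obtain ⟨hQ, hR⟩ := powCoeff_fst_mul hs (k + 2)
  have hww : (2 + s) ^ (k + 2) * (2 - s) ^ (k + 2) = 1 := by
    rw [← mul_pow, show (2 + s) * (2 - s) = 1 by linear_combination -hs, one_pow]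
  have hdet : (p (k + 1) * r (k + 1) - 2 * q (k + 1) ^ 2 : K) = 1 := by
    have := congrArg (Int.cast : ℤ → K) (h.det k)
    push_cast at this
    exact this
  simp only [alphaSeq, betaSeq]
  rw [h.p_succ (k + 1), h.q_succ (k + 1), h.r_succ (k + 1)]
  push_cast
  rw [pow_succ _ (k + 2), pow_succ _ (k + 2)]
  rw [show k + 1 + 1 = k + 2 from rfl]
  generalize (2 + s) ^ (k + 2) = w at *
  generalize (2 - s) ^ (k + 2) = u at *
  generalize ((powCoeff (k + 2)).1 : K) = Q at *
  generalize ((powCoeff (k + 2)).2 : K) = R at *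
  have hQ' : Q = s * (w - u) / 6 := by
    linear_combination (1 / 6 : K) * s * hQ - (1 / 3 : K) * Q * hs
  have hR' : R = (w + u) / 2 - s * (w - u) / 6 := by
    rw [← hQ']
    linear_combination (1 / 2 : K) * hR
  rw [hQ', hR']
  generalize (p (k + 1) : K) = p at *
  generalize (q (k + 1) : K) = q at *
  generalize (r (k + 1) : K) = r at *
  constructor
  · linear_combination (2 + s) * w * ((-(w + u) / 36 * (s ^ 2 * (p + r) ^ 2
      + s * (p ^ 2 + 4 * p * q + 4 * q * r - r ^ 2)) - (p * r - 2 * q ^ 2) * u / 3) * hs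
      - u * hdet) - (2 + s) * hww
  · linear_combination (2 - s) * u * ((-(w + u) / 36 * (s ^ 2 * (p + r) ^ 2
      - s * (p ^ 2 + 4 * p * q + 4 * q * r - r ^ 2)) - (p * r - 2 * q ^ 2) * w / 3) * hs
      - w * hdet) - (2 - s) * hww

end eigen

section limit

open Filter Topology

lemma eventually_abs_sub_le_of_recursion {L : ℝ} (hL : 1 < L) {v r ζ : ℕ → ℝ}
    (hζs : ∀ k, L * ζ (k + 1) = ζ k)
    (hvs : ∀ᶠ k in atTop, v (k + 1) = v k ^ 2 * (L⁻¹ * ((1 + r k - v k)⁻¹) ^ 2))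
    (hrs : ∀ᶠ k in atTop, r k = L * r (k + 1) + v k * (1 - r k) * (1 + r k - v k)⁻¹)
    (hr : Tendsto r atTop (𝓝 0)) (hv : Tendsto v atTop (𝓝 0)) (hv0 : ∀ᶠ k in atTop, 0 < v k)
    (hlim : Tendsto (fun k => L ^ k * (r k - ζ k)) atTop (𝓝 0)) :
    ∀ᶠ k in atTop, |r k - ζ k| ≤ 4 * v k := by
  have hL0 : 0 < L := by linarith
  have hden : Tendsto (fun k => (1 + r k - v k)⁻¹) atTop (𝓝 1) := by
    have := ((hr.const_add 1).sub hv).inv₀ (by norm_num)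
    simpa using this
  have h1 : ∀ᶠ k in atTop, |(1 - r k) * (1 + r k - v k)⁻¹| < 2 := by
    have := ((hr.const_sub 1).mul hden).abs
    exact this.eventually_lt_const (by norm_num)
  have h2 : ∀ᶠ k in atTop, 4 * v k * ((1 + r k - v k)⁻¹) ^ 2 < 2 := by
    have := (hv.const_mul 4).mul (hden.pow 2)
    exact this.eventually_lt_const (by norm_num)
  have hstep : ∀ᶠ k in atTop, 0 < v k ∧
      |r k - ζ k| - 4 * v k ≤ L * (|r (k + 1) - ζ (k + 1)| - 4 * v (k + 1)) := by
    filter_upwards [hvs, hrs, hv0, h1, h2] with k e1 e2 e3 e4 e5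
    refine ⟨e3, ?_⟩
    have f1 : r k - ζ k = L * (r (k + 1) - ζ (k + 1)) +
        v k * ((1 - r k) * (1 + r k - v k)⁻¹) := by linear_combination e2 + hζs k
    have f2 : |r k - ζ k| ≤ L * |r (k + 1) - ζ (k + 1)| + v k * 2 := by
      rw [f1]
      refine (abs_add_le _ _).trans ?_
      rw [abs_mul, abs_mul, abs_of_pos hL0, abs_of_pos e3]
      gcongr
    have f3 : L * (4 * v (k + 1)) ≤ v k * 2 := by
      rw [e1]
      calc _ = v k * (4 * v k * ((1 + r k - v k)⁻¹) ^ 2) := by field_simp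
        _ ≤ v k * 2 := by gcongr
    linarith
  obtain ⟨k₀, hk₀⟩ := eventually_atTop.1 hstep
  filter_upwards [eventually_ge_atTop k₀] with k hk
  have hmono : ∀ n, k ≤ n → L ^ k * (|r k - ζ k| - 4 * v k) ≤
      L ^ n * (|r n - ζ n| - 4 * v n) := by
    intro n hn
    induction n, hn using Nat.le_induction with
    | base => exact le_rfl
    | succ n hn ih =>
      refine ih.trans ?_
      rw [pow_succ, mul_assoc]
      exact mul_le_mul_of_nonneg_left (hk₀ n (hk.trans hn)).2 (pow_pos hL0 n).le
  have hle : L ^ k * (|r k - ζ k| - 4 * v k) ≤ 0 := by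
    have h0 : Tendsto (fun n => L ^ n * |r n - ζ n|) atTop (𝓝 0) := by
      have := hlim.abs
      simpa [abs_mul, abs_of_pos (pow_pos hL0 _)] using this
    refine ge_of_tendsto h0 ?_
    filter_upwards [eventually_ge_atTop k] with n hn
    refine (hmono n hn).trans (mul_le_mul_of_nonneg_left ?_ (pow_pos hL0 n).le)
    linarith [(hk₀ n (hk.trans hn)).1]
  have := nonpos_of_mul_nonpos_right hle (pow_pos hL0 k)
  linarith

end limit

/-- The limit of the ratio of the two eigencomponents, as a function of the limit `τ` of
`p k / q k`. -/
def ratioLimit {K : Type*} [Field K] (s τ : K) : K :=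
  ((s - 1) * τ ^ 2 - 4 * τ + 2 * (s + 1)) / ((1 + s) * τ ^ 2 + 4 * τ + 2 * (s - 1))

namespace IsSandwichOrbit

open Filter Topology

variable {p q r : ℕ → ℕ} {s τ : ℝ}

lemma limit_bounds (h : IsSandwichOrbit p q r)
    (hτ : Tendsto (fun k => (p k : ℝ) / q k) atTop (𝓝 τ)) : 2 ≤ τ ∧ τ ≤ 18 / 7 := by
  constructor
  · refine ge_of_tendsto' hτ fun k => ?_
    have h1 : (1 : ℝ) ≤ q k := by exact_mod_cast h.one_le_q k
    have h2 : 2 * (q k : ℝ) ≤ p k := by exact_mod_cast (h.bounds k).2.2.1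
    rw [le_div_iff₀ (by linarith)]
    exact h2
  · refine le_of_tendsto' hτ fun k => ?_
    have h1 : (1 : ℝ) ≤ q k := by exact_mod_cast h.one_le_q k
    have h2 : 7 * (p k : ℝ) ≤ 18 * q k := by exact_mod_cast (h.bounds k).1
    rw [div_le_iff₀ (by linarith)]
    linarith

lemma ratioLimit_pos (hs : s ^ 2 = 3) (hs1 : 17 / 10 < s) (h2 : 2 ≤ τ) (h3 : τ ≤ 18 / 7) :
    0 < ratioLimit s τ := by
  have e : (s - 1) * τ ^ 2 - 4 * τ + 2 * (s + 1) = (s - 1) * (1 + s - τ) ^ 2 := by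
    linear_combination (2 * τ - s - 1) * hs
  rw [ratioLimit, e]
  have h4 : 0 < s - 1 := by linarith
  have h5 : 0 < 1 + s - τ := by linarith
  have h6 : 0 < 1 + s := by linarith
  positivity

lemma tendsto_ratio (h : IsSandwichOrbit p q r)
    (hτ : Tendsto (fun k => (p k : ℝ) / q k) atTop (𝓝 τ)) (hs1 : 17 / 10 < s) :
    Tendsto (fun k => ((s - 1) * p k - 4 * q k + (s + 1) * r k) /
      ((1 + s) * p k + 4 * q k + (s - 1) * r k)) atTop (𝓝 (ratioLimit s τ)) := by
  have hτ2 := (h.limit_bounds hτ).1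
  have hinv : Tendsto (fun k => ((q k : ℝ))⁻¹) atTop (𝓝 0) := by
    simpa using h.tendsto_pow_div 1
  have hr : Tendsto (fun k => (r k : ℝ) / q k) atTop (𝓝 (2 / τ)) := by
    have h1 : Tendsto (fun k => (2 + ((q k : ℝ))⁻¹ ^ 2) / ((p k : ℝ) / q k)) atTop
        (𝓝 ((2 + 0 ^ 2) / τ)) := (tendsto_const_nhds.add (hinv.pow 2)).div hτ (by linarith)
    have e : (2 + 0 ^ 2) / τ = 2 / τ := by norm_num
    rw [e] at h1
    refine h1.congr' ?_
    filter_upwards [eventually_ge_atTop 1] with k hk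
    obtain ⟨k, rfl⟩ := Nat.exists_eq_add_of_le' hk
    have hdet : (p (k + 1) * r (k + 1) - 2 * q (k + 1) ^ 2 : ℝ) = 1 := by
      exact_mod_cast h.det k
    have h1 : (1 : ℝ) ≤ q (k + 1) := by exact_mod_cast h.one_le_q _
    have h2 : 2 * (q (k + 1) : ℝ) ≤ p (k + 1) := by exact_mod_cast (h.bounds _).2.2.1
    have h3 : (q (k + 1) : ℝ) ≠ 0 := by linarith
    have h4 : (p (k + 1) : ℝ) ≠ 0 := by linarith
    field_simp
    linear_combination -hdet
  have hτ0 : τ ≠ 0 := by linarith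
  have hs' : 0 < s - 1 := by linarith
  have hs'' : 0 < 1 + s := by linarith
  have hden : (1 + s) * τ + 4 + (s - 1) * (2 / τ) ≠ 0 := by positivity
  have hmain := (((hτ.const_mul (s - 1)).sub_const 4).add (hr.const_mul (s + 1))).div
    (((hτ.const_mul (1 + s)).add_const 4).add (hr.const_mul (s - 1))) hden
  have e : ((s - 1) * τ - 4 + (s + 1) * (2 / τ)) / ((1 + s) * τ + 4 + (s - 1) * (2 / τ)) =
      ratioLimit s τ := by
    rw [ratioLimit]
    have h1 : (1 + s) * τ ^ 2 + 4 * τ + 2 * (s - 1) ≠ 0 := by positivity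
    rw [div_eq_div_iff hden h1]
    field_simp
  rw [e] at hmain
  refine hmain.congr fun k => ?_
  have h1 : (1 : ℝ) ≤ q k := by exact_mod_cast h.one_le_q k
  have h0 : (q k : ℝ) ≠ 0 := by linarith
  simp only [Pi.div_apply]
  rw [← mul_div_mul_right _ _ h0]
  congr 1 <;> field_simp

lemma q_le_alphaSeq (h : IsSandwichOrbit p q r) (hs1 : 17 / 10 < s) (k : ℕ) :
    (q k : ℝ) ≤ alphaSeq s p q r k := by
  have h1 : (1 : ℝ) ≤ q k := by exact_mod_cast h.one_le_q k
  have h2 : 2 * (q k : ℝ) ≤ p k := by exact_mod_cast (h.bounds k).2.2.1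
  have h3 : (0 : ℝ) ≤ r k := Nat.cast_nonneg _
  have h4 : (1 : ℝ) ≤ (2 + s) ^ (k + 1) := one_le_pow₀ (by linarith)
  have h5 : (q k : ℝ) ≤ s * ((1 + s) * p k + 4 * q k + (s - 1) * r k) / 6 := by
    have e1 : 0 ≤ (s - 1) * r k := mul_nonneg (by linarith) h3
    have e2 : 2 * (2 * (q k : ℝ)) ≤ (1 + s) * p k :=
      mul_le_mul (by linarith) h2 (by linarith) (by linarith)
    have e3 : 1 * (6 * (q k : ℝ)) ≤ s * ((1 + s) * p k + 4 * q k + (s - 1) * r k) :=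
      mul_le_mul (by linarith) (by linarith) (by linarith) (by linarith)
    linarith
  rw [alphaSeq]
  exact h5.trans (le_mul_of_one_le_right (by linarith) h4)

lemma alphaSeq_le (h : IsSandwichOrbit p q r) (hs1 : 17 / 10 < s) (hs2 : s < 18 / 10) (k : ℕ) :
    alphaSeq s p q r k ≤ 20 * (2 + s) ^ (k + 1) * q k := by
  have h1 : (1 : ℝ) ≤ q k := by exact_mod_cast h.one_le_q k
  have h2 : 7 * (p k : ℝ) ≤ 18 * q k := by exact_mod_cast (h.bounds k).1
  have h3 : (r k : ℝ) ≤ q k := by exact_mod_cast (h.bounds k).2.2.2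
  have hp : (0 : ℝ) ≤ p k := Nat.cast_nonneg _
  have hr : (0 : ℝ) ≤ r k := Nat.cast_nonneg _
  have h4 : (0 : ℝ) < (2 + s) ^ (k + 1) := pow_pos (by linarith) _
  have h5 : s * ((1 + s) * p k + 4 * q k + (s - 1) * r k) / 6 ≤ 20 * q k := by
    have e1 : (s - 1) * r k ≤ 1 * q k := mul_le_mul (by linarith) h3 hr (by linarith)
    have e2 : (1 + s) * p k ≤ 3 * (18 / 7 * q k) :=
      mul_le_mul (by linarith) (by linarith) hp (by linarith)
    have e3 : s * ((1 + s) * p k + 4 * q k + (s - 1) * r k) ≤ 2 * (20 * q k) := by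
      have := mul_nonneg (by linarith : (0:ℝ) ≤ 1 + s) hp
      have := mul_nonneg (by linarith : (0:ℝ) ≤ s - 1) hr
      exact mul_le_mul (by linarith) (by linarith) (by linarith) (by linarith)
    linarith
  rw [alphaSeq]
  calc _ ≤ 20 * q k * (2 + s) ^ (k + 1) := by gcongr
    _ = _ := by ring

end IsSandwichOrbit

namespace IsSandwichOrbit

open Filter Topology Polynomial

variable {p q r : ℕ → ℕ} {K : Type*} [Field K] {s : K}

lemma controlled_q :
    Controlled (fun k => (q k : ℝ)) 1 (fun k => (q k : K)) :=
  Controlled.natCast le_rfl fun k => by simp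

lemma controlled_p (h : IsSandwichOrbit p q r) :
    Controlled (fun k => (q k : ℝ)) 1 (fun k => (p k : K)) :=
  Controlled.natCast (C := 3) (by norm_num) fun k => by
    have := (h.bounds k).1
    have h2 : p k ≤ 3 * q k := by omega
    exact_mod_cast h2

lemma controlled_r (h : IsSandwichOrbit p q r) :
    Controlled (fun k => (q k : ℝ)) 1 (fun k => (r k : K)) :=
  Controlled.natCast le_rfl fun k => by
    rw [one_mul]
    exact_mod_cast (h.bounds k).2.2.2

lemma one_le_cast_q (h : IsSandwichOrbit p q r) (k : ℕ) : (1 : ℝ) ≤ q k := by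
  exact_mod_cast h.one_le_q k

lemma isIntegral_of_sq_eq (hs : s ^ 2 = 3) : IsIntegral ℤ s := by
  refine IsIntegral.of_pow (n := 2) two_pos ?_
  rw [hs]
  exact_mod_cast isIntegral_natCast (R := ℤ) (B := K) 3

variable [NumberField K]

lemma controlled_linear (h : IsSandwichOrbit p q r) (a b c : K) {u : K} (hu : IsIntegral ℤ u) :
    Controlled (fun k => (q k : ℝ)) 1
      (fun k => s * (a * p k + b * q k + c * r k) / 6 * u ^ (k + 1)) := by
  have hQ := h.one_le_cast_q
  have h1 := (((Controlled.const a).mul (h.controlled_p (K := K))).add hQ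
    ((Controlled.const b).mul (controlled_q (q := q) (K := K)))).add hQ
    ((Controlled.const c).mul (h.controlled_r (K := K)))
  have h2 := ((Controlled.const (s / 6 * u)).mul h1).mul
    (Controlled.pow_of_isIntegral (Q := fun k => (q k : ℝ)) hu)
  refine (h2.mono hQ (by norm_num)).congr fun k => ?_
  ring

lemma controlled_alphaSeq (h : IsSandwichOrbit p q r) (hs : s ^ 2 = 3) :
    Controlled (fun k => (q k : ℝ)) 1 (alphaSeq s p q r) := by
  refine (h.controlled_linear (s := s) (1 + s) 4 (s - 1)
    ((isIntegral_natCast 2).add (isIntegral_of_sq_eq hs))).congr fun k => ?_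
  simp [alphaSeq]

lemma controlled_betaSeq (h : IsSandwichOrbit p q r) (hs : s ^ 2 = 3) :
    Controlled (fun k => (q k : ℝ)) 1 (betaSeq s p q r) := by
  refine (h.controlled_linear (s := s) (s - 1) (-4) (s + 1)
    ((isIntegral_natCast 2).sub (isIntegral_of_sq_eq hs))).congr fun k => ?_
  simp [betaSeq, sub_eq_add_neg]

theorem false_of_tendsto (h : IsSandwichOrbit p q r) (ι : K →+* ℝ) {τ : K} (hs : s ^ 2 = 3)
    (hs0 : 0 < ι s) (hτ : Tendsto (fun k => (p k : ℝ) / q k) atTop (𝓝 (ι τ))) : False := by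
  have hσ : ι s ^ 2 = 3 := by rw [← map_pow, hs, map_ofNat]
  have hσ1 : 17 / 10 < ι s := by nlinarith
  have hσ2 : ι s < 18 / 10 := by nlinarith
  obtain ⟨hτ1, hτ2⟩ := h.limit_bounds hτ
  set α := alphaSeq (ι s) p q r with hα
  set β := betaSeq (ι s) p q r with hβ
  set ρ := ratioLimit (ι s) (ι τ) with hρ
  set m := (2 - ι s) ^ 2 with hm
  have hιL : ι ((2 + s) ^ 2) = (2 + ι s) ^ 2 := by simp [map_ofNat]
  have hLm : (2 + ι s) ^ 2 * m = 1 := by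
    rw [hm, ← mul_pow, show (2 + ι s) * (2 - ι s) = 1 by linear_combination -hσ, one_pow]
  have hL1 : 1 < (2 + ι s) ^ 2 := by nlinarith
  have hm0 : 0 < m := by rw [hm]; have : 0 < 2 - ι s := by linarith
                         positivity
  have hm1 : m < 1 := by nlinarith
  have hρ0 : 0 < ρ := ratioLimit_pos hσ hσ1 hτ1 hτ2
  have hαq : ∀ k, (q k : ℝ) ≤ α k := h.q_le_alphaSeq hσ1
  have hα1 : ∀ k, 1 ≤ α k := fun k => (h.one_le_cast_q k).trans (hαq k)
  have hα0 : ∀ k, α k ≠ 0 := fun k => by linarith [hα1 k]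
  have hratio := h.tendsto_ratio hτ hσ1
  set f : ℕ → ℝ := fun k => ((ι s - 1) * p k - 4 * q k + (ι s + 1) * r k) /
      ((1 + ι s) * p k + 4 * q k + (ι s - 1) * r k) with hf
  set v : ℕ → ℝ := fun k => (α k ^ 2)⁻¹ with hv
  set t : ℕ → ℝ := fun k => β k / α k with ht
  set ζ : ℕ → ℝ := fun k => ρ * m ^ (k + 1) with hζ
  have hmlim : Tendsto (fun k => m ^ (k + 1)) atTop (𝓝 0) :=
    (tendsto_pow_atTop_nhds_zero_of_lt_one hm0.le hm1).comp (tendsto_add_atTop_nat 1)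
  have htf : ∀ k, t k = f k * m ^ (k + 1) := by
    intro k
    have h1 : α k ≠ 0 := hα0 k
    have h2 : (2 + ι s) * (2 - ι s) = 1 := by linear_combination -hσ
    have h3 : (1 + ι s) * p k + 4 * q k + (ι s - 1) * r k ≠ 0 := by
      intro h3
      apply h1
      rw [hα, alphaSeq, h3]
      simp
    have h4 : (2 + ι s) ^ (k + 1) * (2 - ι s) ^ (k + 1) = 1 := by rw [← mul_pow, h2, one_pow]
    simp only [ht, hf, hm]
    rw [div_mul_eq_mul_div, div_eq_div_iff h1 h3, hα, hβ, alphaSeq, betaSeq, ← pow_mul,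
      mul_comm 2 (k + 1), pow_mul]
    linear_combination (-(((ι s - 1) * p k - 4 * q k + (ι s + 1) * r k) * (2 - ι s) ^ (k + 1) *
      (ι s * ((1 + ι s) * p k + 4 * q k + (ι s - 1) * r k) / 6))) * h4
  have hv0 : ∀ k, 0 < v k := fun k => by
    have := hα1 k
    simp only [hv]
    positivity
  have hvq : ∀ k, v k ≤ ((q k : ℝ) ^ 2)⁻¹ := fun k => by
    have := h.one_le_cast_q k
    have := hαq k
    simp only [hv]
    gcongr
  have hζ0 : ∀ k, 0 < ζ k := fun k => mul_pos hρ0 (pow_pos hm0 _)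
  have hζlim : Tendsto ζ atTop (𝓝 0) := by simpa using hmlim.const_mul ρ
  have hζs : ∀ k, (2 + ι s) ^ 2 * ζ (k + 1) = ζ k := fun k => by
    simp only [hζ]
    rw [pow_succ m (k + 1)]
    linear_combination ρ * m ^ (k + 1) * hLm
  have hvζ : ∀ n : ℕ, Tendsto (fun k => v k / ζ k ^ n) atTop (𝓝 0) := by
    intro n
    have h1 := (h.tendsto_pow_div (((2 + ι s) ^ 2) ^ n)).const_mul ((((2 + ι s) ^ 2) / ρ) ^ n)
    rw [mul_zero] at h1
    refine squeeze_zero (fun k => div_nonneg (hv0 k).le (pow_nonneg (hζ0 k).le _)) (fun k => ?_) h1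
    have h2 := h.one_le_cast_q k
    have h3 : v k ≤ (q k : ℝ)⁻¹ := (hvq k).trans (by gcongr; nlinarith)
    have h4 : (ζ k)⁻¹ = (2 + ι s) ^ 2 / ρ * ((2 + ι s) ^ 2) ^ k := by
      have : m = ((2 + ι s) ^ 2)⁻¹ := eq_inv_of_mul_eq_one_right hLm
      simp only [hζ]
      rw [this, mul_inv, inv_pow, inv_inv, pow_succ]
      ring
    have h5 := pow_pos (hζ0 k) n
    calc v k / ζ k ^ n ≤ (q k : ℝ)⁻¹ / ζ k ^ n := by gcongr
      _ = (q k : ℝ)⁻¹ * ((ζ k)⁻¹) ^ n := by rw [inv_pow, div_eq_mul_inv]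
      _ = _ := by
        rw [h4, mul_pow, pow_right_comm]
        ring
  have hvlim : Tendsto v atTop (𝓝 0) := by simpa using hvζ 0
  have htlim : Tendsto t atTop (𝓝 0) := by
    have := hratio.mul hmlim
    rw [mul_zero] at this
    exact this.congr fun k => (htf k).symm
  have hdiff : Tendsto (fun k => ((2 + ι s) ^ 2) ^ k * (t k - ζ k)) atTop (𝓝 0) := by
    have h1 := (hratio.sub_const ρ).mul_const m
    rw [sub_self, zero_mul] at h1
    refine h1.congr fun k => ?_
    have h2 : ((2 + ι s) ^ 2) ^ k * m ^ k = 1 := by rw [← mul_pow, hLm, one_pow]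
    rw [htf, pow_succ]
    linear_combination (-(f k - ρ) * m) * h2
  have hden : ∀ᶠ k in atTop, 1 + t k - v k ≠ 0 := by
    have h1 := (htlim.const_add 1).sub hvlim
    simp only [add_zero, sub_zero] at h1
    exact h1.eventually_ne one_ne_zero
  have hrec : ∀ᶠ k in atTop,
      α (k + 1) = (2 + ι s) * (α k ^ 2 * (1 + t k - v k)) ∧
      β (k + 1) = (2 - ι s) * (α k ^ 2 * (t k * (1 + t k) - v k)) := by
    filter_upwards [eventually_ge_atTop 1] with k hk
    obtain ⟨k, rfl⟩ := Nat.exists_eq_add_of_le' hk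
    obtain ⟨h1, h2⟩ := h.alphaSeq_betaSeq_succ hσ k
    have h3 := hα0 (k + 1)
    constructor
    · rw [hα, h1, ← hα, ← hβ]
      simp only [hv, ht]
      field_simp
    · rw [hβ, h2, ← hα, ← hβ]
      simp only [hv, ht]
      field_simp
  have hσ3 : (2 + ι s) ≠ 0 := by linarith
  have hμ : (2 - ι s) = (2 + ι s)⁻¹ :=
    eq_inv_of_mul_eq_one_right (by linear_combination -hσ)
  have hvs : ∀ᶠ k in atTop, v (k + 1) =
      v k ^ 2 * (((2 + ι s) ^ 2)⁻¹ * ((1 + t k - v k)⁻¹) ^ 2) := by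
    filter_upwards [hrec] with k hk
    simp only [hv] at hk ⊢
    rw [hk.1]
    simp only [mul_pow, mul_inv, inv_pow]
    ring
  have hts : ∀ᶠ k in atTop, t k =
      (2 + ι s) ^ 2 * t (k + 1) + v k * (1 - t k) * (1 + t k - v k)⁻¹ := by
    filter_upwards [hrec, hden] with k hk hk'
    have h1 := hα0 k
    have h2 : t (k + 1) = (2 - ι s) * (t k * (1 + t k) - v k) /
        ((2 + ι s) * (1 + t k - v k)) := by
      have : t (k + 1) = β (k + 1) / α (k + 1) := rfl
      rw [this, hk.1, hk.2, mul_left_comm, mul_left_comm (2 + ι s),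
        mul_div_mul_left _ _ (pow_ne_zero 2 h1)]
    rw [h2, hμ]
    field_simp
    ring
  have hD := eventually_abs_sub_le_of_recursion hL1 hζs hvs hts htlim hvlim
    (Eventually.of_forall hv0) hdiff
  set E := 2 * Module.finrank ℚ K with hE
  have hd1 : 1 ≤ Module.finrank ℚ K := Module.finrank_pos
  set N := (E + 1) ^ 2 - 1 with hN
  obtain ⟨P, hP0, C, hC⟩ := exists_small_nonzero ι (L := (2 + s) ^ 2) (by rwa [hιL]) hζ0 hζlim
    (by rwa [hιL]) hvζ (by rwa [hιL]) (by rwa [hιL]) htlim hD (Eventually.of_forall hv0)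
    (E := E) (N := N) (Nat.sub_lt (by positivity) one_pos)
  set z : ℕ → K := fun k => ratioLimit s τ * ((2 - s) ^ 2) ^ (k + 1) with hz
  have hιz : ∀ k, ι (z k) = ζ k := fun k => by
    simp [hz, hζ, hρ, hm, ratioLimit, map_ofNat]
  set y : ℕ → K := fun k => ∑ i, ∑ j, (P i j).eval (z k) *
    alphaSeq s p q r k ^ (3 * E - 2 * i - j) * betaSeq s p q r k ^ (j : ℕ) with hy
  have hιy : ∀ k, ι (y k) = α k ^ (3 * E) *
      ∑ i, ∑ j, (P i j).eval₂ ι (ζ k) * v k ^ (i : ℕ) * t k ^ (j : ℕ) := by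
    intro k
    simp only [hy, map_sum, map_mul, map_pow, Finset.mul_sum]
    refine Finset.sum_congr rfl fun i _ => Finset.sum_congr rfl fun j _ => ?_
    rw [map_alphaSeq, map_betaSeq, ← hα, ← hβ, ← hιz, Polynomial.eval₂_at_apply]
    have h1 := hα0 k
    have h2 : 3 * E = (3 * E - 2 * i - j) + 2 * i + j := by omega
    have h3 : α k ^ (3 * E) = α k ^ (3 * E - 2 * i - j) * (α k ^ 2) ^ (i : ℕ) * α k ^ (j : ℕ) := by
      rw [← pow_mul, ← pow_add, ← pow_add, ← h2]
    rw [h3]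
    simp only [hv, ht, inv_pow, div_pow]
    field_simp
  have hQ := h.one_le_cast_q
  have hzc : Controlled (fun k => (q k : ℝ)) 0 z := by
    have hi : IsIntegral ℤ ((2 - s) ^ 2) :=
      ((isIntegral_natCast 2).sub (isIntegral_of_sq_eq hs)).pow 2
    refine ((Controlled.const (ratioLimit s τ * (2 - s) ^ 2)).mul
      (Controlled.pow_of_isIntegral hi)).congr fun k => ?_
    simp only [hz]
    ring
  have hyc : Controlled (fun k => (q k : ℝ)) (3 * E) y := by
    refine Controlled.sum hQ _ fun i _ => Controlled.sum hQ _ fun j _ => ?_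
    refine (((Controlled.eval hQ hzc (P i j)).mul ((h.controlled_alphaSeq hs).pow _)).mul
      ((h.controlled_betaSeq hs).pow _)).mono hQ ?_
    omega
  have hy0 : ∀ᶠ k in atTop, y k ≠ 0 := by
    filter_upwards [hP0] with k hk h0
    have h1 := hιy k
    rw [h0, map_zero] at h1
    exact mul_ne_zero (pow_ne_zero _ (hα0 k)) hk h1.symm
  have hsmall : ∀ᶠ k in atTop, |ι (y k)| * (q k : ℝ) ^ (2 * N) ≤
      C * (20 * (2 + ι s)) ^ (3 * E) * ((2 + ι s) ^ (3 * E)) ^ k * (q k : ℝ) ^ (3 * E) := by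
    filter_upwards [hC] with k hk
    have h1 := hα1 k
    have hC0 : 0 ≤ C := nonneg_of_mul_nonneg_left ((abs_nonneg _).trans hk) (pow_pos (hv0 k) N)
    have h2 : (q k : ℝ) ^ (2 * N) ≤ α k ^ (2 * N) := pow_le_pow_left₀ (by linarith [hQ k]) (hαq k) _
    have h3 := h.alphaSeq_le hσ1 hσ2 k
    rw [hιy, abs_mul, abs_of_pos (by positivity)]
    calc _ ≤ α k ^ (3 * E) * (C * v k ^ N) * α k ^ (2 * N) := by gcongr
      _ = C * α k ^ (3 * E) := by
        simp only [hv, inv_pow, ← pow_mul]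
        field_simp
      _ ≤ C * (20 * (2 + ι s) ^ (k + 1) * q k) ^ (3 * E) := by gcongr
      _ = _ := by
        simp only [mul_pow, ← pow_mul]
        ring
  obtain ⟨C', B, hCB⟩ := hyc.eventually_le_of_small ι hQ hy0 hsmall (by
    have h1 : N = 4 * (Module.finrank ℚ K) ^ 2 + 4 * Module.finrank ℚ K := by
      rw [hN, hE, Nat.sub_eq_iff_eq_add (Nat.one_le_pow _ _ (by omega))]
      ring
    rw [h1, hE]
    nlinarith)
  have hlim := (h.tendsto_pow_div B).const_mul C'
  rw [mul_zero] at hlim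
  obtain ⟨k, hk1, hk2⟩ := (hCB.and (hlim.eventually_lt_const one_pos)).exists
  rw [← mul_div_assoc, div_lt_one (by linarith [hQ k])] at hk2
  linarith

end IsSandwichOrbit

open Filter Topology in
theorem IsSandwichOrbit.transcendental {p q r : ℕ → ℕ} (h : IsSandwichOrbit p q r) {τ : ℝ}
    (hτ : Tendsto (fun k => (p k : ℝ) / q k) atTop (𝓝 τ)) : Transcendental ℚ τ := by
  intro halg
  have h3 : IsIntegral ℚ (√3 : ℝ) := by
    refine IsIntegral.of_pow (n := 2) two_pos ?_
    rw [Real.sq_sqrt (by norm_num)]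
    exact_mod_cast isIntegral_natCast (R := ℚ) (B := ℝ) 3
  set F := IntermediateField.adjoin ℚ {√3, τ} with hF
  have : FiniteDimensional ℚ F := IntermediateField.finiteDimensional_adjoin (by
    rintro x (rfl | rfl)
    · exact h3
    · exact halg.isIntegral)
  have : NumberField F := ⟨⟩
  have hs : √3 ∈ F := IntermediateField.subset_adjoin _ _ (by simp)
  have ht : τ ∈ F := IntermediateField.subset_adjoin _ _ (by simp)
  refine h.false_of_tendsto (s := ⟨√3, hs⟩) (algebraMap F ℝ) (τ := ⟨τ, ht⟩) ?_ ?_ hτ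
  · apply Subtype.ext
    push_cast
    exact Real.sq_sqrt (by norm_num)
  · exact Real.sqrt_pos.2 (by norm_num)

/-- The product of the matrices `[[a, 1], [1, 0]]` over the partial quotients `a` of a list. -/
def cfMat (l : List ℕ) : Matrix (Fin 2) (Fin 2) ℕ := (l.map fun a => !![a, 1; 1, 0]).prod

lemma cfMat_append (l l' : List ℕ) : cfMat (l ++ l') = cfMat l * cfMat l' := by
  simp [cfMat]

lemma cfMat_reverse (l : List ℕ) : cfMat l.reverse = (cfMat l).transpose := by
  rw [cfMat, cfMat, Matrix.transpose_list_prod, List.map_map, ← List.map_reverse]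
  congr 2
  funext a
  ext i j
  fin_cases i <;> fin_cases j <;> rfl

lemma cfMat_listPow (l : List ℕ) (n : ℕ) : cfMat (listPow l n) = cfMat l ^ n := by
  induction n with
  | zero => simp [cfMat, listPow]
  | succ n ih =>
    rw [listPow, List.replicate_succ, List.flatten_cons, cfMat_append, pow_succ', ← ih, listPow]

lemma cfMat_pos {l : List ℕ} (hl : ∀ a ∈ l, 0 < a) : 0 < cfMat l 0 0 := by
  induction l with
  | nil => simp [cfMat]
  | cons a l ih =>
    have h1 := ih fun b hb => hl b (List.mem_cons_of_mem _ hb)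
    have h2 := hl a List.mem_cons_self
    rw [← List.singleton_append, cfMat_append]
    simp only [cfMat, List.map_cons, List.map_nil, List.prod_singleton, Matrix.mul_apply,
      Fin.sum_univ_two] at h1 ⊢
    simp only [Matrix.cons_val', Matrix.cons_val_zero, Matrix.cons_val_one, Matrix.of_apply,
      Matrix.cons_val_fin_one]
    positivity

lemma cfVal_eq_div (l : List ℕ) (hl : ∀ a ∈ l, 0 < a) (hl0 : l ≠ []) :
    cfVal l = (cfMat l 0 0 : ℝ) / cfMat l 1 0 := by
  induction l with
  | nil => exact absurd rfl hl0
  | cons a l ih =>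
    cases l with
    | nil => simp [cfVal, cfMat]
    | cons b l =>
      have hl' : ∀ c ∈ b :: l, 0 < c := fun c hc => hl c (List.mem_cons_of_mem _ hc)
      have hpos : (0 : ℝ) < cfMat (b :: l) 0 0 := by exact_mod_cast cfMat_pos hl'
      have e : cfMat (a :: b :: l) = !![a, 1; 1, 0] * cfMat (b :: l) := by
        simp [cfMat]
      rw [cfVal, ih hl' (List.cons_ne_nil _ _), e]
      simp only [Matrix.mul_apply, Fin.sum_univ_two]
      simp
      field_simp

lemma cfMat_two_one_pow (n : ℕ) : cfMat [2, 1] ^ n =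
    !![(powCoeff n).2 + 2 * (powCoeff n).1, 2 * (powCoeff n).1;
      (powCoeff n).1, (powCoeff n).2] := by
  induction n with
  | zero => ext i j; fin_cases i <;> fin_cases j <;> simp [powCoeff]
  | succ n ih =>
    rw [pow_succ, ih]
    ext i j
    fin_cases i <;> fin_cases j <;>
      simp [cfMat, Matrix.mul_apply, Fin.sum_univ_two, powCoeff] <;> ring

section sandwich

variable {T : ℕ → List ℕ}

lemma cfMat_sandwich (hTk : ∀ k, T (k + 1) = T k ++ listPow [2, 1] (k + 1) ++ T k) (k : ℕ) :
    cfMat (T (k + 1)) = cfMat (T k) * !![(powCoeff (k + 1)).2 + 2 * (powCoeff (k + 1)).1,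
      2 * (powCoeff (k + 1)).1; (powCoeff (k + 1)).1, (powCoeff (k + 1)).2] * cfMat (T k) := by
  rw [hTk, cfMat_append, cfMat_append, cfMat_listPow, cfMat_two_one_pow]

lemma cfMat_sandwich_symm (hT0 : T 0 = [2, 1, 1, 3, 1])
    (hTk : ∀ k, T (k + 1) = T k ++ listPow [2, 1] (k + 1) ++ T k) (k : ℕ) :
    cfMat (T k) 0 1 = 2 * cfMat (T k) 1 0 := by
  induction k with
  | zero => rw [hT0]; simp [cfMat]
  | succ k ih =>
    rw [cfMat_sandwich hTk]
    simp only [Matrix.mul_apply, Fin.sum_univ_two]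
    simp [ih]
    ring

lemma isSandwichOrbit_cfMat (hT0 : T 0 = [2, 1, 1, 3, 1])
    (hTk : ∀ k, T (k + 1) = T k ++ listPow [2, 1] (k + 1) ++ T k) :
    IsSandwichOrbit (fun k => cfMat (T k) 0 0) (fun k => cfMat (T k) 1 0)
      (fun k => cfMat (T k) 1 1) where
  p_zero := by rw [hT0]; simp [cfMat]
  q_zero := by rw [hT0]; simp [cfMat]
  r_zero := by rw [hT0]; simp [cfMat]
  p_succ k := by
    simp only [cfMat_sandwich hTk, Matrix.mul_apply, Fin.sum_univ_two]
    simp [cfMat_sandwich_symm hT0 hTk]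
    ring
  q_succ k := by
    simp only [cfMat_sandwich hTk, Matrix.mul_apply, Fin.sum_univ_two]
    simp
    ring
  r_succ k := by
    simp only [cfMat_sandwich hTk, Matrix.mul_apply, Fin.sum_univ_two]
    simp [cfMat_sandwich_symm hT0 hTk]
    ring

lemma pos_of_mem_sandwich (hT0 : T 0 = [2, 1, 1, 3, 1])
    (hTk : ∀ k, T (k + 1) = T k ++ listPow [2, 1] (k + 1) ++ T k) (k : ℕ) :
    ∀ a ∈ T k, 0 < a := by
  induction k with
  | zero => rw [hT0]; simp
  | succ k ih =>
    intro a ha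
    rw [hTk, List.mem_append, List.mem_append] at ha
    rcases ha with (ha | ha) | ha
    · exact ih a ha
    · rw [listPow, List.mem_flatten] at ha
      obtain ⟨l, hl, hal⟩ := ha
      rw [List.eq_of_mem_replicate hl] at hal
      simp only [List.mem_cons, List.not_mem_nil, or_false] at hal
      omega
    · exact ih a ha

lemma length_sandwich_pos (hT0 : T 0 = [2, 1, 1, 3, 1])
    (hTk : ∀ k, T (k + 1) = T k ++ listPow [2, 1] (k + 1) ++ T k) (k : ℕ) :
    0 < (T k).length := by
  induction k with
  | zero => rw [hT0]; simp
  | succ k ih =>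
    rw [hTk, List.length_append]
    omega

lemma strictMono_length_sandwich (hT0 : T 0 = [2, 1, 1, 3, 1])
    (hTk : ∀ k, T (k + 1) = T k ++ listPow [2, 1] (k + 1) ++ T k) :
    StrictMono fun k => (T k).length - 1 := by
  refine strictMono_nat_of_lt_succ fun k => ?_
  have h := length_sandwich_pos hT0 hTk k
  rw [hTk, List.length_append, List.length_append]
  omega

lemma isMPal_sandwich (hT0 : T 0 = [2, 1, 1, 3, 1])
    (hTk : ∀ k, T (k + 1) = T k ++ listPow [2, 1] (k + 1) ++ T k) (k : ℕ) :
    IsMPal 2 (T k) := by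
  have hpos := pos_of_mem_sandwich hT0 hTk k
  have hne : T k ≠ [] := List.ne_nil_of_length_pos (length_sandwich_pos hT0 hTk k)
  rw [IsMPal, cfVal_eq_div _ hpos hne, cfVal_eq_div _ (fun a ha => hpos a (List.mem_reverse.1 ha))
    (by simpa using hne), cfMat_reverse, Matrix.transpose_apply, Matrix.transpose_apply,
    cfMat_sandwich_symm hT0 hTk, Nat.cast_mul, Nat.cast_ofNat]
  field_simp

end sandwich

theorem ST_number_transcendental
    (T : ℕ → List ℕ) (hT0 : T 0 = [2, 1, 1, 3, 1])
    (hTk : ∀ k, T (k + 1) = T k ++ listPow [2, 1] (k + 1) ++ T k)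
    (t : ℕ → ℕ) (ht : ∀ k, (List.range (T k).length).map t = T k)
    (τ : ℝ)
    (hτ : Filter.Tendsto (fun i => cfVal (cfPrefix t i)) Filter.atTop (nhds τ)) :
    Transcendental ℚ τ ∧ {i : ℕ | IsMPal 2 (cfPrefix t i)}.Infinite := by
  have hmono := strictMono_length_sandwich hT0 hTk
  have hprefix : ∀ k, cfPrefix t ((T k).length - 1) = T k := fun k => by
    rw [cfPrefix, Nat.sub_add_cancel (length_sandwich_pos hT0 hTk k), ht]
  constructor
  · refine (isSandwichOrbit_cfMat hT0 hTk).transcendental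
      ((hτ.comp hmono.tendsto_atTop).congr fun k => ?_)
    rw [Function.comp_apply, hprefix, cfVal_eq_div _ (pos_of_mem_sandwich hT0 hTk k)
      (List.ne_nil_of_length_pos (length_sandwich_pos hT0 hTk k))]
  · refine (Set.infinite_range_of_injective hmono.injective).mono ?_
    rintro _ ⟨k, rfl⟩
    rw [Set.mem_ofPred_eq, hprefix]
    exact isMPal_sandwich hT0 hTk k
end

section
/- Let α be a quadratic irrational with continued fraction expansion α = [a_0, a_1, a_2, …]. Then α is equivalent to its algebraic conjugate if and only if the sequence (a_0, a_1, a_2, …) is eventually periodic with a period that is either a single 1-palindrome or the concatenation of two 1-palindromes. -/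
/-! ### Finite continued fractions -/

theorem cfVal_cons {l : List ℕ} (hl : l ≠ []) (a : ℕ) : cfVal (a :: l) = a + 1 / cfVal l := by
  cases l with
  | nil => exact absurd rfl hl
  | cons b r => simp [cfVal]

theorem one_le_cfVal {l : List ℕ} (hl : l ≠ []) (hpos : ∀ x ∈ l, 0 < x) : 1 ≤ cfVal l := by
  induction l with
  | nil => exact absurd rfl hl
  | cons a r ih =>
    have ha : (1 : ℝ) ≤ a := by exact_mod_cast hpos a (by simp)
    by_cases hr : r = []
    · subst hr; simpa [cfVal] using ha
    · rw [cfVal_cons hr]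
      have := ih hr (fun x hx => hpos x (by simp [hx]))
      have : 0 < 1 / cfVal r := by positivity
      linarith

/-- Two finite continued fractions of the same length with positive entries are equal as soon as
their values are. -/
theorem eq_of_cfVal_eq {l m : List ℕ} (hlen : l.length = m.length) (hl : ∀ x ∈ l, 0 < x)
    (hm : ∀ x ∈ m, 0 < x) (h : cfVal l = cfVal m) : l = m := by
  induction l generalizing m with
  | nil => exact (List.length_eq_zero_iff.1 hlen.symm).symm
  | cons a r ih =>
    cases m with
    | nil => simp at hlen
    | cons b t =>
      have hlen' : r.length = t.length := by simpa using hlen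
      by_cases hr : r = []
      · subst hr
        obtain rfl : t = [] := List.length_eq_zero_iff.1 hlen'.symm
        have : a = b := by simpa [cfVal] using h
        rw [this]
      · have ht : t ≠ [] := by
          rintro rfl
          exact hr (List.length_eq_zero_iff.1 hlen')
        have hl' : ∀ x ∈ r, 0 < x := fun x hx => hl x (by simp [hx])
        have hm' : ∀ x ∈ t, 0 < x := fun x hx => hm x (by simp [hx])
        rw [cfVal_cons hr, cfVal_cons ht] at h
        have h1 := one_le_cfVal hr hl'
        have h2 := one_le_cfVal ht hm'
        have h3 : 0 < 1 / cfVal r := by positivity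
        have h4 : 0 < 1 / cfVal t := by positivity
        have h5 : 1 / cfVal r ≤ 1 := by rw [div_le_one (by linarith)]; exact h1
        have h6 : 1 / cfVal t ≤ 1 := by rw [div_le_one (by linarith)]; exact h2
        have hab : a = b := by
          have h7 : (a : ℝ) < b + 1 := by linarith
          have h8 : (b : ℝ) < a + 1 := by linarith
          have h9 : a < b + 1 := by exact_mod_cast h7
          have h10 : b < a + 1 := by exact_mod_cast h8
          omega
        subst hab
        have h11 : 1 / cfVal r = 1 / cfVal t := by linarith
        rw [ih hlen' hl' hm' (by simpa using h11)]

theorem isMPal_one_iff {l : List ℕ} (hl : ∀ x ∈ l, 0 < x) : IsMPal 1 l ↔ l.reverse = l := by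
  constructor
  · intro h
    refine (eq_of_cfVal_eq (by simp) hl (by simpa using hl) ?_).symm
    simpa [IsMPal] using h
  · intro h
    simp [IsMPal, h]

theorem cfPrefix_succ (a : ℕ → ℕ) (i : ℕ) :
    cfPrefix a (i + 1) = a 0 :: cfPrefix (fun k => a (k + 1)) i := by
  simp only [cfPrefix]
  rw [List.range_succ_eq_map]
  simp [Function.comp_def]

theorem cfPrefix_ne_nil (a : ℕ → ℕ) (i : ℕ) : cfPrefix a i ≠ [] := by
  simp [cfPrefix]

theorem one_le_cfVal_cfPrefix {a : ℕ → ℕ} (ha : ∀ k, 0 < a k) (i : ℕ) :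
    1 ≤ cfVal (cfPrefix a i) := by
  refine one_le_cfVal (cfPrefix_ne_nil a i) ?_
  intro x hx
  simp only [cfPrefix, List.mem_map] at hx
  obtain ⟨k, -, rfl⟩ := hx
  exact ha k

/-! ### Complete quotients -/

theorem irrational_one_div_sub_nat {x : ℝ} (hx : Irrational x) (k : ℕ) :
    Irrational (1 / (x - k)) := by
  rw [one_div]
  exact (hx.sub_natCast k).inv

/-- The complete quotients of an infinite continued fraction. -/
theorem exists_complete_quotients {a : ℕ → ℕ} (ha : ∀ k, 0 < a k) {α : ℝ}
    (hα : Filter.Tendsto (fun i => cfVal (cfPrefix a i)) Filter.atTop (nhds α))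
    (hirr : Irrational α) :
    ∃ s : ℕ → ℝ, s 0 = α ∧ (∀ n, 1 < s n) ∧ (∀ n, Irrational (s n)) ∧
      ∀ n, s n = a n + 1 / s (n + 1) := by
  let s : ℕ → ℝ := fun n => Nat.rec α (fun k x => 1 / (x - a k)) n
  have hs : ∀ n, s (n + 1) = 1 / (s n - a n) := fun n => rfl
  have hI : ∀ n, Irrational (s n) := by
    intro n
    induction n with
    | zero => exact hirr
    | succ n ih => rw [hs]; exact irrational_one_div_sub_nat ih _
  have hT : ∀ n, Filter.Tendsto (fun i => cfVal (cfPrefix (fun k => a (k + n)) i))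
      Filter.atTop (nhds (s n)) := by
    intro n
    induction n with
    | zero => exact hα
    | succ n ih =>
      rw [hs]
      have h1 := (Filter.tendsto_add_atTop_iff_nat 1).2 ih
      have h2 : s n - a n ≠ 0 := sub_ne_zero.2 ((hI n).ne_nat _)
      have h3 := (h1.sub_const (a n : ℝ)).inv₀ h2
      rw [← one_div] at h3
      refine h3.congr fun i => ?_
      rw [cfPrefix_succ, cfVal_cons (cfPrefix_ne_nil _ _)]
      simp [add_assoc, add_comm 1 n]
  refine ⟨s, rfl, ?_, hI, ?_⟩
  · intro n
    have h1 : 1 ≤ s n := ge_of_tendsto' (hT n) fun i =>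
      one_le_cfVal_cfPrefix (fun k => ha (k + n)) i
    exact lt_of_le_of_ne h1 ((hI n).ne_one.symm)
  · intro n
    rw [hs]
    simp

/-- Two real numbers whose continued fraction expansions agree on a long initial segment
are close. -/
theorem abs_sub_le_half_pow (T : ℕ) {a : ℕ → ℕ} {x y : ℕ → ℝ} (ha : ∀ k, 0 < a k)
    (hx1 : ∀ n ≤ 2 * T + 1, 1 < x n) (hy1 : ∀ n ≤ 2 * T + 1, 1 < y n)
    (hx : ∀ n ≤ 2 * T, x n = a n + 1 / x (n + 1))
    (hy : ∀ n ≤ 2 * T, y n = a n + 1 / y (n + 1)) :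
    |x 0 - y 0| ≤ (1 / 2) ^ T := by
  induction T generalizing a x y with
  | zero =>
    have h1 := hx 0 (by simp)
    have h2 := hy 0 (by simp)
    have h3 := hx1 1 (by simp)
    have h4 := hy1 1 (by simp)
    have h5 : 0 < 1 / x 1 := by positivity
    have h6 : 0 < 1 / y 1 := by positivity
    have h7 : 1 / x 1 ≤ 1 := by rw [div_le_one (by linarith)]; exact h3.le
    have h8 : 1 / y 1 ≤ 1 := by rw [div_le_one (by linarith)]; exact h4.le
    simp only [zero_add] at h1 h2
    rw [h1, h2, abs_le]
    constructor <;> simp only [pow_zero] <;> linarith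
  | succ T ih =>
    have key := ih (a := fun n => a (n + 2)) (x := fun n => x (n + 2)) (y := fun n => y (n + 2))
      (fun k => ha _) (fun n hn => hx1 _ (by omega)) (fun n hn => hy1 _ (by omega))
      (fun n hn => hx _ (by omega)) (fun n hn => hy _ (by omega))
    simp only [zero_add] at key
    have p1 := hx1 1 (by omega)
    have p2 := hx1 2 (by omega)
    have r1 := hy1 1 (by omega)
    have r2 := hy1 2 (by omega)
    have e0 := hx 0 (by omega)
    have e1 := hx 1 (by omega)
    have f0 := hy 0 (by omega)
    have f1 := hy 1 (by omega)
    simp only [zero_add, Nat.reduceAdd] at e0 e1 f0 f1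
    have ha1 : (1 : ℝ) ≤ a 1 := by exact_mod_cast ha 1
    have hxx : x 1 * x 2 = a 1 * x 2 + 1 := by rw [e1]; field_simp
    have hyy : y 1 * y 2 = a 1 * y 2 + 1 := by rw [f1]; field_simp
    have hX : 2 ≤ x 1 * x 2 := by nlinarith
    have hY : 1 ≤ y 1 * y 2 := by nlinarith
    have hXY : 2 ≤ (x 1 * x 2) * (y 1 * y 2) := by nlinarith
    have hd : x 0 - y 0 = (x 2 - y 2) / ((x 1 * x 2) * (y 1 * y 2)) := by
      have g1 : x 0 - y 0 = (y 1 - x 1) / (x 1 * y 1) := by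
        rw [e0, f0]; field_simp; ring
      have g2 : y 1 - x 1 = (x 2 - y 2) / (x 2 * y 2) := by
        rw [e1, f1]; field_simp; ring
      rw [g1, g2]; field_simp
    rw [hd, abs_div, abs_of_pos (show 0 < (x 1 * x 2) * (y 1 * y 2) by linarith),
      div_le_iff₀ (by linarith), pow_succ]
    have hp : (0 : ℝ) ≤ (1 / 2) ^ T := by positivity
    nlinarith

theorem eq_of_forall_abs_sub_le_half_pow {x y : ℝ} (h : ∀ T : ℕ, |x - y| ≤ (1 / 2) ^ T) :
    x = y := by
  have h1 : Filter.Tendsto (fun T : ℕ => (1 / 2 : ℝ) ^ T) Filter.atTop (nhds 0) :=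
    tendsto_pow_atTop_nhds_zero_of_lt_one (by norm_num) (by norm_num)
  have h2 : |x - y| ≤ 0 := ge_of_tendsto' h1 h
  exact sub_eq_zero.1 (abs_nonpos_iff.1 h2)

/-! ### Equivalence of real numbers -/

theorem RealEquiv.refl (x : ℝ) : RealEquiv x x := ⟨0, 1, 1, 0, by simp⟩

theorem RealEquiv.trans {x y z : ℝ} (h₁ : RealEquiv x y) (h₂ : RealEquiv y z) :
    RealEquiv x z := by
  obtain ⟨a, b, c, d, hdet, hne, hx⟩ := h₁
  obtain ⟨a', b', c', d', hdet', hne', hy⟩ := h₂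
  have hden : ((c * c' + d * a' : ℤ) : ℝ) + ((c * d' + d * b' : ℤ) : ℝ) * z
      = ((c' : ℝ) + d' * z) * (c + d * y) := by
    rw [hy]; push_cast; field_simp; ring
  refine ⟨a * c' + b * a', a * d' + b * b', c * c' + d * a', c * d' + d * b', ?_, ?_, ?_⟩
  · have : (a * c' + b * a') * (c * d' + d * b') - (a * d' + b * b') * (c * c' + d * a')
        = -((a * d - b * c) * (a' * d' - b' * c')) := by ring
    rw [this]
    rcases hdet with h | h <;> rcases hdet' with h' | h' <;> simp [h, h']
  · rw [hden]
    exact mul_ne_zero hne' hne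
  · rw [hden, hx, div_eq_div_iff hne (mul_ne_zero hne' hne)]
    have : (y : ℝ) * (c' + d' * z) = a' + b' * z := by
      rw [hy, div_mul_cancel₀ _ hne']
    push_cast
    linear_combination (c + d * y) * b * this

theorem RealEquiv.symm {x y : ℝ} (h : RealEquiv x y) : RealEquiv y x := by
  obtain ⟨a, b, c, d, hdet, hne, hx⟩ := h
  have hx' : x * (c + d * y) = a + b * y := by rw [hx, div_mul_cancel₀ _ hne]
  have hdetR : ((a : ℝ) * d - b * c) ≠ 0 := by
    rcases hdet with h | h
    · have : ((a : ℝ) * d - b * c) = 1 := by exact_mod_cast h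
      rw [this]; norm_num
    · have : ((a : ℝ) * d - b * c) = -1 := by exact_mod_cast h
      rw [this]; norm_num
  have hne' : ((b : ℤ) : ℝ) + ((-d : ℤ) : ℝ) * x ≠ 0 := by
    intro h0
    push_cast at h0
    apply hdetR
    linear_combination -(c + d * y) * h0 - d * hx'
  refine ⟨-a, c, b, -d, ?_, hne', ?_⟩
  · have : -a * -d - c * b = a * d - b * c := by ring
    rwa [this]
  · rw [eq_div_iff hne']
    push_cast
    linear_combination -hx'

theorem realEquiv_nat_add_one_div (k : ℕ) {x y : ℝ} (hy : y ≠ 0) (h : x = k + 1 / y) :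
    RealEquiv x y := by
  refine ⟨1, k, 0, 1, by simp, by simpa using hy, ?_⟩
  have : ((0 : ℤ) : ℝ) + ((1 : ℤ) : ℝ) * y = y := by simp
  rw [this, h, eq_div_iff hy, add_mul, div_mul_cancel₀ _ hy]
  push_cast
  ring

theorem realEquiv_neg_one_div {y : ℝ} (hy : y ≠ 0) : RealEquiv (-1 / y) y :=
  ⟨-1, 0, 0, 1, by simp, by simpa using hy, by simp⟩

/-! ### The Gauss map and tail equivalence -/

/-- The shift on (infinite) continued fractions: `x ↦ 1 / {x}`. -/
noncomputable def cfShift (x : ℝ) : ℝ := (Int.fract x)⁻¹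

theorem cfShift_add_int (x : ℝ) (k : ℤ) : cfShift (x + k) = cfShift x := by
  simp [cfShift]

theorem cfShift_nat_add_one_div (k : ℕ) {y : ℝ} (hy : 1 < y) : cfShift (k + 1 / y) = y := by
  have : Int.fract (1 / y) = 1 / y :=
    Int.fract_eq_self.2 ⟨by positivity, by rw [div_lt_one (by linarith)]; exact hy⟩
  rw [cfShift, Int.fract_natCast_add, this, one_div, inv_inv]

theorem nat_eq_of_add_one_div_eq {k l : ℕ} {x y : ℝ} (hx : 1 < x) (hy : 1 < y)
    (h : (k : ℝ) + 1 / x = l + 1 / y) : k = l := by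
  have h3 : 0 < 1 / x := by positivity
  have h4 : 0 < 1 / y := by positivity
  have h5 : 1 / x ≤ 1 := by rw [div_le_one (by linarith)]; exact hx.le
  have h6 : 1 / y ≤ 1 := by rw [div_le_one (by linarith)]; exact hy.le
  have h7 : (k : ℝ) < l + 1 := by linarith
  have h8 : (l : ℝ) < k + 1 := by linarith
  have h9 : k < l + 1 := by exact_mod_cast h7
  have h10 : l < k + 1 := by exact_mod_cast h8
  omega

/-- Two real numbers are tail equivalent if their continued fraction expansions
eventually agree. -/
def TailEquiv (x y : ℝ) : Prop := ∃ i j : ℕ, cfShift^[i] x = cfShift^[j] y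

theorem TailEquiv.symm {x y : ℝ} (h : TailEquiv x y) : TailEquiv y x := by
  obtain ⟨i, j, h⟩ := h
  exact ⟨j, i, h.symm⟩

theorem TailEquiv.trans {x y z : ℝ} (h₁ : TailEquiv x y) (h₂ : TailEquiv y z) :
    TailEquiv x z := by
  obtain ⟨i, j, h₁⟩ := h₁
  obtain ⟨k, l, h₂⟩ := h₂
  refine ⟨k + i, j + l, ?_⟩
  rw [Function.iterate_add_apply, h₁, ← Function.iterate_add_apply, add_comm k j,
    Function.iterate_add_apply, h₂, ← Function.iterate_add_apply]

theorem tailEquiv_of_cfShift_eq {x y : ℝ} (h : cfShift x = cfShift y) : TailEquiv x y :=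
  ⟨1, 1, h⟩

theorem tailEquiv_cfShift (x : ℝ) : TailEquiv x (cfShift x) := ⟨1, 0, rfl⟩

theorem tailEquiv_add_int (x : ℝ) (k : ℤ) : TailEquiv (x + k) x :=
  tailEquiv_of_cfShift_eq (cfShift_add_int x k)

theorem tailEquiv_neg {x : ℝ} (hx : Irrational x) : TailEquiv x (-x) := by
  have key : ∀ f : ℝ, 0 < f → f < 1 / 2 → TailEquiv f⁻¹ (1 - f)⁻¹ := by
    intro f h0 h1
    have h2 : 0 < 1 - f := by linarith
    have h3 : cfShift (1 - f)⁻¹ = f⁻¹ + ((-1 : ℤ) : ℝ) := by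
      have e : (1 - f)⁻¹ = ((1 : ℕ) : ℝ) + 1 / (f⁻¹ + ((-1 : ℤ) : ℝ)) := by
        have : f⁻¹ + ((-1 : ℤ) : ℝ) = (1 - f) / f := by push_cast; field_simp; ring
        rw [this]; push_cast; field_simp; ring
      rw [e]
      apply cfShift_nat_add_one_div
      have : 2 < f⁻¹ := by rw [lt_inv_comm₀ (by norm_num) h0]; linarith
      push_cast; linarith
    have h4 := (tailEquiv_cfShift (1 - f)⁻¹)
    rw [h3] at h4
    exact (h4.trans (tailEquiv_add_int _ _)).symm
  have hf : Irrational (Int.fract x) := by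
    rw [← Int.self_sub_floor]; exact hx.sub_intCast _
  have hf0 : 0 < Int.fract x := lt_of_le_of_ne (Int.fract_nonneg x) hf.ne_zero.symm
  have hf1 : Int.fract x < 1 := Int.fract_lt_one x
  have hneg : Int.fract (-x) = 1 - Int.fract x := Int.fract_neg hf0.ne'
  refine (tailEquiv_cfShift x).trans (TailEquiv.trans ?_ (tailEquiv_cfShift (-x)).symm)
  rw [cfShift, cfShift, hneg]
  rcases lt_or_gt_of_ne (show Int.fract x ≠ 1 / 2 from fun h => by
    apply hf.ne_rat (1 / 2); rw [h]; push_cast; rfl) with h | h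
  · exact key _ hf0 h
  · have := key (1 - Int.fract x) (by linarith) (by linarith)
    rw [sub_sub_cancel] at this
    exact this.symm

theorem tailEquiv_inv {x : ℝ} (hx : Irrational x) : TailEquiv x x⁻¹ := by
  have h1 : ∀ y : ℝ, 1 < y → TailEquiv y y⁻¹ := by
    intro y hy
    have h := tailEquiv_cfShift y⁻¹
    have e : y⁻¹ = ((0 : ℕ) : ℝ) + 1 / y := by simp
    rw [e, cfShift_nat_add_one_div 0 hy, ← e] at h
    exact h.symm
  have h2 : ∀ y : ℝ, Irrational y → 0 < y → TailEquiv y y⁻¹ := by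
    intro y hy h0
    rcases lt_or_gt_of_ne hy.ne_one with h | h
    · have := h1 y⁻¹ ((one_lt_inv₀ h0).2 h)
      rw [inv_inv] at this
      exact this.symm
    · exact h1 y h
  rcases lt_or_gt_of_ne hx.ne_zero with h | h
  · have h3 := h2 (-x) hx.neg (by linarith)
    have h4 := tailEquiv_neg hx.inv
    rw [inv_neg] at h3
    exact ((tailEquiv_neg hx).trans h3).trans h4.symm
  · exact h2 x hx h

/-- Serret's theorem: equivalent irrational numbers have continued fraction expansions that
eventually agree. -/
theorem RealEquiv.tailEquiv {x y : ℝ} (hx : Irrational x) (h : RealEquiv x y) :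
    TailEquiv x y := by
  obtain ⟨a, b, c, d, hdet, hne, hxy⟩ := h
  induction hn : d.natAbs using Nat.strong_induction_on generalizing a b c d x with
  | _ n ih =>
    by_cases hd : d = 0
    · subst hd
      have hbc : b * c = 1 ∨ b * c = -1 := by
        rcases hdet with h | h
        · right; linarith
        · left; linarith
      have hc : c * c = 1 := by
        have : IsUnit c := by
          rcases hbc with h | h
          · exact IsUnit.of_mul_eq_one b (by linarith)
          · exact IsUnit.of_mul_eq_one (-b) (by linarith)
        exact Int.isUnit_mul_self this
      have hcR : (c : ℝ) * c = 1 := by exact_mod_cast hc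
      have hc0 : (c : ℝ) ≠ 0 := by rintro h; simp [h] at hcR
      have hx' : x = (b * c : ℤ) * y + (a * c : ℤ) := by
        rw [hxy, div_eq_iff (by simpa using hc0)]
        push_cast
        linear_combination -(a + b * y) * hcR
      rcases hbc with h | h
      · rw [h] at hx'
        rw [hx', Int.cast_one, one_mul]
        exact tailEquiv_add_int _ _
      · rw [h] at hx'
        have hy : Irrational y := by
          have e : y = -x + (a * c : ℤ) := by rw [hx']; push_cast; ring
          rw [e]; exact hx.neg.add_intCast _
        rw [hx', Int.cast_neg, Int.cast_one, neg_one_mul]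
        exact (tailEquiv_add_int _ _).trans (tailEquiv_neg hy).symm
    · set k := b / d with hk
      have hr : b = k * d + b % d := by rw [hk, mul_comm]; exact (Int.mul_ediv_add_emod b d).symm
      have hrR : (b : ℝ) = k * d + (b % d : ℤ) := by exact_mod_cast hr
      have hxk : Irrational (x - k) := hx.sub_intCast k
      have e : x - k = (((a - k * c : ℤ) : ℝ) + (b % d : ℤ) * y) / (c + d * y) := by
        rw [hxy, eq_div_iff hne, sub_mul, div_mul_cancel₀ _ hne]
        push_cast
        linear_combination y * hrR
      have hne' : ((a - k * c : ℤ) : ℝ) + (b % d : ℤ) * y ≠ 0 := by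
        intro h0
        rw [h0, zero_div] at e
        exact hxk.ne_zero e
      have h1 : TailEquiv (x - k)⁻¹ y := by
        refine ih (b % d).natAbs ?_ hxk.inv c d (a - k * c) (b % d) ?_ hne' ?_ rfl
        · have h1 := Int.emod_nonneg b hd
          have h2 := Int.emod_lt_abs b hd
          rw [Int.abs_eq_natAbs] at h2
          rw [← hn]; omega
        · have : c * (b % d) - d * (a - k * c) = -(a * d - b * c) := by
            linear_combination (-c) * hr
          rw [this]
          rcases hdet with h | h <;> simp [h]
        · rw [e, inv_div]
      have h2 := tailEquiv_add_int (x - k) k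
      rw [sub_add_cancel] at h2
      exact (h2.trans (tailEquiv_inv hxk)).trans h1

/-! ### Conjugates of complete quotients -/

/-- Bounds for the coefficients of an integer quadratic polynomial with real roots of opposite
signs in terms of its discriminant. -/
theorem coeff_mem_Icc_of_neg {A B C D : ℤ} (h : A * C < 0) (hD : B ^ 2 - 4 * A * C = D) :
    A ∈ Set.Icc (-D) D ∧ B ∈ Set.Icc (-D) D ∧ C ∈ Set.Icc (-D) D := by
  have hA : A ≠ 0 := by rintro rfl; simp at h
  have hC : C ≠ 0 := by rintro rfl; simp at h
  have h1 : |A| * |C| = -(A * C) := by rw [← abs_mul, abs_of_neg h]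
  have h2 : 1 ≤ |A| := Int.one_le_abs hA
  have h3 : 1 ≤ |C| := Int.one_le_abs hC
  have h4 : |B| ≤ |B| ^ 2 := by
    rcases eq_or_ne B 0 with rfl | hB
    · simp
    · have := Int.one_le_abs hB; nlinarith
  have h5 : |B| ^ 2 = B ^ 2 := sq_abs B
  have h6 := abs_nonneg B
  refine ⟨abs_le.1 ?_, abs_le.1 ?_, abs_le.1 ?_⟩ <;> nlinarith

/-- The conjugate complete quotients satisfy integer quadratic equations of constant
discriminant. -/
theorem exists_quadratic_complete_quotients {a : ℕ → ℕ} {s s' : ℕ → ℝ}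
    (hI : ∀ n, Irrational (s n)) (hI' : ∀ n, Irrational (s' n))
    (hs : ∀ n, s (n + 1) = 1 / (s n - a n)) (hs' : ∀ n, s' (n + 1) = 1 / (s' n - a n))
    {A B C : ℤ} (hA : A ≠ 0) (hsum : (A : ℝ) * (s 0 + s' 0) = -B)
    (hprod : (A : ℝ) * (s 0 * s' 0) = C) (n : ℕ) :
    ∃ A' B' C' : ℤ, A' ≠ 0 ∧ (A' : ℝ) * (s n + s' n) = -B' ∧ (A' : ℝ) * (s n * s' n) = C' ∧
      B' ^ 2 - 4 * A' * C' = B ^ 2 - 4 * A * C := by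
  induction n with
  | zero => exact ⟨A, B, C, hA, hsum, hprod, rfl⟩
  | succ n ih =>
    obtain ⟨A', B', C', h0, h1, h2, h3⟩ := ih
    have e1 : s n - a n ≠ 0 := sub_ne_zero.2 ((hI n).ne_nat _)
    have e2 : s' n - a n ≠ 0 := sub_ne_zero.2 ((hI' n).ne_nat _)
    have e3 : ((A' * (a n) ^ 2 + B' * a n + C' : ℤ) : ℝ)
        = A' * ((s n - a n) * (s' n - a n)) := by
      push_cast; linear_combination -h2 + a n * h1
    refine ⟨A' * (a n) ^ 2 + B' * a n + C', 2 * A' * a n + B', A', ?_, ?_, ?_, ?_⟩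
    · have : ((A' * (a n) ^ 2 + B' * a n + C' : ℤ) : ℝ) ≠ 0 := by
        rw [e3]
        exact mul_ne_zero (by exact_mod_cast h0) (mul_ne_zero e1 e2)
      exact_mod_cast this
    · rw [e3, hs, hs']
      have : (A' : ℝ) * ((s n - a n) * (s' n - a n)) * (1 / (s n - a n) + 1 / (s' n - a n))
          = A' * ((s n - a n) + (s' n - a n)) := by field_simp; ring
      rw [this]; push_cast; linear_combination h1
    · rw [e3, hs, hs']; field_simp
    · rw [← h3]; ring

/-- The conjugates of the complete quotients are eventually negative. -/
theorem exists_conjugate_neg {a : ℕ → ℕ} (ha : ∀ k, 0 < a k) {s s' : ℕ → ℝ}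
    (h1 : ∀ n, 1 < s n) (hI' : ∀ n, Irrational (s' n))
    (hs : ∀ n, s n = a n + 1 / s (n + 1)) (hs' : ∀ n, s' n = a n + 1 / s' (n + 1))
    (hne : s' 0 ≠ s 0) : ∃ n, s' n < 0 := by
  by_contra! hcon
  have hpos : ∀ n, 0 < s' n := fun n => lt_of_le_of_ne (hcon n) (hI' n).ne_zero.symm
  have h1' : ∀ n, 1 < s' n := by
    intro n
    have e := hs' n
    have p : 0 < 1 / s' (n + 1) := by have := hpos (n + 1); positivity
    have q : (1 : ℝ) ≤ a n := by exact_mod_cast ha n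
    linarith
  exact hne (eq_of_forall_abs_sub_le_half_pow fun T => abs_sub_le_half_pow T ha
    (fun n _ => h1' n) (fun n _ => h1 n) (fun n _ => hs' n) (fun n _ => hs n))

/-- The theorems of Lagrange and Galois: the complete quotients `s n` of a quadratic irrational
and the negative inverses `g n` of their conjugates are eventually periodic, and `g` is
obtained by running the continued fraction expansion backwards. -/
theorem exists_periodic_quotients {a : ℕ → ℕ} (ha : ∀ k, 0 < a k) {α α' : ℝ}
    (hα : Filter.Tendsto (fun i => cfVal (cfPrefix a i)) Filter.atTop (nhds α))
    (hirr : Irrational α) {A B C : ℤ} (hA : A ≠ 0)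
    (hroot : (A : ℝ) * α ^ 2 + (B : ℝ) * α + (C : ℝ) = 0) (hne : α' ≠ α)
    (hroot' : (A : ℝ) * α' ^ 2 + (B : ℝ) * α' + (C : ℝ) = 0) :
    ∃ (s g : ℕ → ℝ) (N P : ℕ), s 0 = α ∧ (∀ n, 1 < s n) ∧
      (∀ n, s n = a n + 1 / s (n + 1)) ∧ 0 < P ∧
      (∀ n ≥ N, 1 < g n ∧ g (n + 1) = a n + 1 / g n ∧ s (n + P) = s n ∧ g (n + P) = g n ∧
        RealEquiv α' (g n)) := by
  obtain ⟨s, hs0, hs1, hI, hs⟩ := exists_complete_quotients ha hα hirr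
  have hsucc : ∀ n, s (n + 1) = 1 / (s n - a n) := fun n => by
    rw [hs n]; simp
  have hAR : (A : ℝ) ≠ 0 := by exact_mod_cast hA
  have hsum : (A : ℝ) * (α + α') = -B := by
    have : (α' - α) * ((A : ℝ) * (α + α') + B) = 0 := by linear_combination hroot' - hroot
    rcases mul_eq_zero.1 this with h | h
    · exact absurd (sub_eq_zero.1 h) hne
    · linarith
  have hprod : (A : ℝ) * (α * α') = C := by linear_combination α * hsum - hroot
  have hirr' : Irrational α' := by
    have e : α' = ((-B / A : ℚ) : ℝ) - α := by
      push_cast; field_simp; linear_combination hsum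
    rw [e]; exact hirr.ratCast_sub _
  let s' : ℕ → ℝ := fun n => Nat.rec α' (fun k x => 1 / (x - a k)) n
  have hsucc' : ∀ n, s' (n + 1) = 1 / (s' n - a n) := fun n => rfl
  have hI' : ∀ n, Irrational (s' n) := by
    intro n
    induction n with
    | zero => exact hirr'
    | succ n ih => rw [hsucc']; exact irrational_one_div_sub_nat ih _
  have hs' : ∀ n, s' n = a n + 1 / s' (n + 1) := fun n => by rw [hsucc']; simp
  obtain ⟨M, hM⟩ := exists_conjugate_neg ha hs1 hI' hs hs' (by rw [hs0]; exact hne)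
  have hstep : ∀ n, s' n < 0 → -1 < s' (n + 1) ∧ s' (n + 1) < 0 := by
    intro n hn
    have q : (1 : ℝ) ≤ a n := by exact_mod_cast ha n
    have hlt : s' n - a n < -1 := by linarith
    rw [hsucc']
    constructor
    · rw [lt_div_iff_of_neg (by linarith)]; linarith
    · exact div_neg_of_pos_of_neg one_pos (by linarith)
  have hneg : ∀ n ≥ M, s' n < 0 := by
    intro n hn
    induction n, hn using Nat.le_induction with
    | base => exact hM
    | succ n _ ih => exact (hstep n ih).2
  have hred : ∀ n ≥ M + 1, -1 < s' n ∧ s' n < 0 := by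
    intro n hn
    obtain ⟨k, rfl⟩ : ∃ k, n = k + 1 := ⟨n - 1, by omega⟩
    exact hstep k (hneg k (by omega))
  choose A' B' C' hA' hsum' hprod' hD using
    exists_quadratic_complete_quotients hI hI' hsucc hsucc' hA (by rw [hs0]; exact hsum)
      (by rw [hs0]; exact hprod)
  set D := B ^ 2 - 4 * A * C
  let F : ℕ → Set.Icc (-D) D × Set.Icc (-D) D × Set.Icc (-D) D := fun k =>
    have h : A' (M + 1 + k) * C' (M + 1 + k) < 0 := by
      have h1 : ((A' (M + 1 + k) * C' (M + 1 + k) : ℤ) : ℝ) < 0 := by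
        push_cast
        rw [← hprod']
        have p1 : (0 : ℝ) < A' (M + 1 + k) ^ 2 := by
          have : (A' (M + 1 + k) : ℝ) ≠ 0 := by exact_mod_cast hA' _
          positivity
        have p2 : s (M + 1 + k) * s' (M + 1 + k) < 0 :=
          mul_neg_of_pos_of_neg (by linarith [hs1 (M + 1 + k)]) (hneg _ (by omega))
        nlinarith
      exact_mod_cast h1
    have h' := coeff_mem_Icc_of_neg h (hD _)
    (⟨_, h'.1⟩, ⟨_, h'.2.1⟩, ⟨_, h'.2.2⟩)
  obtain ⟨k, l, hkl, hF⟩ : ∃ k l, k < l ∧ F k = F l := by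
    obtain ⟨k, l, hkl, hF⟩ := Finite.exists_ne_map_eq_of_infinite F
    rcases lt_or_gt_of_ne hkl with h | h
    · exact ⟨k, l, h, hF⟩
    · exact ⟨l, k, h, hF.symm⟩
  simp only [F, Prod.mk.injEq, Subtype.mk.injEq] at hF
  obtain ⟨hFA, hFB, hFC⟩ := hF
  set N := M + 1 + k with hN
  set P := l - k with hP
  have hNP : M + 1 + l = N + P := by omega
  rw [hNP] at hFA hFB hFC
  have hAN : (A' N : ℝ) ≠ 0 := by exact_mod_cast hA' N
  have eS : s (N + P) + s' (N + P) = s N + s' N := by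
    apply mul_left_cancel₀ hAN
    rw [hsum' N, hFB, hFA, hsum']
  have eM : s (N + P) * s' (N + P) = s N * s' N := by
    apply mul_left_cancel₀ hAN
    rw [hprod' N, hFC, hFA, hprod']
  have es : s (N + P) = s N := by
    have h0 : (s (N + P) - s N) * (s (N + P) - s' N) = 0 := by
      linear_combination s (N + P) * eS - eM
    rcases mul_eq_zero.1 h0 with h | h
    · linarith
    · have := hs1 (N + P)
      have := hneg N (by omega)
      linarith
  have es' : s' (N + P) = s' N := by linarith
  have hper : ∀ n ≥ N, s (n + P) = s n ∧ s' (n + P) = s' n := by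
    intro n hn
    induction n, hn using Nat.le_induction with
    | base => exact ⟨es, es'⟩
    | succ n _ ih =>
      have han : a (n + P) = a n :=
        nat_eq_of_add_one_div_eq (hs1 _) (hs1 _) ((hs (n + P)).symm.trans (ih.1.trans (hs n)))
      rw [show n + 1 + P = n + P + 1 by ring, hsucc, hsucc, hsucc', hsucc', ih.1, ih.2, han]
      exact ⟨rfl, rfl⟩
  have hequiv : ∀ n, RealEquiv α' (s' n) := by
    intro n
    induction n with
    | zero => exact RealEquiv.refl _
    | succ n ih => exact ih.trans (realEquiv_nat_add_one_div (a n) (hI' (n + 1)).ne_zero (hs' n))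
  refine ⟨s, fun n => -1 / s' n, N, P, hs0, hs1, hs, by omega, fun n hn => ?_⟩
  obtain ⟨r1, r2⟩ := hred n (by omega)
  refine ⟨?_, ?_, (hper n hn).1, ?_, ?_⟩
  · show 1 < -1 / s' n
    rw [lt_div_iff_of_neg r2]; linarith
  · show -1 / s' (n + 1) = a n + 1 / (-1 / s' n)
    have e2 : s' n - a n ≠ 0 := sub_ne_zero.2 ((hI' n).ne_nat _)
    have e3 : s' n ≠ 0 := (hI' n).ne_zero
    rw [hsucc']; field_simp; ring
  · show -1 / s' (n + P) = -1 / s' n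
    rw [(hper n hn).2]
  · exact (hequiv n).trans (realEquiv_neg_one_div (hI' n).ne_zero).symm

/-! ### Periods made of palindromes -/

theorem reverse_map_range_eq {f : ℕ → ℕ} {n : ℕ} (h : ∀ t < n, f (n - 1 - t) = f t) :
    ((List.range n).map f).reverse = (List.range n).map f := by
  apply List.ext_getElem
  · simp
  · intro t h1 h2
    simp only [List.length_map, List.length_range] at h2
    simp [List.getElem_reverse, h t h2]

/-- A periodic sequence with a reflection symmetry has a period which is a palindrome or the
concatenation of two palindromes. -/
theorem exists_palindromic_period {b : ℕ → ℕ} (hb : ∀ k, 0 < b k) {P c : ℕ} (hc : c < P)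
    (hper : ∀ t, b (t + P) = b t) (h₁ : ∀ t ≤ c, b (c - t) = b t)
    (h₂ : ∀ t < P, c < t → b (c + P - t) = b t) :
    ∃ W : List ℕ, W ≠ [] ∧ (∀ k, b k = W.getD (k % W.length) 0) ∧
      (IsMPal 1 W ∨
        ∃ W₁ W₂, W₁ ≠ [] ∧ W₂ ≠ [] ∧ W = W₁ ++ W₂ ∧ IsMPal 1 W₁ ∧ IsMPal 1 W₂) := by
  have hpos : ∀ (f : ℕ → ℕ) (n : ℕ), (∀ t, 0 < f t) → ∀ x ∈ (List.range n).map f, 0 < x := by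
    intro f n hf x hx
    obtain ⟨k, -, rfl⟩ := List.mem_map.1 hx
    exact hf k
  have r₁ : IsMPal 1 ((List.range (c + 1)).map b) :=
    (isMPal_one_iff (hpos _ _ hb)).2 (reverse_map_range_eq fun t ht => by
      rw [show c + 1 - 1 - t = c - t by omega]; exact h₁ t (by omega))
  refine ⟨(List.range P).map b, by simp; omega, ?_, ?_⟩
  · intro k
    have hk : k % P < P := Nat.mod_lt _ (by omega)
    have : b k = b (k % P) := ((show Function.Periodic b P from hper).map_mod_nat k).symm
    simp [List.getD_eq_getElem?_getD, hk, this]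
  · by_cases hcP : c + 1 = P
    · left
      rwa [hcP] at r₁
    · right
      refine ⟨(List.range (c + 1)).map b, (List.range (P - c - 1)).map (fun t => b (c + 1 + t)),
        by simp, by simp; omega, ?_, r₁, ?_⟩
      · conv_lhs => rw [show P = (c + 1) + (P - c - 1) by omega, List.range_add]
        simp [Function.comp_def]
      · refine (isMPal_one_iff (hpos _ _ fun t => hb _)).2 (reverse_map_range_eq fun t ht => ?_)
        have := h₂ (c + 1 + t) (by omega) (by omega)
        rw [← this]
        congr 1
        omega

/-- A sequence whose period is `W₁ ++ W₂` with palindromes `W₁` and `W₂` has reflection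
symmetries. -/
theorem getD_reflect {W₁ W₂ : List ℕ} (h₁ : W₁.reverse = W₁) (h₂ : W₂.reverse = W₂)
    {c p : ℕ} (hc : W₁.length = c + 1) (hp : (W₁ ++ W₂).length = p) {k t : ℕ}
    (ht : t ≤ c + p * k) :
    (W₁ ++ W₂).getD ((c + p * k - t) % p) 0 = (W₁ ++ W₂).getD (t % p) 0 := by
  have hp' : p = c + 1 + W₂.length := by rw [← hp, List.length_append, hc]
  have hp0 : 0 < p := by omega
  have hr : t % p < p := Nat.mod_lt _ hp0
  have hdiv := Nat.mod_add_div t p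
  set r := t % p
  set q := t / p
  have getRev : ∀ (l : List ℕ) (i : ℕ), l.reverse = l → i < l.length →
      l[l.length - 1 - i]? = l[i]? := by
    intro l i hl hi
    conv_rhs => rw [← hl]
    rw [List.getElem?_reverse hi]
  simp only [List.getD_eq_getElem?_getD]
  by_cases hrc : r ≤ c
  · have hq : q ≤ k := by
      by_contra! hlt
      have : p * (k + 1) ≤ p * q := Nat.mul_le_mul_left _ hlt
      rw [mul_add] at this
      omega
    obtain ⟨j, rfl⟩ := Nat.exists_eq_add_of_le hq
    have e : c + p * (q + j) - t = (c - r) + p * j := by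
      rw [mul_add]; omega
    rw [e, Nat.add_mul_mod_self_left, Nat.mod_eq_of_lt (by omega),
      List.getElem?_append_left (by omega), List.getElem?_append_left (by omega),
      ← getRev W₁ r h₁ (by omega), hc]
    simp
  · have hq : q + 1 ≤ k := by
      by_contra! hlt
      have : p * k ≤ p * q := Nat.mul_le_mul_left _ (by omega)
      omega
    obtain ⟨j, rfl⟩ := Nat.exists_eq_add_of_le hq
    have e : c + p * (q + 1 + j) - t = (c + p - r) + p * j := by
      rw [mul_add, mul_add]; omega
    rw [e, Nat.add_mul_mod_self_left, Nat.mod_eq_of_lt (by omega),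
      List.getElem?_append_right (by omega), List.getElem?_append_right (by omega),
      ← getRev W₂ (r - W₁.length) h₂ (by omega)]
    congr 2
    omega

/-- A palindromic period, or one made of two palindromes, gives a reflection symmetry. -/
theorem exists_reflection_of_period {b : ℕ → ℕ} (hb : ∀ k, 0 < b k) {W : List ℕ} (hW : W ≠ [])
    (hper : ∀ k, b k = W.getD (k % W.length) 0)
    (hpal : IsMPal 1 W ∨
      ∃ W₁ W₂, W₁ ≠ [] ∧ W₂ ≠ [] ∧ W = W₁ ++ W₂ ∧ IsMPal 1 W₁ ∧ IsMPal 1 W₂) :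
    ∃ c : ℕ, ∀ k t, t ≤ c + W.length * k → b (c + W.length * k - t) = b t := by
  have hpos : ∀ x ∈ W, 0 < x := by
    intro x hx
    obtain ⟨i, hi, rfl⟩ := List.mem_iff_getElem.1 hx
    have := hb i
    rw [hper, Nat.mod_eq_of_lt hi] at this
    simpa [List.getD_eq_getElem?_getD, hi] using this
  obtain ⟨W₁, W₂, hne, rfl, h₁, h₂⟩ : ∃ W₁ W₂, W₁ ≠ [] ∧ W = W₁ ++ W₂ ∧ W₁.reverse = W₁ ∧
      W₂.reverse = W₂ := by
    rcases hpal with h | ⟨W₁, W₂, hne, -, rfl, h₁, h₂⟩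
    · exact ⟨W, [], hW, by simp, (isMPal_one_iff hpos).1 h, rfl⟩
    · exact ⟨W₁, W₂, hne, rfl, (isMPal_one_iff fun x hx => hpos x (by simp [hx])).1 h₁,
        (isMPal_one_iff fun x hx => hpos x (by simp [hx])).1 h₂⟩
  have hlen := List.length_pos_iff.2 hne
  refine ⟨W₁.length - 1, fun k t ht => ?_⟩
  rw [hper, hper t]
  exact getD_reflect h₁ h₂ (by omega) rfl ht

/-- If the continued fraction expansions `s` and, run backwards, `g` share a tail, then the
sequence of partial quotients has a period made of palindromes. -/
theorem exists_palindromic_period_of_eq {a : ℕ → ℕ} (ha : ∀ k, 0 < a k) {s g : ℕ → ℝ} {N P : ℕ}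
    (hs1 : ∀ n, 1 < s n) (hs : ∀ n, s n = a n + 1 / s (n + 1)) (hP : 0 < P)
    (hg : ∀ n ≥ N, 1 < g n ∧ g (n + 1) = a n + 1 / g n ∧ s (n + P) = s n ∧ g (n + P) = g n)
    {i l : ℕ} (hl : N ≤ l) (hil : s i = g l) :
    ∃ (N : ℕ) (W : List ℕ), W ≠ [] ∧
      (∀ k, a (N + k) = W.getD (k % W.length) 0) ∧
      (IsMPal 1 W ∨
        ∃ W₁ W₂, W₁ ≠ [] ∧ W₂ ≠ [] ∧ W = W₁ ++ W₂ ∧ IsMPal 1 W₁ ∧ IsMPal 1 W₂) := by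
  have haper : ∀ n ≥ N, a (n + P) = a n := fun n hn =>
    nat_eq_of_add_one_div_eq (hs1 _) (hs1 _)
      ((hs (n + P)).symm.trans ((hg n hn).2.2.1.trans (hs n)))
  have haper' : ∀ k, ∀ n ≥ N, a (n + P * k) = a n := by
    intro k n hn
    induction k with
    | zero => rfl
    | succ k ih => rw [mul_add, mul_one, ← add_assoc, haper _ (by omega), ih]
  have hgper : ∀ k, ∀ n ≥ N, g (n + P * k) = g n := by
    intro k n hn
    induction k with
    | zero => rfl
    | succ k ih => rw [mul_add, mul_one, ← add_assoc, (hg _ (by omega)).2.2.2, ih]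
  have hrefl : ∀ L, N ≤ L → s i = g L → ∀ t, N + t ≤ L → s (i + t) = g (L - t) := by
    intro L hL hiL t
    induction t with
    | zero => intro _; simpa using hiL
    | succ t ih =>
      intro ht
      have e := ih (by omega)
      obtain ⟨m, hm⟩ : ∃ m, L - t = m + 1 := ⟨L - t - 1, by omega⟩
      obtain ⟨g1, g2, -, -⟩ := hg m (by omega)
      rw [hm, g2, hs] at e
      have hd := nat_eq_of_add_one_div_eq (hs1 _) g1 e
      rw [hd] at e
      rw [show L - (t + 1) = m by omega]
      have e' : 1 / s (i + t + 1) = 1 / g m := by linarith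
      simpa [add_assoc] using e'
  have hdig : ∀ L, N ≤ L → s i = g L → ∀ t, N + t + 1 ≤ L → a (i + t) = a (L - 1 - t) := by
    intro L hL hiL t ht
    have e := hrefl L hL hiL t (by omega)
    obtain ⟨m, hm⟩ : ∃ m, L - t = m + 1 := ⟨L - t - 1, by omega⟩
    obtain ⟨g1, g2, -, -⟩ := hg m (by omega)
    rw [hm, g2, hs] at e
    rw [show L - 1 - t = m by omega]
    exact nat_eq_of_add_one_div_eq (hs1 _) g1 e
  set j := i + N with hj
  have hPK : ∀ K, K ≤ P * K := fun K => Nat.le_mul_of_pos_left K hP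
  set L := l + P * (j + N + P + N + 1) with hLdef
  have hL := hPK (j + N + P + N + 1)
  have hiL : s i = g L := by rw [hLdef, hgper _ _ hl, hil]
  have hdig' : ∀ t, t ≤ P → a (j + t) = a (L - 1 - N - t) := by
    intro t ht
    have := hdig L (by omega) hiL (N + t) (by omega)
    rw [← add_assoc, ← hj] at this
    rw [this]; congr 1; omega
  have hmod := Nat.mod_add_div (L - 1 - N - j) P
  set c := (L - 1 - N - j) % P with hc
  have hcP : c < P := Nat.mod_lt _ hP
  obtain ⟨k, hk⟩ : ∃ k, (L - 1 - N - j) / P = k + 1 :=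
    Nat.exists_eq_succ_of_ne_zero (Nat.div_pos (by omega) hP).ne'
  rw [hk, mul_add, mul_one] at hmod
  refine ⟨j, exists_palindromic_period (b := fun t => a (j + t)) (fun t => ha _) hcP ?_ ?_ ?_⟩
  · intro t
    rw [← add_assoc]
    exact haper _ (by omega)
  · intro t ht
    rw [hdig' t (by omega), show L - 1 - N - t = j + (c - t) + P * (k + 1) by
      rw [mul_add]; omega, haper' _ _ (by omega)]
  · intro t ht hct
    rw [hdig' t (by omega), show L - 1 - N - t = j + (c + P - t) + P * k by omega,
      haper' _ _ (by omega)]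

/-- If the partial quotients have a period made of palindromes, then the expansions `s` and,
run backwards, `g` meet. -/
theorem exists_eq_of_reflection {a : ℕ → ℕ} (ha : ∀ k, 0 < a k) {s g : ℕ → ℝ} {N P : ℕ}
    (hs1 : ∀ n, 1 < s n) (hs : ∀ n, s n = a n + 1 / s (n + 1)) (hP : 0 < P)
    (hg : ∀ n ≥ N, 1 < g n ∧ g (n + 1) = a n + 1 / g n ∧ g (n + P) = g n)
    {i c p : ℕ} (hp : 0 < p)
    (hrefl : ∀ k t, t ≤ c + p * k → a (i + (c + p * k - t)) = a (i + t)) :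
    ∃ l ≥ N, s i = g l := by
  have hgper : ∀ k, ∀ n ≥ N, g (n + P * k) = g n := by
    intro k n hn
    induction k with
    | zero => rfl
    | succ k ih => rw [mul_add, mul_one, ← add_assoc, (hg _ (by omega)).2.2, ih]
  have hpN : N ≤ p * N := Nat.le_mul_of_pos_left N hp
  refine ⟨i + c + 1 + p * N, by omega, eq_of_forall_abs_sub_le_half_pow fun T => ?_⟩
  set l := i + c + 1 + p * N with hl
  set K := N + P * (2 * T + 2) with hK
  have hpK : p * K = p * N + P * (p * (2 * T + 2)) := by rw [hK]; ring
  have hbig : 2 * T + 2 ≤ P * (p * (2 * T + 2)) :=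
    (Nat.le_mul_of_pos_left _ hp).trans (Nat.le_mul_of_pos_left _ hP)
  set L := i + c + 1 + p * K with hL
  have hgl : g L = g l := by
    rw [hL, hpK, ← hgper (p * (2 * T + 2)) l (by omega), hl]; congr 1; ring
  have := abs_sub_le_half_pow T (a := fun n => a (i + n)) (x := fun n => s (i + n))
    (y := fun n => g (L - n)) (fun k => ha _) (fun n _ => hs1 _)
    (fun n hn => (hg _ (by omega)).1) (fun n _ => hs _) (fun n hn => by
      obtain ⟨m, hm⟩ : ∃ m, L - n = m + 1 := ⟨L - n - 1, by omega⟩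
      have e := (hg m (by omega)).2.1
      have e2 := hrefl K n (by omega)
      rw [hm, e, show L - (n + 1) = m by omega, ← e2]
      congr 3
      omega)
  simpa [hgl] using this

theorem burger_equivalent_to_conjugate_iff
    (a : ℕ → ℕ) (ha : ∀ k, 0 < a k) (α : ℝ)
    (hα : Filter.Tendsto (fun i => cfVal (cfPrefix a i)) Filter.atTop (nhds α))
    (hirr : Irrational α)
    (A B C : ℤ) (hA : A ≠ 0)
    (hroot : (A : ℝ) * α ^ 2 + (B : ℝ) * α + (C : ℝ) = 0)
    (α' : ℝ) (hne : α' ≠ α)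
    (hroot' : (A : ℝ) * α' ^ 2 + (B : ℝ) * α' + (C : ℝ) = 0) :
    RealEquiv α α' ↔
      ∃ (N : ℕ) (W : List ℕ), W ≠ [] ∧
        (∀ k, a (N + k) = W.getD (k % W.length) 0) ∧
        (IsMPal 1 W ∨
          ∃ W₁ W₂, W₁ ≠ [] ∧ W₂ ≠ [] ∧ W = W₁ ++ W₂ ∧ IsMPal 1 W₁ ∧ IsMPal 1 W₂) := by
  obtain ⟨s, g, N, P, hs0, hs1, hs, hP, hg⟩ :=
    exists_periodic_quotients ha hα hirr hA hroot hne hroot'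
  constructor
  · intro h
    obtain ⟨i, j, hij⟩ := (h.trans (hg N le_rfl).2.2.2.2).tailEquiv hirr
    have hsi : ∀ n, cfShift^[n] α = s n := by
      intro n
      induction n with
      | zero => exact hs0.symm
      | succ n ih =>
        rw [Function.iterate_succ_apply', ih, hs n, cfShift_nat_add_one_div _ (hs1 _)]
    have hgj : ∀ j n, N ≤ n → cfShift^[j] (g (n + j)) = g n := by
      intro j n hn
      induction j with
      | zero => rfl
      | succ j ih =>
        have h1 := hg (n + j) (by omega)
        rw [Function.iterate_succ_apply, ← add_assoc, h1.2.1, cfShift_nat_add_one_div _ h1.1, ih]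
    have hgper : ∀ k, g (N + P * k) = g N := by
      intro k
      induction k with
      | zero => rfl
      | succ k ih => rw [mul_add, mul_one, ← add_assoc, (hg _ (by omega)).2.2.2.1, ih]
    have hPj : j ≤ P * j := Nat.le_mul_of_pos_left j hP
    have hl := hgj j (N + P * j - j) (by omega)
    rw [Nat.sub_add_cancel (by omega), hgper, ← hij, hsi] at hl
    exact exists_palindromic_period_of_eq ha hs1 hs hP
      (fun n hn => ⟨(hg n hn).1, (hg n hn).2.1, (hg n hn).2.2.1, (hg n hn).2.2.2.1⟩)
      (by omega) hl
  · rintro ⟨i, W, hW, hper, hpal⟩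
    obtain ⟨c, hc⟩ := exists_reflection_of_period (b := fun k => a (i + k)) (fun k => ha _)
      hW hper hpal
    obtain ⟨l, hl, hil⟩ := exists_eq_of_reflection ha hs1 hs hP
      (fun n hn => ⟨(hg n hn).1, (hg n hn).2.1, (hg n hn).2.2.2.1⟩)
      (List.length_pos_iff.2 hW) hc
    have hequiv : ∀ n, RealEquiv α (s n) := by
      intro n
      induction n with
      | zero => rw [hs0]; exact RealEquiv.refl _
      | succ n ih =>
        exact ih.trans (realEquiv_nat_add_one_div (a n) (by linarith [hs1 (n + 1)]) (hs n))
    have := hequiv i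
    rw [hil] at this
    exact this.trans (hg l hl).2.2.2.2.symm
end
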